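/- For any integer n ≥ 2, there exists a pair of r-orthogonal Latin squares of order n if and only if n ≤ r ≤ n², r ∉ {n+1, n²−1}, and (n, r) is not one of the following exceptional pairs: (2,4), (3,5), (3,6), (3,7), (4,7), (4,10), (4,11), (4,13), (4,14), (5,8), (5,9), (5,20), (5,22), (5,23), (6,33), (6,36). -/

import Mathlib

/-- A Latin square of order `n`: each symbol occurs exactly once in each row
and exactly once in each column. -/
def IsLatinSquare {n : ℕ} (A : Fin n → Fin n → Fin n) : Prop :=
  (∀ i, Function.Bijective fun j => A i j) ∧ (∀ j, Function.Bijective fun i => A i j)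

/-- The number of distinct ordered pairs obtained by superimposing `A` and `B`. -/
def orthCount {k n : ℕ} (A B : Fin k → Fin n → Fin n) : ℕ :=
  (Finset.univ.image fun q : Fin k × Fin n => (A q.1 q.2, B q.1 q.2)).card

namespace ROrth

open Finset Function

set_option linter.unusedSectionVars false

/-- Latin property for squares indexed by an arbitrary type. -/
def LatT {X : Type*} (A : X → X → X) : Prop :=
  (∀ i, Injective (A i)) ∧ (∀ j, Injective fun i => A i j)

/-- The set of pairs of two superimposed squares. -/
def prs {X : Type*} [Fintype X] [DecidableEq X] (A B : X → X → X) : Finset (X × X) :=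
  univ.image fun q : X × X => (A q.1 q.2, B q.1 q.2)

/-- There is a pair of `r`-orthogonal squares of order `n`. -/
def Sp (n r : ℕ) : Prop := ∃ A B : Fin n → Fin n → Fin n,
  IsLatinSquare A ∧ IsLatinSquare B ∧ orthCount A B = r

/-- There is a pair of `r`-orthogonal squares on the type `X`. -/
def SpT (X : Type*) [Fintype X] [DecidableEq X] (r : ℕ) : Prop :=
  ∃ A B : X → X → X, LatT A ∧ LatT B ∧ (prs A B).card = r

theorem latT_iff {n : ℕ} (A : Fin n → Fin n → Fin n) : IsLatinSquare A ↔ LatT A := by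
  unfold IsLatinSquare LatT
  constructor
  · rintro ⟨h1, h2⟩
    exact ⟨fun i => (h1 i).1, fun i => (h2 i).1⟩
  · rintro ⟨h1, h2⟩
    exact ⟨fun i => Finite.injective_iff_bijective.1 (h1 i),
      fun i => Finite.injective_iff_bijective.1 (h2 i)⟩

theorem sp_iff_fin {n r : ℕ} : Sp n r ↔ SpT (Fin n) r := by
  unfold Sp SpT
  simp only [latT_iff]
  rfl

theorem SpT.transfer {X Y : Type*} [Fintype X] [DecidableEq X] [Fintype Y] [DecidableEq Y]
    (e : X ≃ Y) {r : ℕ} (h : SpT X r) : SpT Y r := by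
  obtain ⟨A, B, hA, hB, hc⟩ := h
  refine ⟨fun i j => e (A (e.symm i) (e.symm j)), fun i j => e (B (e.symm i) (e.symm j)),
    ?_, ?_, ?_⟩
  · exact ⟨fun i => e.injective.comp ((hA.1 _).comp e.symm.injective),
      fun i => e.injective.comp ((hA.2 _).comp e.symm.injective)⟩
  · exact ⟨fun i => e.injective.comp ((hB.1 _).comp e.symm.injective),
      fun i => e.injective.comp ((hB.2 _).comp e.symm.injective)⟩
  · have : prs (fun i j => e (A (e.symm i) (e.symm j))) (fun i j => e (B (e.symm i) (e.symm j)))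
        = (prs A B).image (Prod.map e e) := by
      ext ⟨x, y⟩
      simp only [prs, mem_image, mem_univ, true_and, Prod.exists, Prod.map, Prod.mk.injEq]
      constructor
      · rintro ⟨a, b, h1, h2⟩
        exact ⟨_, _, ⟨e.symm a, e.symm b, rfl, rfl⟩, h1, h2⟩
      · rintro ⟨a, b, ⟨c, d, rfl, rfl⟩, h1, h2⟩
        exact ⟨e c, e d, by simpa using h1, by simpa using h2⟩
    rw [this, card_image_of_injective _ (e.injective.prodMap e.injective), hc]

theorem sp_iff {X : Type*} [Fintype X] [DecidableEq X] {n r : ℕ} (hX : Fintype.card X = n) :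
    Sp n r ↔ SpT X r := by
  rw [sp_iff_fin]
  have e : X ≃ Fin n := Fintype.equivFinOfCardEq hX
  exact ⟨fun h => h.transfer e.symm, fun h => h.transfer e⟩

/-! ### Filling a hole -/

section hole
variable {G H : Type*} [Fintype G] [DecidableEq G] [Fintype H] [DecidableEq H]

/-- A Latin square with a hole indexed by `H`. -/
structure Frame (A : G ⊕ H → G ⊕ H → G ⊕ H) : Prop where
  row : ∀ g, Injective (A (Sum.inl g))
  col : ∀ g, Injective fun x => A x (Sum.inl g)
  bl : ∀ h g, ∃ g', A (Sum.inr h) (Sum.inl g) = Sum.inl g'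
  blinj : ∀ h, Injective fun g => A (Sum.inr h) (Sum.inl g)
  tr : ∀ g h, ∃ g', A (Sum.inl g) (Sum.inr h) = Sum.inl g'
  trinj : ∀ h, Injective fun g => A (Sum.inl g) (Sum.inr h)

/-- Fill the hole. -/
def fill (A : G ⊕ H → G ⊕ H → G ⊕ H) (C : H → H → H) : G ⊕ H → G ⊕ H → G ⊕ H
  | Sum.inr i, Sum.inr j => Sum.inr (C i j)
  | x, y => A x y

theorem Frame.fill {A : G ⊕ H → G ⊕ H → G ⊕ H} (hA : Frame A) {C : H → H → H}
    (hC : LatT C) : LatT (fill A C) := by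
  constructor
  · rintro (g | h)
    · intro x y hxy
      apply hA.row g
      simpa [ROrth.fill] using hxy
    · rintro (x | x) (y | y) hxy
      · simp only [ROrth.fill] at hxy
        rw [hA.blinj h hxy]
      · obtain ⟨g', hg'⟩ := hA.bl h x
        simp [ROrth.fill, hg'] at hxy
      · obtain ⟨g', hg'⟩ := hA.bl h y
        simp [ROrth.fill, hg'] at hxy
      · simp only [ROrth.fill, Sum.inr.injEq] at hxy
        rw [hC.1 h hxy]
  · rintro (g | h)
    · intro x y hxy
      apply hA.col g
      simpa [ROrth.fill] using hxy
    · rintro (x | x) (y | y) hxy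
      · simp only [ROrth.fill] at hxy
        rw [hA.trinj h hxy]
      · obtain ⟨g', hg'⟩ := hA.tr x h
        simp [ROrth.fill, hg'] at hxy
      · obtain ⟨g', hg'⟩ := hA.tr y h
        simp [ROrth.fill, hg'] at hxy
      · simp only [ROrth.fill, Sum.inr.injEq] at hxy
        rw [hC.2 h hxy]

/-- Cell outside the hole. -/
def Outside (x y : G ⊕ H) : Prop := ∀ i j, ¬ (x = Sum.inr i ∧ y = Sum.inr j)

theorem relabel [Nonempty H] {ρ : ℕ} (h : SpT H ρ) : ∃ C D : H → H → H, LatT C ∧ LatT D ∧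
    (prs C D).card = ρ ∧ ∀ a, (a, a) ∈ prs C D := by
  obtain ⟨C, D, hC, hD, hc⟩ := h
  obtain ⟨i0⟩ := ‹Nonempty H›
  have bC := Finite.injective_iff_bijective.1 (hC.1 i0)
  have bD := Finite.injective_iff_bijective.1 (hD.1 i0)
  let σ : H ≃ H := (Equiv.ofBijective _ bD).symm.trans (Equiv.ofBijective _ bC)
  have hσ : ∀ j, σ (D i0 j) = C i0 j := by
    intro j
    have : (Equiv.ofBijective _ bD).symm (D i0 j) = j :=
      (Equiv.ofBijective _ bD).symm_apply_apply j
    simp [σ, this]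
  refine ⟨C, fun i j => σ (D i j), hC, ⟨fun i => σ.injective.comp (hD.1 i),
    fun j => σ.injective.comp (hD.2 j)⟩, ?_, ?_⟩
  · have : prs C (fun i j => σ (D i j)) = (prs C D).image (Prod.map id σ) := by
      simp only [prs, image_image]
      rfl
    rw [this, card_image_of_injective _ (injective_id.prodMap σ.injective), hc]
  · intro a
    obtain ⟨j, hj⟩ := bC.2 a
    simp only [prs, mem_image, mem_univ, true_and, Prod.exists, Prod.mk.injEq]
    exact ⟨i0, j, hj, by rw [hσ, hj]⟩

/-- The hole lemma. -/
theorem hole_lemma [Nonempty H] {A B : G ⊕ H → G ⊕ H → G ⊕ H} (hA : Frame A) (hB : Frame B)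
    (O : Finset ((G ⊕ H) × (G ⊕ H)))
    (h1 : ∀ x y, Outside x y → (A x y, B x y) ∈ O ∨ ∃ a, A x y = Sum.inr a ∧ B x y = Sum.inr a)
    (h2 : ∀ p ∈ O, ∃ x y, Outside x y ∧ p = (A x y, B x y))
    (h3 : ∀ p ∈ O, Outside p.1 p.2) {ρ : ℕ} (h : SpT H ρ) :
    SpT (G ⊕ H) (O.card + ρ) := by
  obtain ⟨C, D, hC, hD, hc, hdiag⟩ := relabel h
  refine ⟨fill A C, fill B D, hA.fill hC, hB.fill hD, ?_⟩
  have : prs (fill A C) (fill B D) = O ∪ (prs C D).image (Prod.map Sum.inr Sum.inr) := by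
    have hf : ∀ x y, Outside x y → fill A C x y = A x y ∧ fill B D x y = B x y := by
      rintro (x | x) (y | y) hxy
      · exact ⟨rfl, rfl⟩
      · exact ⟨rfl, rfl⟩
      · exact ⟨rfl, rfl⟩
      · exact absurd ⟨rfl, rfl⟩ (hxy x y)
    ext p
    constructor
    · intro hp
      simp only [prs, mem_image, mem_univ, true_and, Prod.exists] at hp
      obtain ⟨x, y, rfl⟩ := hp
      by_cases hxy : Outside x y
      · rw [(hf x y hxy).1, (hf x y hxy).2, mem_union]
        rcases h1 x y hxy with h | ⟨a, ha, hb⟩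
        · exact Or.inl h
        · right
          rw [ha, hb, mem_image]
          exact ⟨(a, a), hdiag a, rfl⟩
      · unfold Outside at hxy
        push Not at hxy
        obtain ⟨i, j, rfl, rfl⟩ := hxy
        rw [mem_union]
        right
        rw [mem_image]
        refine ⟨(C i j, D i j), ?_, rfl⟩
        simp only [prs, mem_image, mem_univ, true_and, Prod.exists]
        exact ⟨i, j, rfl⟩
    · intro hp
      rw [mem_union] at hp
      simp only [prs, mem_image, mem_univ, true_and, Prod.exists]
      rcases hp with hp | hp
      · obtain ⟨x, y, hxy, rfl⟩ := h2 p hp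
        exact ⟨x, y, by rw [(hf x y hxy).1, (hf x y hxy).2]⟩
      · rw [mem_image] at hp
        obtain ⟨q, hq, rfl⟩ := hp
        simp only [prs, mem_image, mem_univ, true_and, Prod.exists] at hq
        obtain ⟨i, j, rfl⟩ := hq
        exact ⟨Sum.inr i, Sum.inr j, rfl⟩
  rw [this, card_union_of_disjoint, card_image_of_injective _
    (Sum.inr_injective.prodMap Sum.inr_injective), hc]
  rw [disjoint_left]
  intro p hp hq
  rw [mem_image] at hq
  obtain ⟨⟨a, b⟩, -, rfl⟩ := hq
  exact h3 _ hp a b ⟨rfl, rfl⟩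

end hole

end ROrth

namespace ROrth
open Finset Function
set_option linter.unusedSectionVars false

/-! ### Bordered circulants -/
section circ
variable {G H : Type*} [Fintype G] [DecidableEq G] [Fintype H] [DecidableEq H] [AddCommGroup G]

/-- Translate the finite part. -/
def sh (t : G) : G ⊕ H → G ⊕ H := Sum.map (fun x => t + x) id

/-- A bordered circulant array. -/
def CS (τ : G →+ G) (a : G → G ⊕ H) (b e : H → G) : G ⊕ H → G ⊕ H → G ⊕ H
  | Sum.inl r, Sum.inl c => sh (τ r) (a (c - r))
  | Sum.inl r, Sum.inr j => Sum.inl (τ r + b j)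
  | Sum.inr j, Sum.inl c => Sum.inl (τ c + e j)
  | Sum.inr i, Sum.inr _ => Sum.inr i

/-- Conditions making a bordered circulant a Latin square with hole. -/
structure CSok (τ : G →+ G) (a : G → G ⊕ H) (b e : H → G) : Prop where
  ainj : Injective a
  binj : Injective b
  ab : ∀ v j, a v ≠ Sum.inl (b j)
  acol : ∀ v w x y, a v = Sum.inl x → a w = Sum.inl y → x - τ v = y - τ w → v = w
  einj : Injective e
  ae : ∀ v x j, a v = Sum.inl x → e j ≠ x - τ v

theorem sh_inj (t : G) : Injective (sh t : G ⊕ H → G ⊕ H) :=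
  Sum.map_injective.2 ⟨add_right_injective t, injective_id⟩

theorem CSok.frame {τ : G →+ G} (hτ : Injective τ) {a : G → G ⊕ H} {b e : H → G}
    (h : CSok τ a b e) : Frame (CS τ a b e) where
  row := by
    rintro g (x | x) (y | y) hxy
    · simp only [CS] at hxy
      have := h.ainj (sh_inj _ hxy)
      rw [sub_left_inj] at this
      rw [this]
    · simp only [CS] at hxy
      have : sh (τ g) (a (x - g)) = sh (τ g) (Sum.inl (b y)) := hxy
      exact absurd (sh_inj _ this) (h.ab _ _)
    · simp only [CS] at hxy
      have : sh (τ g) (a (y - g)) = sh (τ g) (Sum.inl (b x)) := hxy.symm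
      exact absurd (sh_inj _ this) (h.ab _ _)
    · simp only [CS, Sum.inl.injEq, add_right_inj] at hxy
      rw [h.binj hxy]
  col := by
    rintro g (x | x) (y | y) hxy
    · simp only [CS] at hxy
      rcases hx : a (g - x) with u | u <;> rcases hy : a (g - y) with v | v <;>
        rw [hx, hy] at hxy <;> simp only [sh, Sum.map_inl, Sum.map_inr, Sum.inl.injEq,
          Sum.inr.injEq, reduceCtorEq, id] at hxy
      · have : g - x = g - y := by
          apply h.acol _ _ _ _ hx hy
          rw [map_sub, map_sub]
          have h2 : u = τ y + v - τ x := by rw [← hxy]; abel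
          rw [h2]; abel
        rw [sub_right_inj] at this
        rw [this]
      · rw [hxy] at hx
        have : g - x = g - y := h.ainj (hx.trans hy.symm)
        rw [sub_right_inj] at this
        rw [this]
    · simp only [CS] at hxy
      rcases hx : a (g - x) with u | u <;> rw [hx] at hxy <;>
        simp only [sh, Sum.map_inl, Sum.map_inr, Sum.inl.injEq, reduceCtorEq] at hxy
      refine absurd ?_ (h.ae _ _ y hx)
      rw [map_sub]
      have h2 : e y = τ x + u - τ g := by rw [hxy]; abel
      rw [h2]; abel
    · simp only [CS] at hxy
      rcases hx : a (g - y) with u | u <;> rw [hx] at hxy <;>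
        simp only [sh, Sum.map_inl, Sum.map_inr, Sum.inl.injEq, reduceCtorEq] at hxy
      refine absurd ?_ (h.ae _ _ x hx)
      rw [map_sub]
      have h2 : e x = τ y + u - τ g := by rw [← hxy]; abel
      rw [h2]; abel
    · simp only [CS, Sum.inl.injEq, add_right_inj] at hxy
      rw [h.einj hxy]
  bl := fun j g => ⟨_, rfl⟩
  blinj := by
    intro j x y hxy
    simp only [CS, Sum.inl.injEq, add_left_inj] at hxy
    exact hτ hxy
  tr := fun g j => ⟨_, rfl⟩
  trinj := by
    intro j x y hxy
    simp only [CS, Sum.inl.injEq, add_left_inj] at hxy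
    exact hτ hxy

/-- A pair of symbols has the given key. -/
def HasKey : G ⊕ H → G ⊕ H → G ⊕ (H ⊕ H) → Prop
  | Sum.inl x, Sum.inl y, k => k = Sum.inl (y - x)
  | Sum.inl _, Sum.inr j, k => k = Sum.inr (Sum.inl j)
  | Sum.inr j, Sum.inl _, k => k = Sum.inr (Sum.inr j)
  | Sum.inr _, Sum.inr _, _ => False

/-- The pair with given key and translation. -/
def dec : G × (G ⊕ (H ⊕ H)) → (G ⊕ H) × (G ⊕ H)
  | (t, Sum.inl d) => (Sum.inl t, Sum.inl (t + d))
  | (t, Sum.inr (Sum.inl j)) => (Sum.inl t, Sum.inr j)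
  | (t, Sum.inr (Sum.inr j)) => (Sum.inr j, Sum.inl t)

theorem dec_inj : Injective (dec : G × (G ⊕ (H ⊕ H)) → (G ⊕ H) × (G ⊕ H)) := by
  rintro ⟨t, d | j | j⟩ ⟨t', d' | j' | j'⟩ h <;> simp only [dec, Prod.mk.injEq, Sum.inl.injEq,
    Sum.inr.injEq, reduceCtorEq, and_false, false_and] at h
  · obtain ⟨rfl, h⟩ := h
    rw [add_right_inj] at h
    rw [h]
  · rw [h.1, h.2]
  · rw [h.1, h.2]

theorem HasKey.sh_dec {p q : G ⊕ H} {k : G ⊕ (H ⊕ H)} (h : HasKey p q k) (s : G) :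
    ∃ t, (sh s p, sh s q) = dec (t, k) := by
  rcases p with x | x <;> rcases q with y | y <;> simp only [HasKey] at h <;> subst h
  · exact ⟨s + x, by simp [sh, dec]⟩
  · exact ⟨s + x, by simp [sh, dec]⟩
  · exact ⟨s + y, by simp [sh, dec]⟩

theorem HasKey.dec_sh {p q : G ⊕ H} {k : G ⊕ (H ⊕ H)} (h : HasKey p q k) (t : G) :
    ∃ s, dec (t, k) = (sh s p, sh s q) := by
  rcases p with x | x <;> rcases q with y | y <;> simp only [HasKey] at h <;> subst h
  · exact ⟨t - x, by simp [sh, dec]; abel⟩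
  · exact ⟨t - x, by simp [sh, dec]⟩
  · exact ⟨t - y, by simp [sh, dec]⟩

theorem circ_lemma [Nonempty H] {τ : G →+ G} (hτ : Injective τ) {a a' : G → G ⊕ H}
    {b e b' e' : H → G} (h : CSok τ a b e) (h' : CSok τ a' b' e')
    (K : Finset (G ⊕ (H ⊕ H)))
    (hd : ∀ v i j, a v = Sum.inr i → a' v = Sum.inr j → i = j)
    (hK : ∀ k, k ∈ K ↔ ((∃ v, HasKey (a v) (a' v) k) ∨ (∃ j, k = Sum.inl (b' j - b j)) ∨
      (∃ j, k = Sum.inl (e' j - e j)))) {ρ : ℕ} (hρ : SpT H ρ) :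
    SpT (G ⊕ H) (Fintype.card G * K.card + ρ) := by
  have hsur : Surjective τ := Finite.surjective_of_injective hτ
  have := hole_lemma (h.frame hτ) (h'.frame hτ) ((univ ×ˢ K).image dec) ?_ ?_ ?_ hρ
  · rwa [card_image_of_injective _ dec_inj, card_product, card_univ] at this
  · rintro (x | x) (y | y) hxy
    · simp only [CS]
      by_cases hk : ∃ k, HasKey (a (y - x)) (a' (y - x)) k
      · left
        obtain ⟨k, hk⟩ := hk
        obtain ⟨t, ht⟩ := hk.sh_dec (τ x)
        rw [ht, mem_image]
        exact ⟨(t, k), by simp [(hK k).2 (Or.inl ⟨_, hk⟩)], rfl⟩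
      · right
        rcases ha : a (y - x) with u | u <;> rcases ha' : a' (y - x) with v | v <;>
          rw [ha, ha'] at hk <;> simp only [HasKey, exists_eq, not_true] at hk
        have := hd _ _ _ ha ha'
        subst this
        exact ⟨u, rfl, rfl⟩
    · left
      rw [mem_image]
      refine ⟨(τ x + b y, Sum.inl (b' y - b y)), ?_, ?_⟩
      · simp [(hK _).2 (Or.inr (Or.inl ⟨y, rfl⟩))]
      · simp [dec, CS]
    · left
      rw [mem_image]
      refine ⟨(τ y + e x, Sum.inl (e' x - e x)), ?_, ?_⟩
      · simp [(hK _).2 (Or.inr (Or.inr ⟨x, rfl⟩))]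
      · simp [dec, CS]
    · exact absurd ⟨rfl, rfl⟩ (hxy x y)
  · intro p hp
    rw [mem_image] at hp
    obtain ⟨⟨t, k⟩, hk, rfl⟩ := hp
    simp only [mem_product, mem_univ, true_and] at hk
    rcases (hK k).1 hk with ⟨v, hv⟩ | ⟨j, rfl⟩ | ⟨j, rfl⟩
    · obtain ⟨s, hs⟩ := hv.dec_sh t
      obtain ⟨r, rfl⟩ := hsur s
      refine ⟨Sum.inl r, Sum.inl (r + v), by simp [Outside], ?_⟩
      simp [CS, hs]
    · obtain ⟨r, hr⟩ := hsur (t - b j)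
      refine ⟨Sum.inl r, Sum.inr j, by simp [Outside], ?_⟩
      simp [CS, dec, hr]; abel
    · obtain ⟨r, hr⟩ := hsur (t - e j)
      refine ⟨Sum.inr j, Sum.inl r, by simp [Outside], ?_⟩
      simp [CS, dec, hr]; abel
  · intro p hp
    rw [mem_image] at hp
    obtain ⟨⟨t, d | j | j⟩, -, rfl⟩ := hp <;> simp [dec, Outside]

end circ
end ROrth

namespace ROrth
open Finset Function
set_option linter.unusedSectionVars false

/-! ### The family of bordered circulants for the middle of the spectrum -/
section mid
variable {m h : ℕ} [NeZero m]

theorem cast_inj_of_lt {a b : ℕ} (ha : a < m) (hb : b < m) (hab : (a : ZMod m) = b) : a = b := by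
  have := congrArg ZMod.val hab
  rwa [ZMod.val_cast_of_lt ha, ZMod.val_cast_of_lt hb] at this

/-- First row of the circulant part. -/
def aS (m h s : ℕ) (v : ZMod m) : ZMod m ⊕ Fin h :=
  if hv : s ≤ v.val ∧ v.val < s + h then
    Sum.inr ⟨(if v.val < h then v.val else v.val - h) % h, Nat.mod_lt _ (by omega)⟩
  else Sum.inl v

theorem aS_inl {s : ℕ} {v x : ZMod m} (hx : aS m h s v = Sum.inl x) :
    x = v ∧ ¬ (s ≤ v.val ∧ v.val < s + h) := by
  unfold aS at hx
  split_ifs at hx with hv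
  exact ⟨(Sum.inl.inj hx).symm, hv⟩

theorem aS_inr {s : ℕ} (hs : s ≤ h) {v : ZMod m} {j : Fin h} (hx : aS m h s v = Sum.inr j) :
    (s ≤ v.val ∧ v.val < s + h) ∧ ((v.val < h ∧ j.val = v.val) ∨ (h ≤ v.val ∧ j.val + h = v.val)) := by
  unfold aS at hx
  split_ifs at hx with hv hc
  · refine ⟨hv, ?_⟩
    have := congrArg Fin.val (Sum.inr.inj hx)
    simp only at this
    rw [Nat.mod_eq_of_lt hc] at this; omega
  · refine ⟨hv, ?_⟩
    have := congrArg Fin.val (Sum.inr.inj hx)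
    simp only at this
    rw [Nat.mod_eq_of_lt (by omega)] at this; omega

theorem aS_of_not {s : ℕ} {v : ZMod m} (hv : ¬ (s ≤ v.val ∧ v.val < s + h)) :
    aS m h s v = Sum.inl v := by
  unfold aS
  rw [dif_neg hv]

theorem aS_of {s : ℕ} (hs : s ≤ h) {v : ZMod m} (hv : s ≤ v.val ∧ v.val < s + h) (j : Fin h)
    (hj : (v.val < h ∧ j.val = v.val) ∨ (h ≤ v.val ∧ j.val + h = v.val)) :
    aS m h s v = Sum.inr j := by
  unfold aS
  rw [dif_pos hv]
  congr 1
  apply Fin.ext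
  simp only
  by_cases hc : v.val < h
  · rw [if_pos hc, Nat.mod_eq_of_lt hc]; omega
  · rw [if_neg hc, Nat.mod_eq_of_lt (by omega)]; omega

/-- Doubling. -/
def dbl (m : ℕ) : ZMod m →+ ZMod m := AddMonoidHom.mulLeft 2

theorem dbl_apply (v : ZMod m) : dbl m v = v + v := by
  simp [dbl, two_mul]

theorem dbl_inj (hm : Odd m) : Injective (dbl m) := by
  have hu : IsUnit (2 : ZMod m) := by
    have := (ZMod.isUnit_iff_coprime 2 m).2 (Nat.coprime_two_left.2 hm)
    simpa using this
  intro x y hxy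
  exact hu.mul_left_cancel hxy

theorem aS_ok {s : ℕ} (hs : s ≤ h) (hm : s + h ≤ m) (π1 π2 : Equiv.Perm (Fin h)) :
    CSok (dbl m) (aS m h s) (fun j => ((s + π1 j : ℕ) : ZMod m))
      (fun j => - ((s + π2 j : ℕ) : ZMod m)) where
  ainj := by
    intro v w hvw
    rcases hw : aS m h s w with x | j
    · rw [hw] at hvw
      rw [← (aS_inl hvw).1, ← (aS_inl hw).1]
    · rw [hw] at hvw
      have h1 := aS_inr hs hvw
      have h2 := aS_inr hs hw
      apply ZMod.val_injective
      omega
  binj := by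
    intro i j hij
    have := cast_inj_of_lt (m := m) (by omega) (by omega) hij
    exact π1.injective (Fin.ext (by omega))
  ab := by
    intro v j hv
    have h1 := aS_inl hv
    rw [← h1.1, ZMod.val_cast_of_lt (by omega)] at h1
    omega
  acol := by
    intro v w x y hv hw hxy
    rw [(aS_inl hv).1, (aS_inl hw).1, dbl_apply, dbl_apply] at hxy
    simpa using hxy
  einj := by
    intro i j hij
    have := cast_inj_of_lt (m := m) (by omega) (by omega) (neg_injective hij)
    exact π2.injective (Fin.ext (by omega))
  ae := by
    intro v x j hv hj
    have h1 := aS_inl hv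
    rw [h1.1, dbl_apply] at hj
    simp only [sub_add_cancel_left, neg_inj] at hj
    rw [← hj, ZMod.val_cast_of_lt (by omega)] at h1
    omega

/-- Differences occurring. -/
def XX (m h s : ℕ) (π1 π2 : Equiv.Perm (Fin h)) : Finset (ZMod m) :=
  (if s + h < m then {0} else ∅) ∪
    (univ.image fun j => ((s + π1 j : ℕ) : ZMod m) - ((j : ℕ) : ZMod m)) ∪
    (univ.image fun j => - ((s + π2 j : ℕ) : ZMod m) - - ((j : ℕ) : ZMod m))

theorem mid_lemma (hm : Odd m) (hh : 0 < h) {s : ℕ} (hs : s ≤ h) (hsm : s + h ≤ m)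
    (π1 π2 : Equiv.Perm (Fin h)) {ρ : ℕ} (hρ : Sp h ρ) :
    Sp (m + h) (m * (2 * s + (XX m h s π1 π2).card) + ρ) := by
  have : Nonempty (Fin h) := ⟨⟨0, hh⟩⟩
  have hX : Fintype.card (ZMod m ⊕ Fin h) = m + h := by simp [ZMod.card]
  rw [sp_iff hX]
  rw [sp_iff_fin] at hρ
  have h0 := aS_ok (m := m) (h := h) (s := 0) (by omega) (by omega) (Equiv.refl _) (Equiv.refl _)
  have hs' := aS_ok (m := m) hs hsm π1 π2
  let S : Finset (Fin h) := univ.filter fun j => j.val < s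
  have hS : S.card = s := by
    simp only [S]
    have := Fin.card_filter_val_lt (n := h) (m := s)
    rw [this]; omega
  have key := circ_lemma (dbl_inj hm) h0 hs' ((XX m h s π1 π2).disjSum (S.disjSum S)) ?_ ?_ hρ
  · rw [card_disjSum, card_disjSum, hS, ZMod.card] at key
    convert key using 2
    ring
  · intro v i j hi hj
    have h1 := aS_inr (Nat.zero_le _) hi
    have h2 := aS_inr hs hj
    apply Fin.ext
    omega
  · rintro (d | j | j)
    · rw [inl_mem_disjSum]
      simp only [XX, mem_union, mem_image, mem_univ, true_and, Sum.inl.injEq, Equiv.refl_apply,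
        zero_add]
      have : (∃ v, HasKey (aS m h 0 v) (aS m h s v) (Sum.inl d)) ↔
          d ∈ (if s + h < m then {0} else ∅ : Finset (ZMod m)) := by
        constructor
        · rintro ⟨v, hv⟩
          have hvm := ZMod.val_lt v
          rcases h1 : aS m h 0 v with x | x <;> rcases h2 : aS m h s v with y | y <;>
            rw [h1, h2] at hv <;> simp only [HasKey, reduceCtorEq, Sum.inl.injEq] at hv
          have h3 := aS_inl h1
          have h4 := aS_inl h2
          rw [if_pos (by omega), hv, h3.1, h4.1]
          simp
        · intro hd
          split_ifs at hd with hlt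
          · refine ⟨((s + h : ℕ) : ZMod m), ?_⟩
            have hv := ZMod.val_cast_of_lt hlt
            rw [aS_of_not (by omega), aS_of_not (by omega)]
            simpa [HasKey] using hd
          · simp at hd
      rw [this, or_assoc]
      constructor
      · rintro (h | ⟨j, h⟩ | ⟨j, h⟩)
        · exact Or.inl h
        · exact Or.inr (Or.inl ⟨j, h.symm⟩)
        · exact Or.inr (Or.inr ⟨j, h.symm⟩)
      · rintro (h | ⟨j, h⟩ | ⟨j, h⟩)
        · exact Or.inl h
        · exact Or.inr (Or.inl ⟨j, h.symm⟩)
        · exact Or.inr (Or.inr ⟨j, h.symm⟩)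
    · rw [inr_mem_disjSum, inl_mem_disjSum]
      simp only [S, mem_filter, mem_univ, true_and, reduceCtorEq, exists_false, or_false]
      constructor
      · intro hj
        have hv := ZMod.val_cast_of_lt (show j.val + h < m by omega)
        refine ⟨((j.val + h : ℕ) : ZMod m), ?_⟩
        rw [aS_of_not (by omega), aS_of hs (by omega) j (by omega)]
        simp [HasKey]
      · rintro ⟨v, hv⟩
        rcases h1 : aS m h 0 v with x | x <;> rcases h2 : aS m h s v with y | y <;>
            rw [h1, h2] at hv <;> simp only [HasKey, reduceCtorEq, Sum.inl.injEq, Sum.inr.injEq] at hv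
        subst hv
        have h3 := aS_inl h1
        have h4 := aS_inr hs h2
        omega
    · rw [inr_mem_disjSum, inr_mem_disjSum]
      simp only [S, mem_filter, mem_univ, true_and, reduceCtorEq, exists_false, or_false]
      constructor
      · intro hj
        have hv := ZMod.val_cast_of_lt (show j.val < m by omega)
        refine ⟨((j.val : ℕ) : ZMod m), ?_⟩
        rw [aS_of (s := 0) (Nat.zero_le _) (by omega) j (by omega), aS_of_not (by omega)]
        simp [HasKey]
      · rintro ⟨v, hv⟩
        rcases h1 : aS m h 0 v with x | x <;> rcases h2 : aS m h s v with y | y <;>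
            rw [h1, h2] at hv <;> simp only [HasKey, reduceCtorEq, Sum.inl.injEq, Sum.inr.injEq] at hv
        subst hv
        have h3 := aS_inr (Nat.zero_le _) h1
        have h4 := aS_inl h2
        omega

/-- Reverse the outer `p` positions on both sides. -/
def revf (h p : ℕ) (j : Fin h) : Fin h :=
  if j.val < p ∨ h ≤ j.val + p then ⟨h - 1 - j.val, by omega⟩ else j

theorem revf_inv (h p : ℕ) : Involutive (revf h p) := by
  intro j
  apply Fin.ext
  unfold revf
  by_cases hj : j.val < p ∨ h ≤ j.val + p
  · rw [if_pos hj, if_pos (by simp only; omega)]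
    simp only; omega
  · rw [if_neg hj, if_neg hj]

/-- The same as a permutation. -/
def rev (h p : ℕ) : Equiv.Perm (Fin h) := (revf_inv h p).toPerm

theorem rev_val (h p : ℕ) (j : Fin h) :
    (rev h p j).val = if j.val < p ∨ h ≤ j.val + p then h - 1 - j.val else j.val := by
  show (revf h p j).val = _
  unfold revf
  split_ifs <;> rfl

/-- number of key classes -/
def kf (m h s p q : ℕ) [NeZero m] : ℕ := 2 * s + (XX m h s (rev h p) (rev h q)).card

theorem rev_succ {p : ℕ} {j : Fin h} (h1 : j.val ≠ p) (h2 : j.val + p + 1 ≠ h) :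
    (rev h (p + 1) j).val = (rev h p j).val := by
  rw [rev_val, rev_val]
  split_ifs <;> omega

theorem card_image_step (f g : Fin h → ZMod m) (Z : Finset (ZMod m)) (p : ℕ)
    (hfg : ∀ j : Fin h, j.val ≠ p → j.val + p + 1 ≠ h → f j = g j) :
    (Z ∪ univ.image f).card ≤ (Z ∪ univ.image g).card + 2 := by
  by_cases hp : p < h
  · have : Z ∪ univ.image f ⊆ insert (f ⟨p, hp⟩) (insert (f ⟨h - 1 - p, by omega⟩)
        (Z ∪ univ.image g)) := by
      intro x hx
      simp only [mem_union, mem_image, mem_univ, true_and, mem_insert] at hx ⊢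
      rcases hx with hx | ⟨j, rfl⟩
      · tauto
      · by_cases h1 : j.val = p
        · left; congr 1; exact Fin.ext h1
        · by_cases h2 : j.val + p + 1 = h
          · right; left; congr 1; apply Fin.ext; simp only; omega
          · right; right; right; exact ⟨j, (hfg j h1 h2).symm⟩
    refine (card_le_card this).trans ?_
    refine (card_insert_le _ _).trans ?_
    have := card_insert_le (f ⟨h - 1 - p, by omega⟩) (Z ∪ univ.image g)
    omega
  · have : univ.image f = univ.image g := by
      congr 1
      ext j
      rw [hfg j (by omega) (by omega)]
    rw [this]; omega

theorem kf_stepq (s p q : ℕ) : kf m h s p (q + 1) ≤ kf m h s p q + 2 := by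
  unfold kf XX
  have := card_image_step (fun j => - ((s + rev h (q+1) j : ℕ) : ZMod m) - - ((j : ℕ) : ZMod m))
    (fun j => - ((s + rev h q j : ℕ) : ZMod m) - - ((j : ℕ) : ZMod m))
    ((if s + h < m then {0} else ∅) ∪
    (univ.image fun j => ((s + rev h p j : ℕ) : ZMod m) - ((j : ℕ) : ZMod m))) q
    (by intro j h1 h2; rw [rev_succ h1 h2])
  omega

theorem kf_stepp (s p q : ℕ) : kf m h s (p + 1) q ≤ kf m h s p q + 2 := by
  unfold kf XX
  have := card_image_step (fun j => ((s + rev h (p+1) j : ℕ) : ZMod m) - ((j : ℕ) : ZMod m))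
    (fun j => ((s + rev h p j : ℕ) : ZMod m) - ((j : ℕ) : ZMod m))
    ((if s + h < m then {0} else ∅) ∪
    (univ.image fun j => - ((s + rev h q j : ℕ) : ZMod m) - - ((j : ℕ) : ZMod m))) p
    (by intro j h1 h2; rw [rev_succ h1 h2])
  rw [union_right_comm] at this
  have e := congrArg card (union_right_comm (if s + h < m then {0} else ∅)
    (univ.image fun j => - ((s + rev h q j : ℕ) : ZMod m) - - ((j : ℕ) : ZMod m))
    (univ.image fun j => ((s + rev h p j : ℕ) : ZMod m) - ((j : ℕ) : ZMod m)))
  omega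

theorem rev_zero (j : Fin h) : (rev h 0 j).val = j.val := by
  rw [rev_val, if_neg (by omega)]

theorem XX_zero (hh : 0 < h) (s : ℕ) : XX m h s (rev h 0) (rev h 0) =
    (if s + h < m then {0} else ∅) ∪ {(s : ZMod m), - (s : ZMod m)} := by
  have : Nonempty (Fin h) := ⟨⟨0, hh⟩⟩
  unfold XX
  simp only [rev_zero, Nat.cast_add, add_sub_cancel_right]
  ext x
  simp [eq_comm, or_assoc]
  try tauto

theorem neg_ne (hm : Odd m) {s : ℕ} (h0 : 0 < s) (hs : s < m) : (s : ZMod m) ≠ 0 ∧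
    - (s : ZMod m) ≠ 0 ∧ (s : ZMod m) ≠ - (s : ZMod m) := by
  have h1 : (s : ZMod m) ≠ 0 := by
    intro h
    have := cast_inj_of_lt (m := m) hs (by omega : 0 < m) (by simpa using h)
    omega
  refine ⟨h1, neg_ne_zero.2 h1, fun h => h1 ?_⟩
  apply dbl_inj hm
  rw [dbl_apply, map_zero]
  nth_rewrite 1 [h]
  simp

theorem kf_one (hh : 0 < h) (hm : h < m) : kf m h 0 0 0 = 1 := by
  unfold kf
  rw [XX_zero hh, if_pos (by omega)]
  simp

theorem kf_s (hh : 0 < h) (hm : Odd m) {s : ℕ} (h0 : 0 < s) (hs : s + h < m) :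
    kf m h s 0 0 = 2 * s + 3 := by
  unfold kf
  rw [XX_zero hh, if_pos hs]
  obtain ⟨h1, h2, h3⟩ := neg_ne (m := m) hm h0 (by omega)
  rw [singleton_union, card_eq_three.2 ⟨_, _, _, h1.symm, h2.symm, h3, rfl⟩]

theorem kf_s_le (hh : 0 < h) (s : ℕ) : kf m h s 0 0 ≤ 2 * s + 3 := by
  unfold kf
  rw [XX_zero hh]
  have : (if s + h < m then {0} else ∅ : Finset (ZMod m)) ∪ {(s : ZMod m), - (s : ZMod m)} ⊆
      {0, (s : ZMod m), - (s : ZMod m)} := by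
    split_ifs
    · rw [singleton_union]
    · rw [empty_union]; exact subset_insert _ _
  have := (card_le_card this).trans card_le_three
  omega

theorem kf_three (hh : 2 ≤ h) (hm : Odd m) (hhm : h < m) : kf m h 0 1 0 = 3 := by
  unfold kf
  obtain ⟨h1, h2, h3⟩ := neg_ne (m := m) hm (s := h - 1) (by omega) (by omega)
  have : XX m h 0 (rev h 1) (rev h 0) = {0, ((h - 1 : ℕ) : ZMod m), - ((h - 1 : ℕ) : ZMod m)} := by
    unfold XX
    rw [if_pos (by omega)]
    ext x
    simp only [mem_union, mem_image, mem_univ, true_and, mem_insert, mem_singleton, rev_zero,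
      zero_add]
    constructor
    · rintro ((h | ⟨j, rfl⟩) | ⟨j, rfl⟩)
      · tauto
      · rw [rev_val]
        by_cases hj : j.val = 0
        · right; left; rw [if_pos (by omega), hj]; simp
        · by_cases hj' : j.val + 1 = h
          · right; right
            rw [if_pos (by omega), show h - 1 - j.val = 0 by omega, show j.val = h - 1 by omega]; simp
          · left; rw [if_neg (by omega)]; simp
      · left; simp
    · rintro (hx | hx | hx)
      · tauto
      · left; right
        refine ⟨⟨0, by omega⟩, ?_⟩
        rw [rev_val, if_pos (by simp)]; simp [hx]
      · left; right
        refine ⟨⟨h - 1, by omega⟩, ?_⟩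
        rw [rev_val, if_pos (by simp only; omega)]; simp [hx]
  rw [this, card_eq_three.2 ⟨_, _, _, h1.symm, h2.symm, h3, rfl⟩]

end mid

theorem ivt (g : ℕ → ℕ) (T L : ℕ) (h0 : g 0 ≤ T) (hs : ∀ i, g (i + 1) ≤ g i + 2)
    (hL : T ≤ g L) : ∃ i, g i = T ∨ g i + 1 = T := by
  induction L with
  | zero => exact ⟨0, by omega⟩
  | succ k ih =>
    by_cases h : T ≤ g k
    · exact ih h
    · have := hs k
      by_cases h2 : g (k + 1) = T
      · exact ⟨k + 1, Or.inl h2⟩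
      · exact ⟨k, by omega⟩

/-- The whole expected spectrum is realized. -/
def Full (n : ℕ) : Prop := ∀ r, n ≤ r → r ≤ n ^ 2 → r ≠ n + 1 → r ≠ n ^ 2 - 1 → Sp n r

theorem kf_cover {m h S : ℕ} [NeZero m] (hm : Odd m) (hh : 2 ≤ h) (hhm : h < m) (hS : 1 ≤ S)
    (hSm : S + h ≤ m) {T : ℕ} (hT : 1 ≤ T) (hTK : T ≤ kf m h S h h) :
    ∃ s p q, s ≤ S ∧ (kf m h s p q = T ∨ kf m h s p q + 1 = T) := by
  by_cases h1 : T ≤ 2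
  · exact ⟨0, 0, 0, by omega, by rw [kf_one (by omega) hhm]; omega⟩
  by_cases h2 : T ≤ 4
  · exact ⟨0, 1, 0, by omega, by rw [kf_three hh hm hhm]; omega⟩
  by_cases h3 : T ≤ 2 * S + 2
  · refine ⟨(T - 3) / 2, 0, 0, by omega, ?_⟩
    rw [kf_s (by omega) hm (by omega) (by omega)]
    omega
  · have a1 : (fun i => kf m h S (min i h) (i - h)) 0 ≤ T := by
      have := kf_s_le (m := m) (h := h) (by omega) S
      simp only [Nat.zero_sub, Nat.zero_min]
      omega
    have a2 : ∀ i, (fun i => kf m h S (min i h) (i - h)) (i + 1) ≤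
        (fun i => kf m h S (min i h) (i - h)) i + 2 := by
      intro i
      simp only
      by_cases hi : i < h
      · rw [show min (i + 1) h = i + 1 by omega, show min i h = i by omega,
          show i + 1 - h = 0 by omega, show i - h = 0 by omega]
        exact kf_stepp _ _ _
      · rw [show min (i + 1) h = h by omega, show min i h = h by omega,
          show i + 1 - h = (i - h) + 1 by omega]
        exact kf_stepq _ _ _
    have a3 : T ≤ (fun i => kf m h S (min i h) (i - h)) (2 * h) := by
      simp only
      rwa [show min (2 * h) h = h by omega, show 2 * h - h = h by omega]
    obtain ⟨i, hi⟩ := ivt (fun i => kf m h S (min i h) (i - h)) T (2 * h) a1 a2 a3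
    exact ⟨S, _, _, le_rfl, hi⟩

theorem mid_range {m h S : ℕ} [NeZero m] (hm : Odd m) (hh : 2 ≤ h) (hhm : h < m) (hS : 1 ≤ S)
    (hSh : S ≤ h) (hSm : S + h ≤ m) (hF : Full h) (hbig : 2 * m + h + 3 ≤ h ^ 2) {r : ℕ}
    (hr : r = m + h ∨ (m + h + 2 ≤ r ∧ r + 2 ≤ m * kf m h S h h + h ^ 2) ∨
      r = m * kf m h S h h + h ^ 2) : Sp (m + h) r := by
  rcases hr with rfl | ⟨h1, h2⟩ | rfl
  · have := mid_lemma (m := m) hm (by omega) (s := 0) (by omega) (by omega) (rev h 0) (rev h 0)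
      (hF h le_rfl (by nlinarith) (by omega) (by nlinarith [Nat.sub_add_cancel (show 1 ≤ h^2 by nlinarith)]))
    have hk := kf_one (m := m) (h := h) (by omega) hhm
    unfold kf at hk
    rw [hk] at this
    simpa using this
  · set K := kf m h S h h with hK
    have hmpos : 0 < m := by omega
    set T := (r - h - 2) / m with hT
    have hT1 : m * T ≤ r - h - 2 := Nat.mul_div_le _ _
    have hT2 : r - h - 2 < m * T + m := by
      have := Nat.lt_mul_div_succ (r - h - 2) hmpos
      rw [← hT, mul_add, mul_one] at this
      exact this
    have hTpos : 1 ≤ T := by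
      rw [hT, Nat.one_le_div_iff hmpos]; omega
    by_cases hTK : T ≤ K
    · obtain ⟨s, p, q, hs, hk⟩ := kf_cover hm hh hhm hS hSm hTpos hTK
      have hle : m * kf m h s p q ≤ m * T := Nat.mul_le_mul_left _ (by omega)
      have hge : m * T ≤ m * kf m h s p q + m := by
        rw [← mul_add_one]; exact Nat.mul_le_mul_left _ (by omega)
      have := mid_lemma (m := m) hm (by omega) (s := s) (by omega) (by omega) (rev h p) (rev h q)
        (hF (r - m * kf m h s p q) (by omega) (by omega) (by omega) (by omega))
      unfold kf at *
      rwa [Nat.add_sub_cancel' (by omega)] at this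
    · have hge : m * K + m ≤ m * T := by
        rw [← mul_add_one]; exact Nat.mul_le_mul_left _ (by omega)
      have := mid_lemma (m := m) hm (by omega) (s := S) (by omega) (by omega) (rev h h) (rev h h)
        (hF (r - m * K) (by omega) (by omega) (by omega) (by omega))
      unfold kf at hK
      rw [← hK] at this
      rwa [Nat.add_sub_cancel' (by omega)] at this
  · exact mid_lemma (m := m) hm (by omega) hSh hSm (rev h h) (rev h h)
        (hF _ (by nlinarith) le_rfl (by omega) (by omega))

end ROrth

namespace ROrth
open Finset Function
set_option linter.unusedSectionVars false

/-! ### The three residue classes modulo three -/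

theorem XX_end {m h S : ℕ} [NeZero m] {v : ℕ} (hv : v + 1 ≤ S + h) (hp : (v + S + h) % 2 = 1)
    (hv2 : S + 1 ≤ v + h) :
    (v : ZMod m) ∈ XX m h S (rev h h) (rev h h) ∧ (-(v : ZMod m)) ∈ XX m h S (rev h h) (rev h h) := by
  have hj : (S + h - 1 - v) / 2 < h := by omega
  have e : ((S + (h - 1 - (S + h - 1 - v) / 2) : ℕ) : ZMod m) =
      ((v + (S + h - 1 - v) / 2 : ℕ) : ZMod m) := by
    congr 1; omega
  unfold XX
  simp only [mem_union, mem_image, mem_univ, true_and]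
  constructor
  · left; right
    refine ⟨⟨(S + h - 1 - v) / 2, hj⟩, ?_⟩
    rw [rev_val, if_pos (Or.inl hj)]
    simp only
    rw [e]; push_cast; ring
  · right
    refine ⟨⟨(S + h - 1 - v) / 2, hj⟩, ?_⟩
    rw [rev_val, if_pos (Or.inl hj)]
    simp only
    rw [e]; push_cast; ring

theorem zero_mem_XX {m h S : ℕ} [NeZero m] (hS : S + h < m) (π π' : Equiv.Perm (Fin h)) :
    (0 : ZMod m) ∈ XX m h S π π' := by
  unfold XX
  rw [if_pos hS]
  simp

theorem zmod_neg {m : ℕ} [NeZero m] (x : ZMod m) : x = - ((m - x.val : ℕ) : ZMod m) := by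
  rw [Nat.cast_sub (ZMod.val_lt x).le]
  simp

theorem K1 (h : ℕ) (hh : 2 ≤ h) : kf (2 * h + 1) h h h h = 4 * h + 1 := by
  unfold kf
  have : XX (2 * h + 1) h h (rev h h) (rev h h) = univ := by
    ext x
    simp only [mem_univ, iff_true]
    have hx := ZMod.val_lt x
    by_cases h0 : x.val = 0
    · rw [(ZMod.val_eq_zero x).1 h0]
      exact zero_mem_XX (by omega) _ _
    · by_cases h1 : x.val % 2 = 1
      · have := (XX_end (m := 2 * h + 1) (h := h) (S := h) (v := x.val)
          (by omega) (by omega) (by omega)).1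
        rwa [ZMod.natCast_zmod_val] at this
      · have := (XX_end (m := 2 * h + 1) (h := h) (S := h) (v := 2 * h + 1 - x.val)
          (by omega) (by omega) (by omega)).2
        rwa [← zmod_neg] at this
  rw [this, card_univ, ZMod.card]
  omega

theorem K2 (h : ℕ) (hh : 2 ≤ h) [NeZero (2 * h - 1)] : kf (2 * h - 1) h (h - 1) h h = 4 * h - 3 := by
  unfold kf
  have : XX (2 * h - 1) h (h - 1) (rev h h) (rev h h) = univ := by
    ext x
    simp only [mem_univ, iff_true]
    have hx := ZMod.val_lt x
    by_cases h1 : x.val % 2 = 0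
    · have := (XX_end (m := 2 * h - 1) (h := h) (S := h - 1) (v := x.val)
          (by omega) (by omega) (by omega)).1
      rwa [ZMod.natCast_zmod_val] at this
    · have := (XX_end (m := 2 * h - 1) (h := h) (S := h - 1) (v := 2 * h - 1 - x.val)
          (by omega) (by omega) (by omega)).2
      rwa [← zmod_neg] at this
  rw [this, card_univ, ZMod.card]
  omega

theorem K3 (h : ℕ) (hh : 2 ≤ h) : 4 * h + 1 ≤ kf (2 * h + 3) h h h h := by
  unfold kf
  have : (univ : Finset (ZMod (2 * h + 3))) ⊆
      insert 2 (insert (-2) (XX (2 * h + 3) h h (rev h h) (rev h h))) := by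
    intro x _
    simp only [mem_insert]
    have hx := ZMod.val_lt x
    by_cases h0 : x.val = 0
    · rw [(ZMod.val_eq_zero x).1 h0]
      right; right
      exact zero_mem_XX (by omega) _ _
    by_cases h2 : x.val = 2
    · left
      rw [← ZMod.natCast_zmod_val x, h2]; simp
    by_cases h3 : x.val = 2 * h + 1
    · right; left
      rw [zmod_neg x, h3, show 2 * h + 3 - (2 * h + 1) = 2 by omega]; simp
    right; right
    by_cases h1 : x.val % 2 = 1
    · have := (XX_end (m := 2 * h + 3) (h := h) (S := h) (v := x.val)
        (by omega) (by omega) (by omega)).1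
      rwa [ZMod.natCast_zmod_val] at this
    · have := (XX_end (m := 2 * h + 3) (h := h) (S := h) (v := 2 * h + 3 - x.val)
        (by omega) (by omega) (by omega)).2
      rwa [← zmod_neg] at this
  have := card_le_card this
  rw [card_univ, ZMod.card] at this
  have h1 := card_insert_le (2 : ZMod (2 * h + 3)) (insert (-2) (XX (2 * h + 3) h h (rev h h) (rev h h)))
  have h2 := card_insert_le (-2 : ZMod (2 * h + 3)) (XX (2 * h + 3) h h (rev h h) (rev h h))
  omega

theorem res1 {h : ℕ} (hh : 7 ≤ h) (hF : Full h) : Full (3 * h + 1) := by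
  intro r h1 h2 h3 h4
  have := mid_range (m := 2 * h + 1) (h := h) (S := h) ⟨h, rfl⟩ (by omega) (by omega) (by omega)
    le_rfl (by omega) hF (by nlinarith) (r := r) (by
      rw [K1 h (by omega)]
      have e : (2 * h + 1) * (4 * h + 1) + h ^ 2 = (3 * h + 1) ^ 2 := by ring
      rw [e]
      omega)
  rwa [show 2 * h + 1 + h = 3 * h + 1 by ring] at this

theorem res2 {h r : ℕ} (hh : 7 ≤ h) (hF : Full h) (h1 : 3 * h - 1 ≤ r) (h2 : r ≠ 3 * h)
    (h3 : r + 4 * h ≤ (3 * h - 1) ^ 2) : Sp (3 * h - 1) r := by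
  have : NeZero (2 * h - 1) := ⟨by omega⟩
  have := mid_range (m := 2 * h - 1) (h := h) (S := h - 1) ⟨h - 1, by omega⟩ (by omega) (by omega)
    (by omega) (by omega) (by omega) hF (by
      have : 7 * h ≤ h ^ 2 := by nlinarith
      omega) (r := r) (by
      rw [K2 h (by omega)]
      have e : (2 * h - 1) * (4 * h - 3) + h ^ 2 + (4 * h - 2) = (3 * h - 1) ^ 2 := by
        zify [show 1 ≤ 2 * h by omega, show 3 ≤ 4 * h by omega, show 2 ≤ 4 * h by omega,
          show 1 ≤ 3 * h by omega]
        ring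
      omega)
  rwa [show 2 * h - 1 + h = 3 * h - 1 by omega] at this

theorem res3 {h r : ℕ} (hh : 7 ≤ h) (hF : Full h) (h1 : 3 * h + 3 ≤ r) (h2 : r ≠ 3 * h + 4)
    (h3 : r + (4 * h + 8) ≤ (3 * h + 3) ^ 2) : Sp (3 * h + 3) r := by
  have := mid_range (m := 2 * h + 3) (h := h) (S := h) ⟨h + 1, by omega⟩ (by omega) (by omega)
    (by omega) (by omega) (by omega) hF (by
      have : 7 * h ≤ h ^ 2 := by nlinarith
      omega) (r := r) (by
      have := Nat.mul_le_mul_left (2 * h + 3) (K3 h (by omega))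
      have e : (2 * h + 3) * (4 * h + 1) + h ^ 2 + (4 * h + 6) = (3 * h + 3) ^ 2 := by
        ring
      omega)
  rwa [show 2 * h + 3 + h = 3 * h + 3 by omega] at this

/-- A special small case. -/
theorem mid21 (hF : Full 8) {r : ℕ} (h1 : r = 21 ∨ (23 ≤ r ∧ r ≤ 75)) : Sp 21 r := by
  have hk := kf_one (m := 13) (h := 8) (by omega) (by omega)
  have := mid_lemma (m := 13) (h := 8) ⟨6, rfl⟩ (by omega) (s := 0) (by omega) (by omega)
    (rev 8 0) (rev 8 0) (hF (r - 13) (by omega) (by omega) (by omega) (by omega))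
  unfold kf at hk
  rw [hk] at this
  rwa [show 13 * 1 + (r - 13) = r by omega] at this

end ROrth

namespace ROrth
open Finset Function
set_option linter.unusedSectionVars false

/-! ### Products -/

theorem two_inj {a : ℕ} [NeZero a] (ha : Odd a) {x y : ZMod a} (h : 2 * x = 2 * y) : x = y := by
  apply dbl_inj ha
  rw [dbl_apply, dbl_apply, ← two_mul, ← two_mul, h]

theorem prod_lemma {a b : ℕ} [NeZero a] (ha : Odd a) (r : ZMod a × ZMod a → ℕ)
    (hr : ∀ q, Sp b (r q)) : Sp (a * b) (∑ q, r q) := by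
  have hX : Fintype.card (ZMod a × Fin b) = a * b := by simp [ZMod.card]
  rw [sp_iff hX]
  simp only [sp_iff_fin] at hr
  choose A B hA hB hc using hr
  refine ⟨fun p q => (p.1 + q.1, A (p.1, q.1) p.2 q.2),
    fun p q => (p.1 + 2 * q.1, B (p.1, q.1) p.2 q.2), ⟨?_, ?_⟩, ⟨?_, ?_⟩, ?_⟩
  · rintro ⟨i, x⟩ ⟨j, y⟩ ⟨j', y'⟩ h
    simp only [Prod.mk.injEq, add_right_inj] at h
    obtain ⟨rfl, h⟩ := h
    rw [(hA _).1 _ h]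
  · rintro ⟨i, x⟩ ⟨j, y⟩ ⟨j', y'⟩ h
    simp only [Prod.mk.injEq, add_left_inj] at h
    obtain ⟨rfl, h⟩ := h
    rw [(hA _).2 _ h]
  · rintro ⟨i, x⟩ ⟨j, y⟩ ⟨j', y'⟩ h
    simp only [Prod.mk.injEq, add_right_inj] at h
    obtain ⟨h1, h⟩ := h
    obtain rfl := two_inj ha h1
    rw [(hB _).1 _ h]
  · rintro ⟨i, x⟩ ⟨j, y⟩ ⟨j', y'⟩ h
    simp only [Prod.mk.injEq, add_left_inj] at h
    obtain ⟨rfl, h⟩ := h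
    rw [(hB _).2 _ h]
  · have : prs (fun p q : ZMod a × Fin b => (p.1 + q.1, A (p.1, q.1) p.2 q.2))
        (fun p q => (p.1 + 2 * q.1, B (p.1, q.1) p.2 q.2)) =
        univ.biUnion fun q : ZMod a × ZMod a => (prs (A q) (B q)).image
          fun s => ((q.1 + q.2, s.1), (q.1 + 2 * q.2, s.2)) := by
      ext p
      simp only [prs, mem_image, mem_univ, true_and, mem_biUnion, Prod.exists]
      constructor
      · rintro ⟨i, x, j, y, rfl⟩
        exact ⟨i, j, _, _, ⟨x, y, rfl⟩, rfl⟩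
      · rintro ⟨i, j, _, _, ⟨x, y, h⟩, rfl⟩
        simp only [Prod.mk.injEq] at h
        refine ⟨i, x, j, y, ?_⟩
        rw [← h.1, ← h.2]
    rw [this, card_biUnion]
    · refine sum_congr rfl fun q _ => ?_
      rw [card_image_of_injective, hc]
      rintro ⟨s, t⟩ ⟨s', t'⟩ h
      simp only [Prod.mk.injEq, true_and] at h
      rw [h.1, h.2]
    · rintro ⟨i, j⟩ - ⟨i', j'⟩ - hne
      simp only [Function.onFun]
      rw [disjoint_left]
      intro p hp hq
      simp only [mem_image, Prod.exists] at hp hq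
      obtain ⟨_, _, -, rfl⟩ := hp
      obtain ⟨_, _, -, h⟩ := hq
      simp only [Prod.mk.injEq] at h
      obtain ⟨⟨h1, -⟩, h2, -⟩ := h
      have e : j' = j := by linear_combination h2 - h1
      subst e
      exact hne (by rw [add_left_injective _ h1])

theorem top_prod {a b ρ : ℕ} [NeZero a] (ha : Odd a) (h1 : Sp b (b ^ 2)) (h2 : Sp b ρ) :
    Sp (a * b) ((a ^ 2 - 1) * b ^ 2 + ρ) := by
  have := prod_lemma (b := b) ha (fun q : ZMod a × ZMod a => if q = (0, 0) then ρ else b ^ 2) (by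
    intro q
    split_ifs
    · exact h2
    · exact h1)
  convert this using 1
  rw [← add_sum_erase univ _ (mem_univ ((0, 0) : ZMod a × ZMod a)), if_pos rfl,
    sum_congr rfl (g := fun _ => b ^ 2) (fun q hq => if_neg (ne_of_mem_erase hq)),
    sum_const, card_erase_of_mem (mem_univ _), card_univ, Fintype.card_prod, ZMod.card, smul_eq_mul,
    add_comm, sq a]

theorem top_prod' {a b d : ℕ} (ha : Odd a) (hb : 3 ≤ b) (hF : Full b) (hd : d ≠ 1)
    (hd2 : d + b + 2 ≤ b ^ 2) : Sp (a * b) ((a * b) ^ 2 - d) := by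
  have : NeZero a := ⟨by rintro rfl; exact (by decide : ¬ Odd 0) ha⟩
  have h := top_prod (a := a) (b := b) (ρ := b ^ 2 - d) ha
    (hF _ (by nlinarith) le_rfl (by nlinarith) (by omega))
    (hF _ (by omega) (by omega) (by omega) (by omega))
  convert h using 1
  have h1 : 1 ≤ a ^ 2 := Nat.one_le_pow _ _ (NeZero.pos a)
  have h2 : (a * b) ^ 2 = (a ^ 2 - 1) * b ^ 2 + b ^ 2 := by
    obtain ⟨c, hc⟩ := Nat.exists_eq_add_of_le h1
    rw [mul_pow, hc, Nat.add_sub_cancel_left]; ring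
  omega

theorem sum7 {α : Type*} [DecidableEq α] (s : Finset α) (hs : s.Nonempty) : ∀ R : ℕ,
    (R = 7 * s.card ∨ (7 * s.card + 2 ≤ R ∧ R + 2 ≤ 49 * s.card) ∨ R = 49 * s.card) →
    ∃ f : α → ℕ, (∀ q, f q = 7 ∨ (9 ≤ f q ∧ f q ≤ 47) ∨ f q = 49) ∧ ∑ q ∈ s, f q = R := by
  induction s using Finset.induction_on with
  | empty => exact absurd hs (by simp)
  | insert c s hc ih =>
    intro R hR
    rw [card_insert_of_notMem hc] at hR
    rcases s.eq_empty_or_nonempty with rfl | hne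
    · refine ⟨fun _ => R, fun _ => ?_, by simp⟩
      simp only [card_empty] at hR
      show R = 7 ∨ (9 ≤ R ∧ R ≤ 47) ∨ R = 49
      omega
    · have hk := hne.card_pos
      have : ∃ x, (x = 7 ∨ (9 ≤ x ∧ x ≤ 47) ∨ x = 49) ∧ x ≤ R ∧ (R - x = 7 * s.card ∨
          (7 * s.card + 2 ≤ R - x ∧ R - x + 2 ≤ 49 * s.card) ∨ R - x = 49 * s.card) := by
        generalize s.card = k at *
        by_cases h1 : R ≤ 49 * k + 5
        · exact ⟨7, by omega, by omega, by omega⟩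
        by_cases h2 : R ≤ 49 * k + 44
        · exact ⟨R + 3 - 49 * k, by omega, by omega, by omega⟩
        · exact ⟨R - 49 * k, by omega, by omega, by omega⟩
      obtain ⟨x, hx, hxR, hrest⟩ := this
      obtain ⟨f, hf, hsum⟩ := ih hne _ hrest
      refine ⟨update f c x, fun q => ?_, ?_⟩
      · by_cases hq : q = c
        · subst hq; simpa using hx
        · rw [update_of_ne hq]; exact hf q
      · rw [sum_insert hc, update_self, sum_congr rfl (g := f), hsum]
        · omega
        · intro q hq
          rw [update_of_ne]
          rintro rfl; exact hc hq

theorem prod21 (hF : Full 7) {r : ℕ} (h : (65 ≤ r ∧ r ≤ 439) ∨ r = 441) : Sp 21 r := by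
  obtain ⟨f, hf, hs⟩ := sum7 (univ : Finset (ZMod 3 × ZMod 3)) univ_nonempty r (by
    rw [card_univ, Fintype.card_prod, ZMod.card]; omega)
  have := prod_lemma (a := 3) (b := 7) (by decide) f (fun q => by
    have := hf q
    exact hF _ (by omega) (by omega) (by omega) (by omega))
  rwa [hs] at this

theorem full21 (h7 : Full 7) (h8 : Full 8) : Full 21 := by
  intro r h1 h2 h3 h4
  by_cases h : r ≤ 75
  · exact mid21 h8 (by omega)
  · exact prod21 h7 (by omega)

theorem full_mul3 {b : ℕ} (hb : 8 ≤ b) (hF : Full b) (hF' : Full (b - 1)) : Full (3 * b) := by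
  intro r h1 h2 h3 h4
  by_cases h : r + (4 * b + 4) ≤ (3 * b) ^ 2
  · have := res3 (h := b - 1) (r := r) (by omega) hF' (by omega) (by omega) (by
      rw [show 3 * (b - 1) + 3 = 3 * b by omega]; omega)
    rwa [show 3 * (b - 1) + 3 = 3 * b by omega] at this
  · have : 8 * b ≤ b ^ 2 := by nlinarith
    have := top_prod' (a := 3) (b := b) (d := (3 * b) ^ 2 - r) (by decide) (by omega) hF
      (by omega) (by omega)
    rwa [show (3 * b) ^ 2 - ((3 * b) ^ 2 - r) = r by omega] at this

end ROrth

namespace ROrth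
open Finset Function
set_option linter.unusedSectionVars false

/-! ### Wilson's construction with weight three -/

/-- addition in the field with four elements, `none` being zero -/
def add4 : Option (ZMod 3) → Option (ZMod 3) → Option (ZMod 3)
  | none, y => y
  | x, none => x
  | some i, some j => if i = j then none else some (-(i + j))

/-- multiplication by a generator -/
def om4 (c : Bool) : Option (ZMod 3) → Option (ZMod 3)
  | none => none
  | some i => some (if c then i + 1 else i)

/-- ingredient squares -/
def F4 (c : Bool) (u : Bool) (i j : Option (ZMod 3)) : Option (ZMod 3) :=
  if u then add4 i (om4 c j) else
    match i, j with
    | some i, some j => some (if c then i + 2 * j else i + j)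
    | _, _ => none

/-- valid cells of an ingredient -/
def V4 (u : Bool) (i j : Option (ZMod 3)) : Prop :=
  ¬ (i = none ∧ j = none) ∧ (u = false → i ≠ none ∧ j ≠ none)

instance (u : Bool) (i j : Option (ZMod 3)) : Decidable (V4 u i j) := by
  unfold V4; infer_instance

theorem F4_u : ∀ c u i j, V4 u i j → F4 c u i j = none → u = true := by decide
theorem F4_row : ∀ c u i j j', V4 u i j → V4 u i j' → F4 c u i j = F4 c u i j' → j = j' := by decide
theorem F4_col : ∀ c u i i' j, V4 u i j → V4 u i' j → F4 c u i j = F4 c u i' j → i = i' := by decide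
theorem F4_i : ∀ c u i j, V4 u i j → ¬ (i = none ∧ F4 c u i j = none) := by decide
theorem F4_j : ∀ c u i j, V4 u i j → ¬ (j = none ∧ F4 c u i j = none) := by decide
theorem F4_o : ∀ u i j, V4 u i j → ¬ (F4 false u i j = none ∧ F4 true u i j = none) := by decide
theorem F4_p : ∀ u i j i' j', V4 u i j → V4 u i' j' → F4 false u i j = F4 false u i' j' →
    F4 true u i j = F4 true u i' j' → i = i' ∧ j = j' := by decide

section wil
variable {t u : ℕ} [NeZero t] [NeZero u]

/-- points -/
def E4 (z w : ZMod t) : Option (ZMod 3) → (ZMod t × ZMod 3) ⊕ Fin u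
  | some i => Sum.inl (z, i)
  | none => Sum.inr ⟨w.val % u, Nat.mod_lt _ (NeZero.pos u)⟩

theorem E4_uniq {B : Type*} (α β w : B → ZMod t)
    (h1 : ∀ b b', α b = α b' → β b = β b' → b = b')
    (h2 : ∀ b b', α b = α b' → w b = w b' → b = b')
    (h3 : ∀ b b', β b = β b' → w b = w b' → b = b')
    {b b' : B} {i j i' j' : Option (ZMod 3)}
    (hij : ¬ (i = none ∧ j = none))
    (hi : i = none → (w b).val < u) (hj : j = none → (w b).val < u)
    (hi' : i' = none → (w b').val < u) (hj' : j' = none → (w b').val < u)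
    (e1 : (E4 (α b) (w b) i : (ZMod t × ZMod 3) ⊕ Fin u) = E4 (α b') (w b') i')
    (e2 : (E4 (β b) (w b) j : (ZMod t × ZMod 3) ⊕ Fin u) = E4 (β b') (w b') j') :
    b = b' ∧ i = i' ∧ j = j' := by
  have hw : ∀ c c' : B, (w c).val < u → (w c').val < u → (w c).val % u = (w c').val % u →
      w c = w c' := by
    intro c c' hc hc' h
    rw [Nat.mod_eq_of_lt hc, Nat.mod_eq_of_lt hc'] at h
    exact ZMod.val_injective _ h
  rcases i with _ | i <;> rcases j with _ | j <;> rcases i' with _ | i' <;> rcases j' with _ | j' <;>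
    simp [E4] at e1 e2 hij
  · have := hw _ _ (hi rfl) (hi' rfl) e1
    exact ⟨h3 _ _ e2.1 this, rfl, by rw [e2.2]⟩
  · have := hw _ _ (hj rfl) (hj' rfl) e2
    exact ⟨h2 _ _ e1.1 this, by rw [e1.2], rfl⟩
  · exact ⟨h1 _ _ e1.1 e2.1, by rw [e1.2], by rw [e2.2]⟩

/-- weight of a block -/
def w4 (b : ZMod t × ZMod t) : ZMod t := b.1 + 3 * b.2

/-- truncated group membership -/
def U4 (u : ℕ) (b : ZMod t × ZMod t) : Bool := decide ((w4 b).val < u)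

/-- symbol function -/
def G4 (u : ℕ) [NeZero u] (c : Bool) (b : ZMod t × ZMod t) (i j : Option (ZMod 3)) :
    (ZMod t × ZMod 3) ⊕ Fin u :=
  E4 (b.1 + (if c then 2 else 1) * b.2) (w4 b) (F4 c (U4 u b) i j)

/-- The two squares. -/
def W4 (c : Bool) : (ZMod t × ZMod 3) ⊕ Fin u → (ZMod t × ZMod 3) ⊕ Fin u →
    (ZMod t × ZMod 3) ⊕ Fin u
  | Sum.inl (x, i), Sum.inl (y, j) => G4 u c (x, y) (some i) (some j)
  | Sum.inl (x, i), Sum.inr k => G4 u c (x, (((k : ℕ) : ZMod t) - x) * 3⁻¹) (some i) none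
  | Sum.inr k, Sum.inl (y, j) => G4 u c (((k : ℕ) : ZMod t) - 3 * y, y) none (some j)
  | Sum.inr k, Sum.inr _ => Sum.inr k

theorem W4_spec (ht : Nat.Coprime 3 t) (hu : u ≤ t) (p q : (ZMod t × ZMod 3) ⊕ Fin u)
    (h : Outside p q) : ∃ (b : ZMod t × ZMod t) (i j : Option (ZMod 3)), V4 (U4 u b) i j ∧
      p = E4 b.1 (w4 b) i ∧ q = E4 b.2 (w4 b) j ∧ ∀ c, W4 c p q = G4 u c b i j := by
  have h3 : ((3 : ℕ) : ZMod t) * ((3 : ℕ) : ZMod t)⁻¹ = 1 := ZMod.coe_mul_inv_eq_one 3 ht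
  simp only [Nat.cast_ofNat] at h3
  have hk : ∀ k : Fin u, (((k : ℕ) : ZMod t)).val = k :=
    fun k => ZMod.val_cast_of_lt (k.2.trans_le hu)
  rcases p with ⟨x, i⟩ | k <;> rcases q with ⟨y, j⟩ | l
  · exact ⟨(x, y), some i, some j, ⟨by simp, by simp⟩, rfl, rfl, fun c => rfl⟩
  · have hw : w4 (x, (((l : ℕ) : ZMod t) - x) * 3⁻¹) = ((l : ℕ) : ZMod t) := by
      unfold w4; linear_combination (((l : ℕ) : ZMod t) - x) * h3
    refine ⟨(x, (((l : ℕ) : ZMod t) - x) * 3⁻¹), some i, none, ⟨by simp, ?_⟩, rfl, ?_, fun c => rfl⟩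
    · simp only [U4, hw, hk, l.2, decide_true]; simp
    · simp only [hw, E4, hk]
      congr 1; apply Fin.ext; exact (Nat.mod_eq_of_lt l.2).symm
  · have hw : w4 (((k : ℕ) : ZMod t) - 3 * y, y) = ((k : ℕ) : ZMod t) := by
      unfold w4; ring
    refine ⟨(((k : ℕ) : ZMod t) - 3 * y, y), none, some j, ⟨by simp, ?_⟩, ?_, rfl, fun c => rfl⟩
    · simp only [U4, hw, hk, k.2, decide_true]; simp
    · simp only [hw, E4, hk]
      congr 1; apply Fin.ext; exact (Nat.mod_eq_of_lt k.2).symm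
  · exact absurd ⟨rfl, rfl⟩ (h k l)

theorem V4_i {b : ZMod t × ZMod t} {i j : Option (ZMod 3)} (h : V4 (U4 u b) i j) (hi : i = none) :
    (w4 b).val < u := by
  by_contra hc
  exact (h.2 (by simpa [U4] using hc)).1 hi

theorem V4_j {b : ZMod t × ZMod t} {i j : Option (ZMod 3)} (h : V4 (U4 u b) i j) (hi : j = none) :
    (w4 b).val < u := by
  by_contra hc
  exact (h.2 (by simpa [U4] using hc)).2 hi

theorem V4_f {b : ZMod t × ZMod t} {i j : Option (ZMod 3)} (h : V4 (U4 u b) i j) (c : Bool)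
    (hi : F4 c (U4 u b) i j = none) : (w4 b).val < u := by
  simpa [U4] using F4_u c _ i j h hi

theorem W4_row (h2 : Odd t) (h3 : Nat.Coprime 3 t) (hu : u ≤ t) (c : Bool)
    {p q q' : (ZMod t × ZMod 3) ⊕ Fin u} (hq : Outside p q) (hq' : Outside p q')
    (h : W4 c p q = W4 c p q') : q = q' := by
  obtain ⟨b, i, j, hv, hp1, hq1, hW⟩ := W4_spec h3 hu p q hq
  obtain ⟨b', i', j', hv', hp1', hq1', hW'⟩ := W4_spec h3 hu p q' hq'
  rw [hW, hW'] at h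
  have hi3 : ∀ x y : ZMod t, 3 * x = 3 * y → x = y := by
    have hu3 : IsUnit ((3 : ℕ) : ZMod t) := (ZMod.isUnit_iff_coprime 3 t).2 h3
    rw [Nat.cast_ofNat] at hu3
    exact fun x y hxy => hu3.mul_left_cancel hxy
  obtain ⟨rfl, rfl, hF⟩ := E4_uniq (u := u) (fun b : ZMod t × ZMod t => b.1)
    (fun b => b.1 + (if c then 2 else 1) * b.2) w4
    (by
      rintro ⟨x, y⟩ ⟨x', y'⟩ e1 e2
      simp only at e1 e2
      subst e1
      congr 1
      cases c
      · simpa using e2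
      · exact two_inj h2 (by simpa using e2))
    (by
      rintro ⟨x, y⟩ ⟨x', y'⟩ e1 e2
      simp only [w4] at e1 e2
      subst e1
      congr 1
      exact hi3 _ _ (by simpa using e2))
    (by
      rintro ⟨x, y⟩ ⟨x', y'⟩ e1 e2
      simp only [w4] at e1 e2
      have : y = y' := by
        cases c
        · simp at e1
          exact two_inj h2 (by linear_combination e2 - e1)
        · simp at e1
          linear_combination e2 - e1
      subst this
      congr 1
      simpa using e2)
    (F4_i c _ i j hv) (V4_i hv) (V4_f hv c) (V4_i hv') (V4_f hv' c) (hp1.symm.trans hp1') h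
  rw [hq1, hq1', F4_row c _ _ _ _ hv hv' hF]

theorem W4_col (h2 : Odd t) (h3 : Nat.Coprime 3 t) (hu : u ≤ t) (c : Bool)
    {p p' q : (ZMod t × ZMod 3) ⊕ Fin u} (hq : Outside p q) (hq' : Outside p' q)
    (h : W4 c p q = W4 c p' q) : p = p' := by
  obtain ⟨b, i, j, hv, hp1, hq1, hW⟩ := W4_spec h3 hu p q hq
  obtain ⟨b', i', j', hv', hp1', hq1', hW'⟩ := W4_spec h3 hu p' q hq'
  rw [hW, hW'] at h
  obtain ⟨rfl, rfl, hF⟩ := E4_uniq (u := u) (fun b : ZMod t × ZMod t => b.2)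
    (fun b => b.1 + (if c then 2 else 1) * b.2) w4
    (by
      rintro ⟨x, y⟩ ⟨x', y'⟩ e1 e2
      simp only at e1 e2
      subst e1
      congr 1
      simpa using e2)
    (by
      rintro ⟨x, y⟩ ⟨x', y'⟩ e1 e2
      simp only [w4] at e1 e2
      subst e1
      congr 1
      simpa using e2)
    (by
      rintro ⟨x, y⟩ ⟨x', y'⟩ e1 e2
      simp only [w4] at e1 e2
      have : y = y' := by
        cases c
        · simp at e1
          exact two_inj h2 (by linear_combination e2 - e1)
        · simp at e1
          linear_combination e2 - e1
      subst this
      congr 1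
      simpa using e2)
    (F4_j c _ i j hv) (V4_j hv) (V4_f hv c) (V4_j hv') (V4_f hv' c) (hq1.symm.trans hq1') h
  rw [hp1, hp1', F4_col c _ _ _ _ hv hv' hF]

theorem W4_pair (h3 : Nat.Coprime 3 t) (h2 : Odd t) (hu : u ≤ t)
    {p p' q q' : (ZMod t × ZMod 3) ⊕ Fin u} (hq : Outside p q) (hq' : Outside p' q')
    (h : W4 false p q = W4 false p' q') (h' : W4 true p q = W4 true p' q') : p = p' ∧ q = q' := by
  obtain ⟨b, i, j, hv, hp1, hq1, hW⟩ := W4_spec h3 hu p q hq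
  obtain ⟨b', i', j', hv', hp1', hq1', hW'⟩ := W4_spec h3 hu p' q' hq'
  rw [hW, hW'] at h h'
  obtain ⟨rfl, hF, hF'⟩ := E4_uniq (u := u) (fun b : ZMod t × ZMod t => b.1 + (if false then 2 else 1) * b.2)
    (fun b => b.1 + (if true then 2 else 1) * b.2) w4
    (by
      rintro ⟨x, y⟩ ⟨x', y'⟩ e1 e2
      simp at e1 e2
      have : y = y' := by linear_combination e2 - e1
      subst this
      congr 1
      simpa using e2)
    (by
      rintro ⟨x, y⟩ ⟨x', y'⟩ e1 e2
      simp [w4] at e1 e2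
      have : y = y' := two_inj h2 (by linear_combination e2 - e1)
      subst this
      congr 1
      simpa using e2)
    (by
      rintro ⟨x, y⟩ ⟨x', y'⟩ e1 e2
      simp [w4] at e1 e2
      have : y = y' := by linear_combination e2 - e1
      subst this
      congr 1
      simpa using e2)
    (F4_o _ i j hv) (V4_f hv false) (V4_f hv true) (V4_f hv' false) (V4_f hv' true) h h'
  obtain ⟨rfl, rfl⟩ := F4_p _ _ _ _ _ hv hv' hF hF'
  exact ⟨hp1.trans hp1'.symm, hq1.trans hq1'.symm⟩

theorem outside_l {G H : Type*} (g : G) (q : G ⊕ H) : Outside (Sum.inl g) q := by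
  intro i j h; simp at h

theorem outside_r {G H : Type*} (g : G) (p : G ⊕ H) : Outside p (Sum.inl g) := by
  intro i j h; simp at h

theorem W4_frame (h2 : Odd t) (h3 : Nat.Coprime 3 t) (hu : u ≤ t) (c : Bool) :
    Frame (W4 c : (ZMod t × ZMod 3) ⊕ Fin u → _ → _) where
  row g x y h := W4_row h2 h3 hu c (outside_l _ _) (outside_l _ _) h
  col g x y h := W4_col h2 h3 hu c (outside_r _ _) (outside_r _ _) h
  bl k g := by
    obtain ⟨b, i, j, hv, hp1, hq1, hW⟩ := W4_spec h3 hu (Sum.inr k) (Sum.inl g) (outside_r _ _)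
    rw [hW, G4]
    rcases i with _ | i
    · rcases hF : F4 c (U4 u b) none j with _ | f
      · exact absurd ⟨rfl, hF⟩ (F4_i c _ _ _ hv)
      · exact ⟨_, rfl⟩
    · simp [E4] at hp1
  blinj k g g' h := Sum.inl_injective (W4_row h2 h3 hu c (outside_r _ _) (outside_r _ _) h)
  tr g k := by
    obtain ⟨b, i, j, hv, hp1, hq1, hW⟩ := W4_spec h3 hu (Sum.inl g) (Sum.inr k) (outside_l _ _)
    rw [hW, G4]
    rcases j with _ | j
    · rcases hF : F4 c (U4 u b) i none with _ | f
      · exact absurd ⟨rfl, hF⟩ (F4_j c _ _ _ hv)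
      · exact ⟨_, rfl⟩
    · simp [E4] at hq1
  trinj k g g' h := Sum.inl_injective (W4_col h2 h3 hu c (outside_l _ _) (outside_l _ _) h)

theorem wilson (h2 : Odd t) (h3 : Nat.Coprime 3 t) (hu : u ≤ t) {ρ : ℕ} (hρ : Sp u ρ) :
    Sp (3 * t + u) ((3 * t + u) ^ 2 - u ^ 2 + ρ) := by
  classical
  have hX : Fintype.card ((ZMod t × ZMod 3) ⊕ Fin u) = 3 * t + u := by
    simp [ZMod.card]; ring
  rw [sp_iff hX]
  rw [sp_iff_fin] at hρ
  have : Nonempty (Fin u) := ⟨⟨0, NeZero.pos u⟩⟩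
  let O : Finset (((ZMod t × ZMod 3) ⊕ Fin u) × ((ZMod t × ZMod 3) ⊕ Fin u)) :=
    univ.filter fun p => Outside p.1 p.2
  have hO : ∀ p, p ∈ O ↔ Outside p.1 p.2 := by intro p; simp [O]
  have hcard : O.card = (3 * t + u) ^ 2 - u ^ 2 := by
    have e : O = univ \ (univ.image fun q : Fin u × Fin u =>
        ((Sum.inr q.1, Sum.inr q.2) : ((ZMod t × ZMod 3) ⊕ Fin u) × ((ZMod t × ZMod 3) ⊕ Fin u))) := by
      ext ⟨p, q⟩
      rw [hO]
      simp only [Outside, mem_sdiff, mem_univ, true_and, mem_image, Prod.exists, Prod.mk.injEq]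
      constructor
      · rintro h ⟨i, j, rfl, rfl⟩
        exact h i j ⟨rfl, rfl⟩
      · rintro h i j ⟨rfl, rfl⟩
        exact h ⟨i, j, rfl, rfl⟩
    rw [e, card_sdiff_of_subset (subset_univ _), card_univ, Fintype.card_prod, hX,
      card_image_of_injective]
    · rw [card_univ, Fintype.card_prod, Fintype.card_fin, sq, sq]
    · rintro ⟨a, b⟩ ⟨c, d⟩ h
      simpa using h
  have hin : ∀ p q : (ZMod t × ZMod 3) ⊕ Fin u, Outside p q → Outside (W4 false p q) (W4 true p q) := by
    rintro p q hpq k l ⟨ha, hb⟩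
    obtain ⟨b, i, j, hv, hp1, hq1, hW⟩ := W4_spec h3 hu p q hpq
    rw [hW, G4] at ha hb
    apply F4_o _ _ _ hv
    constructor
    · rcases hF : F4 false (U4 u b) i j with _ | f
      · rfl
      · rw [hF] at ha; simp [E4] at ha
    · rcases hF : F4 true (U4 u b) i j with _ | f
      · rfl
      · rw [hF] at hb; simp [E4] at hb
  have himg : O.image (fun p : ((ZMod t × ZMod 3) ⊕ Fin u) × ((ZMod t × ZMod 3) ⊕ Fin u) =>
      ((W4 false p.1 p.2 : (ZMod t × ZMod 3) ⊕ Fin u), (W4 true p.1 p.2 : (ZMod t × ZMod 3) ⊕ Fin u))) = O := by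
    apply eq_of_subset_of_card_le
    · intro p hp
      rw [mem_image] at hp
      obtain ⟨q, hq, rfl⟩ := hp
      rw [hO] at hq ⊢
      exact hin _ _ hq
    · rw [card_image_of_injOn]
      rintro ⟨p, q⟩ hpq ⟨p', q'⟩ hpq' h
      simp only [Prod.mk.injEq] at h
      have := W4_pair h3 h2 hu ((hO _).1 hpq) ((hO _).1 hpq') h.1 h.2
      simp only at this
      rw [this.1, this.2]
  have := hole_lemma (W4_frame h2 h3 hu false) (W4_frame h2 h3 hu true) O
    (fun x y hxy => Or.inl ((hO _).2 (hin x y hxy)))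
    (fun p hp => by
      rw [← himg, mem_image] at hp
      obtain ⟨q, hq, rfl⟩ := hp
      exact ⟨q.1, q.2, (hO _).1 hq, rfl⟩)
    (fun p hp => (hO _).1 hp) hρ
  rwa [hcard] at this

end wil

theorem wilson_top {t u d : ℕ} (h2 : Odd t) (h3 : Nat.Coprime 3 t) (hu : u ≤ t) (hu7 : 7 ≤ u)
    (hF : Full u) (hd : d ≠ 1) (hd2 : d + u + 2 ≤ u ^ 2) :
    Sp (3 * t + u) ((3 * t + u) ^ 2 - d) := by
  have : NeZero t := ⟨by omega⟩
  have : NeZero u := ⟨by omega⟩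
  have h := wilson (t := t) (u := u) h2 h3 hu (ρ := u ^ 2 - d)
    (hF _ (by omega) (by omega) (by omega) (by omega))
  have : u ^ 2 ≤ (3 * t + u) ^ 2 := Nat.pow_le_pow_left (by omega) 2
  convert h using 1
  omega

/-- residue two modulo three -/
theorem full_res2 {h : ℕ} (hh : 7 ≤ h) (hF : Full h)
    (htop : ∀ d, d ≠ 1 → d + 1 ≤ 4 * h → Sp (3 * h - 1) ((3 * h - 1) ^ 2 - d)) :
    Full (3 * h - 1) := by
  intro r h1 h2 h3 h4
  by_cases hr : r + 4 * h ≤ (3 * h - 1) ^ 2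
  · exact res2 hh hF h1 (by omega) hr
  · have := htop ((3 * h - 1) ^ 2 - r) (by omega) (by omega)
    rwa [show (3 * h - 1) ^ 2 - ((3 * h - 1) ^ 2 - r) = r by omega] at this

theorem full_wilson {h t u : ℕ} (hh : 7 ≤ h) (hF : Full h) (h2 : Odd t) (h3 : Nat.Coprime 3 t)
    (hu : u ≤ t) (hu7 : 7 ≤ u) (hn : 3 * t + u = 3 * h - 1) (hFu : Full u)
    (hd : 4 * h + u + 1 ≤ u ^ 2) : Full (3 * h - 1) := by
  refine full_res2 hh hF fun d hd1 hd2 => ?_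
  rw [← hn]
  exact wilson_top h2 h3 hu hu7 hFu hd1 (by omega)

end ROrth

namespace ROrth
open Finset Function
set_option linter.unusedSectionVars false

/-! ### Quasi-difference matrices -/
section qdm

/-- Six bit digits of a number. -/
def dg (N i : ℕ) : ℕ := N / 2 ^ (6 * i) % 64

/-- One bordered circulant given by numbers. -/
def QOne (m h A B E : ℕ) : Prop :=
  (∀ v < m, dg A v < m + h) ∧ (∀ j < h, dg B j < m) ∧ (∀ j < h, dg E j < m) ∧
  (∀ v < m, ∀ w < m, dg A v = dg A w → v = w) ∧
  (∀ v < h, ∀ w < h, dg B v = dg B w → v = w) ∧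
  (∀ v < h, ∀ w < h, dg E v = dg E w → v = w) ∧
  (∀ v < m, ∀ j < h, dg A v ≠ dg B j) ∧
  (∀ v < m, ∀ w < m, dg A v < m → dg A w < m →
    (dg A v + (m - v)) % m = (dg A w + (m - w)) % m → v = w) ∧
  (∀ v < m, ∀ j < h, dg A v < m → dg E j ≠ (dg A v + (m - v)) % m)

/-- The two bordered circulants produce every pair outside the hole. -/
def QTwo (m h A A' B B' E E' : ℕ) : Prop :=
  (∀ v < m, m ≤ dg A v → dg A' v < m) ∧
  (∀ d < m, (∃ v < m, dg A v < m ∧ dg A' v < m ∧ (dg A' v + (m - dg A v)) % m = d) ∨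
    (∃ j < h, (dg B' j + (m - dg B j)) % m = d) ∨
    (∃ j < h, (dg E' j + (m - dg E j)) % m = d)) ∧
  (∀ j < h, ∃ v < m, dg A v < m ∧ dg A' v = m + j) ∧
  (∀ j < h, ∃ v < m, dg A v = m + j ∧ dg A' v < m)

set_option synthInstance.maxSize 2000 in
set_option synthInstance.maxHeartbeats 400000 in
instance (m h A B E : ℕ) : Decidable (QOne m h A B E) := by
  unfold QOne; infer_instance

instance (m h A A' B B' E E' : ℕ) : Decidable (QTwo m h A A' B B' E E') := by
  unfold QTwo; infer_instance

/-- Decode an entry. -/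
def ent (m h : ℕ) [NeZero h] (x : ℕ) : ZMod m ⊕ Fin h :=
  if x < m then Sum.inl (x : ZMod m) else Sum.inr (Fin.ofNat h (x - m))

variable {m h : ℕ} [NeZero m] [NeZero h]

theorem cast_inj' {x y : ℕ} (hx : x < m) (hy : y < m) (e : (x : ZMod m) = y) : x = y := by
  rw [ZMod.natCast_eq_natCast_iff'] at e
  rwa [Nat.mod_eq_of_lt hx, Nat.mod_eq_of_lt hy] at e

theorem ent_inl {x : ℕ} (hx : x < m) : ent m h x = Sum.inl (x : ZMod m) := if_pos hx

theorem ent_add {j : ℕ} (hj : j < h) : ent m h (m + j) = Sum.inr ⟨j, hj⟩ := by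
  rw [ent, if_neg (by omega)]
  congr 1
  apply Fin.ext
  simp [Nat.mod_eq_of_lt hj]

theorem ent_cases {x : ℕ} (hx : x < m + h) : (x < m ∧ ent m h x = Sum.inl (x : ZMod m)) ∨
    ∃ j, ∃ hj : j < h, x = m + j ∧ ent m h x = Sum.inr ⟨j, hj⟩ := by
  by_cases h1 : x < m
  · exact Or.inl ⟨h1, ent_inl h1⟩
  · refine Or.inr ⟨x - m, by omega, by omega, ?_⟩
    rw [← ent_add]
    congr 1; omega

theorem ent_inj {x y : ℕ} (hx : x < m + h) (hy : y < m + h) (e : ent m h x = ent m h y) :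
    x = y := by
  rcases ent_cases hx with ⟨h1, h2⟩ | ⟨j, hj, h1, h2⟩ <;>
    rcases ent_cases hy with ⟨h3, h4⟩ | ⟨k, hk, h3, h4⟩ <;> rw [h2, h4] at e <;>
    simp only [Sum.inl.injEq, Sum.inr.injEq, reduceCtorEq, Fin.mk.injEq] at e
  · exact cast_inj' h1 h3 e
  · omega

theorem sub_cast {x v : ℕ} (hv : v ≤ m) :
    (((x + (m - v)) % m : ℕ) : ZMod m) = (x : ZMod m) - v := by
  rw [ZMod.natCast_mod]
  push_cast [hv]
  simp [sub_eq_add_neg]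

theorem ent_eq_inl {x : ℕ} {y : ZMod m} (hx : x < m + h) (e : ent m h x = Sum.inl y) :
    x < m ∧ y = x := by
  rcases ent_cases hx with ⟨h1, h2⟩ | ⟨j, hj, h1, h2⟩ <;> rw [h2] at e
  · exact ⟨h1, (Sum.inl.inj e).symm⟩
  · simp at e

theorem QOne.ok {A B E : ℕ} (q : QOne m h A B E) :
    CSok (AddMonoidHom.id (ZMod m)) (fun v : ZMod m => ent m h (dg A v.val))
      (fun j : Fin h => ((dg B j : ℕ) : ZMod m)) (fun j : Fin h => ((dg E j : ℕ) : ZMod m)) := by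
  obtain ⟨q1, q2, q3, q4, q5, q6, q7, q8, q9⟩ := q
  have lt : ∀ v : ZMod m, v.val < m := fun v => ZMod.val_lt v
  have hsub : ∀ (x : ℕ) (v : ZMod m), (((x + (m - v.val)) % m : ℕ) : ZMod m) = (x : ZMod m) - v := by
    intro x v
    rw [sub_cast (lt v).le, ZMod.natCast_zmod_val]
  constructor
  · intro v w e
    exact ZMod.val_injective m (q4 _ (lt v) _ (lt w) (ent_inj (q1 _ (lt v)) (q1 _ (lt w)) e))
  · intro v w e
    exact Fin.ext (q5 _ v.2 _ w.2 (cast_inj' (q2 _ v.2) (q2 _ w.2) e))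
  · intro v j e
    obtain ⟨h1, h2⟩ := ent_eq_inl (q1 _ (lt v)) e
    exact q7 _ (lt v) _ j.2 (cast_inj' h1 (q2 _ j.2) h2.symm)
  · intro v w x y hx hy e
    obtain ⟨h1, rfl⟩ := ent_eq_inl (q1 _ (lt v)) hx
    obtain ⟨h3, rfl⟩ := ent_eq_inl (q1 _ (lt w)) hy
    simp only [AddMonoidHom.id_apply] at e
    rw [← hsub, ← hsub] at e
    have hm : 0 < m := NeZero.pos m
    exact ZMod.val_injective m (q8 _ (lt v) _ (lt w) h1 h3
      (cast_inj' (Nat.mod_lt _ hm) (Nat.mod_lt _ hm) e))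
  · intro v w e
    exact Fin.ext (q6 _ v.2 _ w.2 (cast_inj' (q3 _ v.2) (q3 _ w.2) e))
  · intro v x j hx e
    obtain ⟨h1, rfl⟩ := ent_eq_inl (q1 _ (lt v)) hx
    simp only [AddMonoidHom.id_apply] at e
    rw [← hsub] at e
    exact q9 _ (lt v) _ j.2 h1 (cast_inj' (q3 _ j.2) (Nat.mod_lt _ (NeZero.pos m)) e)

theorem qdm_sp {A A' B B' E E' ρ : ℕ} (q : QOne m h A B E) (q' : QOne m h A' B' E')
    (p : QTwo m h A A' B B' E E') (hρ : Sp h ρ) : Sp (m + h) (m * (m + 2 * h) + ρ) := by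
  rw [sp_iff_fin] at hρ
  have hX : Fintype.card (ZMod m ⊕ Fin h) = m + h := by simp [ZMod.card]
  rw [sp_iff hX]
  have : Nonempty (Fin h) := ⟨⟨0, NeZero.pos h⟩⟩
  have lt : ∀ v : ZMod m, v.val < m := fun v => ZMod.val_lt v
  obtain ⟨p1, p2, p3, p4⟩ := p
  have hv : ∀ v < m, ((v : ℕ) : ZMod m).val = v := fun v hv => ZMod.val_cast_of_lt hv
  have := circ_lemma (τ := AddMonoidHom.id (ZMod m)) injective_id q.ok q'.ok univ ?_ ?_ hρ
  · simpa [ZMod.card, two_mul] using this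
  · intro v i j h1 h2
    exfalso
    rcases ent_cases (q.1 _ (lt v)) with ⟨h3, h4⟩ | ⟨k, hk, h3, h4⟩
    · simp only [h4, reduceCtorEq] at h1
    · have := p1 _ (lt v) (by omega)
      simp only [ent_inl this, reduceCtorEq] at h2
  · intro k
    simp only [mem_univ, true_iff]
    rcases k with d | j | j
    · rcases p2 d.val (lt d) with ⟨v, hvm, h1, h2, h3⟩ | ⟨j, hj, h3⟩ | ⟨j, hj, h3⟩
      · left
        refine ⟨(v : ZMod m), ?_⟩
        rw [hv v hvm, ent_inl h1, ent_inl h2]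
        simp only [HasKey]
        rw [← sub_cast h1.le, h3, ZMod.natCast_zmod_val]
      · right; left
        refine ⟨⟨j, hj⟩, ?_⟩
        simp only
        rw [← sub_cast (q.2.1 j hj).le, h3, ZMod.natCast_zmod_val]
      · right; right
        refine ⟨⟨j, hj⟩, ?_⟩
        simp only
        rw [← sub_cast (q.2.2.1 j hj).le, h3, ZMod.natCast_zmod_val]
    · left
      obtain ⟨v, hvm, h1, h2⟩ := p3 j j.2
      refine ⟨(v : ZMod m), ?_⟩
      rw [hv v hvm, h2, ent_inl h1, ent_add j.2]
      rfl
    · left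
      obtain ⟨v, hvm, h1, h2⟩ := p4 j j.2
      refine ⟨(v : ZMod m), ?_⟩
      rw [hv v hvm, h1, ent_inl h2, ent_add j.2]
      rfl

end qdm

theorem full_qdm {h' m h n : ℕ} (hh : 7 ≤ h') (hF : Full h') (hFh : Full h) (hmh : m + h = n)
    (hn : n = 3 * h' - 1 ∧ 1 ≤ m ∧ 7 ≤ h) (hd : 4 * h' + h + 1 ≤ h ^ 2) (A A' B B' E E' : ℕ)
    (hq : QOne m h A B E ∧ QOne m h A' B' E' ∧ QTwo m h A A' B B' E E') : Full n := by
  obtain ⟨hn, hm1, hh7⟩ := hn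
  have : NeZero m := ⟨by omega⟩
  have : NeZero h := ⟨by omega⟩
  rw [hn]
  refine full_res2 hh hF fun d hd1 hd2 => ?_
  rw [← hn, ← hmh]
  have key := qdm_sp hq.1 hq.2.1 hq.2.2 (hFh (h ^ 2 - d) (by omega) (by omega) (by omega) (by omega))
  have : m * (m + 2 * h) + (h ^ 2 - d) = (m + h) ^ 2 - d := by
    have : (m + h) ^ 2 = m * (m + 2 * h) + h ^ 2 := by ring
    omega
  rwa [this] at key

theorem full_23 (hF : Full 8) (hh : Full 7) : Full 23 :=
  full_qdm (h' := 8) (m := 16) (h := 7) (by norm_num) hF hh (by norm_num) (by norm_num) (by norm_num)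
    27647015641787878653373194497
    18824836227967210304957645507
    11962966469
    274897064390
    151652446862
    355611992327 (by decide +kernel)

theorem full_26 (hF : Full 9) (hh : Full 7) : Full 26 :=
  full_qdm (h' := 9) (m := 19) (h := 7) (by norm_num) hF hh (by norm_num) (by norm_num) (by norm_num)
    4634878825021069054602711119476032
    8221190969147279728473002178306176
    353483101264
    288957211205
    1241467917000
    972911878275 (by decide +kernel)

theorem full_29 (hF : Full 10) (hh : Full 8) : Full 29 :=
  full_qdm (h' := 10) (m := 21) (h := 8) (by norm_num) hF hh (by norm_num) (by norm_num) (by norm_num)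
    24100509066691675941824427663982932736
    9329681597574159129521366971026879936
    48520517685318
    61864760877388
    13344601018630
    45304474551567 (by decide +kernel)

theorem full_32 (hF : Full 11) (hh : Full 9) : Full 32 :=
  full_qdm (h' := 11) (m := 23) (h := 9) (by norm_num) hF hh (by norm_num) (by norm_num) (by norm_num)
    92995535147239497900542313535210513527488
    45717945825908511000249716057540142151552
    897752589738131
    3999206488999119
    3101453905384531
    5678932580390212 (by decide +kernel)

theorem full_35 (hF : Full 12) (hh : Full 10) : Full 35 :=
  full_qdm (h' := 12) (m := 25) (h := 10) (by norm_num) hF hh (by norm_num) (by norm_num) (by norm_num)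
    744446302043165149087866500047802455775314560
    382011910143356804980994481968524760973189248
    167253523758625285
    198480345146352530
    38373647387804045
    290255009815520340 (by decide +kernel)

theorem full_38 (hF : Full 13) (hh : Full 11) : Full 38 :=
  full_qdm (h' := 13) (m := 27) (h := 11) (by norm_num) hF hh (by norm_num) (by norm_num) (by norm_num)
    472513206306121569477835049644486046698634293888
    2608263635973827276127120585266340436802719233856
    15118592964577531290
    10776657696977397075
    26794545181615986324
    16504396876067414337 (by decide +kernel)

theorem full_41 (hF : Full 14) (hh : Full 12) : Full 41 :=
  full_qdm (h' := 14) (m := 29) (h := 12) (by norm_num) hF hh (by norm_num) (by norm_num) (by norm_num)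
    13248170609452040985877367601223910676746873475490304
    956032221300147993622586172930435513904297532619136
    534186113737046459612
    1864676885715051905874
    1330490901545844266451
    1639601632345806099073 (by decide +kernel)

theorem full_47 (hF : Full 16) (hh : Full 14) : Full 47 :=
  full_qdm (h' := 16) (m := 33) (h := 14) (by norm_num) hF hh (by norm_num) (by norm_num) (by norm_num)
    60964766931551390597726128023089668013014307264138370803776
    228345846818695726429744043424685180763378780524382778900800
    5565180259585864310476932
    9379958633380043074377440
    3973090078833677860652636
    4566769466708170677536733 (by decide +kernel)

theorem full_53 (hF : Full 18) (hh : Full 16) : Full 53 :=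
  full_qdm (h' := 18) (m := 37) (h := 16) (by norm_num) hF hh (by norm_num) (by norm_num) (by norm_num)
    4585611711071858004933377523297852561846710990525010145637915547072
    281550972914476927778097122006073380462928921890521110721574677120
    18977722932847555156017485923
    9326315135845955581211924301
    36152376429333854446270564431
    27553102670768008192571818242 (by decide +kernel)

theorem full_56 (hF : Full 19) (hh : Full 17) : Full 56 :=
  full_qdm (h' := 19) (m := 39) (h := 17) (by norm_num) hF hh (by norm_num) (by norm_num) (by norm_num)
    23831400691224190155722206761639653101567338202177782385212188590244224
    4780358854256614415589941229093791533474583720156238967537292599986944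
    955018522109584529549794846089
    113272554665856561929828256095
    2248164157684297531570987602902
    2183925821312697797965851186270 (by decide +kernel)

theorem full_59 (hF : Full 20) (hh : Full 18) : Full 59 :=
  full_qdm (h' := 20) (m := 41) (h := 18) (by norm_num) hF hh (by norm_num) (by norm_num) (by norm_num)
    62099875841731304441104047076177619404678458921801142623398914509195998784
    75359204742536744044090288866289907057288325174574593399515503515297344512
    99354892176855798038997272514976
    149606960381371460873469050282334
    53500422867600512216325847067175
    111839722108786992407183629764809 (by decide +kernel)

end ROrth

namespace ROrth
open Finset Function
set_option linter.unusedSectionVars false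

/-! ### Explicit small squares: a verified checker -/

/-- Latin squares given by functions on naturals. -/
structure FLat (n : ℕ) (A : ℕ → ℕ → ℕ) : Prop where
  lt : ∀ i < n, ∀ j < n, A i j < n
  row : ∀ i < n, ∀ j < n, ∀ j' < n, A i j = A i j' → j = j'
  col : ∀ j < n, ∀ i < n, ∀ i' < n, A i j = A i' j → i = i'

theorem mod_eq_card (M : ℕ) (T : Finset ℕ) (hT : ∀ t, M.testBit t = true ↔ t ∈ T)
    (h10 : ∀ t ∈ T, 10 ∣ t) (hc : T.card < 1023) : M % 1023 = T.card := by
  have hM : M = ∑ t ∈ T, 2 ^ t := by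
    have : M.bitIndices.toFinset = T := by
      ext t; rw [List.mem_toFinset, Nat.mem_bitIndices, hT]
    conv_lhs => rw [← Finset.sum_toFinset_bitIndices_two_pow M]
    rw [this]
  have : M ≡ T.card [MOD 1023] := by
    rw [hM, Finset.card_eq_sum_ones]
    apply Nat.ModEq.sum
    intro t ht
    obtain ⟨k, rfl⟩ := h10 t ht
    rw [pow_mul]
    have : (2 ^ 10 : ℕ) ≡ 1 [MOD 1023] := by decide
    simpa using this.pow k
  rw [this, Nat.mod_eq_of_lt hc]

theorem sp_of_fun {n : ℕ} (hn : n ≤ 31) {A B : ℕ → ℕ → ℕ} (hA : FLat n A) (hB : FLat n B)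
    {M : ℕ} (hM : ∀ t, M.testBit t = true ↔ ∃ i < n, ∃ j < n, t = 10 * (A i j * n + B i j)) :
    Sp n (M % 1023) := by
  rw [sp_iff_fin]
  let A' : Fin n → Fin n → Fin n := fun i j => ⟨A i j, hA.lt _ i.2 _ j.2⟩
  let B' : Fin n → Fin n → Fin n := fun i j => ⟨B i j, hB.lt _ i.2 _ j.2⟩
  refine ⟨A', B', ?_, ?_, ?_⟩
  · refine ⟨fun i j j' h => ?_, fun j i i' h => ?_⟩
    · exact Fin.ext (hA.row _ i.2 _ j.2 _ j'.2 (Fin.ext_iff.1 h))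
    · exact Fin.ext (hA.col _ j.2 _ i.2 _ i'.2 (Fin.ext_iff.1 h))
  · refine ⟨fun i j j' h => ?_, fun j i i' h => ?_⟩
    · exact Fin.ext (hB.row _ i.2 _ j.2 _ j'.2 (Fin.ext_iff.1 h))
    · exact Fin.ext (hB.col _ j.2 _ i.2 _ i'.2 (Fin.ext_iff.1 h))
  · let φ : Fin n × Fin n → ℕ := fun p => 10 * ((p.1 : ℕ) * n + p.2)
    have hφ : Injective φ := by
      rintro ⟨a, b⟩ ⟨c, d⟩ h
      have h1 : (a : ℕ) * n + b = c * n + d := by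
        have : 10 * ((a : ℕ) * n + b) = 10 * (c * n + d) := h
        omega
      have hn0 : 0 < n := a.pos
      have h2 : (a : ℕ) = c := by
        have e1 : ((a : ℕ) * n + b) / n = a := by
          rw [mul_comm, Nat.mul_add_div hn0, Nat.div_eq_of_lt b.2, add_zero]
        have e2 : ((c : ℕ) * n + d) / n = c := by
          rw [mul_comm, Nat.mul_add_div hn0, Nat.div_eq_of_lt d.2, add_zero]
        rw [← e1, h1, e2]
      rw [h2] at h1
      exact Prod.ext (Fin.ext h2) (Fin.ext (by simpa using h1))
    have hcard : ((prs A' B').image φ).card = (prs A' B').card := card_image_of_injective _ hφ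
    rw [← hcard]
    symm
    apply mod_eq_card
    · intro t
      rw [hM]
      simp only [prs, mem_image, mem_univ, true_and, exists_exists_eq_and, Prod.exists]
      constructor
      · rintro ⟨i, hi, j, hj, rfl⟩
        exact ⟨_, _, ⟨⟨i, hi⟩, ⟨j, hj⟩, rfl⟩, rfl⟩
      · rintro ⟨_, _, ⟨i, j, e⟩, rfl⟩
        obtain ⟨rfl, rfl⟩ := Prod.mk.inj e
        exact ⟨i, i.2, j, j.2, rfl⟩
    · intro t ht
      rw [mem_image] at ht
      obtain ⟨p, -, rfl⟩ := ht
      exact dvd_mul_right _ _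
    · rw [hcard]
      have : (prs A' B').card ≤ n * n := by
        refine (card_le_univ _).trans ?_
        simp
      have : n * n ≤ 31 * 31 := Nat.mul_le_mul hn hn
      omega

/-- Union of powers of two. -/
def orr (f : ℕ → ℕ) (k : ℕ) : ℕ := Nat.rec 0 (fun j ih => Nat.lor ih (Nat.pow 2 (f j))) k

theorem orr_bit (f : ℕ → ℕ) (k t : ℕ) : (orr f k).testBit t = true ↔ ∃ j < k, f j = t := by
  induction k with
  | zero => simp [orr]
  | succ k ih =>
    have : orr f (k + 1) = orr f k ||| 2 ^ f k := rfl
    rw [this, Nat.testBit_or, Bool.or_eq_true, ih, Nat.testBit_two_pow, decide_eq_true_iff]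
    constructor
    · rintro (⟨j, hj, h⟩ | h)
      · exact ⟨j, by omega, h⟩
      · exact ⟨k, by omega, h⟩
    · rintro ⟨j, hj, h⟩
      rcases Nat.lt_succ_iff_lt_or_eq.1 hj with h1 | h1
      · exact Or.inl ⟨j, h1, h⟩
      · exact Or.inr (h1 ▸ h)

theorem full_mask {n V : ℕ} {f : ℕ → ℕ} (hV : ∀ t, V.testBit t = true ↔ ∃ j < n, f j = t)
    (h : V = 2 ^ n - 1) : (∀ j < n, f j < n) ∧ ∀ j < n, ∀ j' < n, f j = f j' → j = j' := by
  have h1 : ∀ t, (∃ j < n, f j = t) ↔ t < n := by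
    intro t
    rw [← hV, h, Nat.testBit_two_pow_sub_one, decide_eq_true_iff]
  have h2 : ∀ j < n, f j < n := fun j hj => (h1 _).1 ⟨j, hj, rfl⟩
  refine ⟨h2, ?_⟩
  let g : Fin n → Fin n := fun j => ⟨f j, h2 j j.2⟩
  have hg : Surjective g := by
    intro t
    obtain ⟨j, hj, e⟩ := (h1 t).2 t.2
    exact ⟨⟨j, hj⟩, Fin.ext e⟩
  have hi : Injective g := Finite.injective_iff_surjective.2 hg
  intro j hj j' hj' e
  have := @hi ⟨j, hj⟩ ⟨j', hj'⟩ (Fin.ext e)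
  exact Fin.ext_iff.1 this

/-- Bounded universal quantifier. -/
def allB (f : ℕ → Bool) (k : ℕ) : Bool :=
  Nat.rec true (fun j ih => cond (f j) ih false) k

theorem allB_iff (f : ℕ → Bool) (k : ℕ) : allB f k = true ↔ ∀ j < k, f j = true := by
  induction k with
  | zero => simp [allB]
  | succ k ih =>
    have : allB f (k + 1) = cond (f k) (allB f k) false := rfl
    rw [this, Nat.forall_lt_succ_right, ← ih]
    cases f k <;> simp

/-- Five bit digits. -/
def d5 (N p : ℕ) : ℕ := Nat.mod (Nat.shiftRight N (Nat.mul 5 p)) 32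

/-- Entry of a packed square. -/
def e5 (n N i j : ℕ) : ℕ := d5 N (Nat.add (Nat.mul i n) j)

/-- Latin check for a packed square. -/
def latB (n N : ℕ) : Bool :=
  cond (allB (fun i => Nat.beq (orr (fun j => e5 n N i j) n) (Nat.sub (Nat.pow 2 n) 1)) n)
    (allB (fun j => Nat.beq (orr (fun i => e5 n N i j) n) (Nat.sub (Nat.pow 2 n) 1)) n) false

theorem latB_flat {n N : ℕ} (h : latB n N = true) : FLat n (e5 n N) := by
  unfold latB at h
  rw [Bool.cond_false_right, Bool.and_eq_true, allB_iff, allB_iff] at h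
  have h1 : ∀ i < n, _ := fun i hi => full_mask (orr_bit _ _) (Nat.eq_of_beq_eq_true (h.1 i hi))
  have h2 : ∀ i < n, _ := fun i hi => full_mask (orr_bit _ _) (Nat.eq_of_beq_eq_true (h.2 i hi))
  exact ⟨fun i hi => (h1 i hi).1, fun i hi => (h1 i hi).2, fun j hj => (h2 j hj).2⟩

/-- Number of pairs of two packed squares. -/
def cntB (n N N' : ℕ) : ℕ :=
  Nat.mod (orr (fun p => Nat.mul 10 (Nat.add (Nat.mul (d5 N p) n) (d5 N' p))) (Nat.mul n n)) 1023

/-- Check of an explicit pair. -/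
def okB (n N N' r : ℕ) : Bool :=
  cond (latB n N) (cond (latB n N') (cond (Nat.ble n 31) (Nat.beq (cntB n N N') r) false) false)
    false

theorem sp_okB {n N N' r : ℕ} (h : okB n N N' r = true) : Sp n r := by
  unfold okB at h
  simp only [Bool.cond_false_right, Bool.and_eq_true] at h
  obtain ⟨h1, h2, h3, h4⟩ := h
  have h4 := Nat.eq_of_beq_eq_true h4
  rw [← h4]
  refine sp_of_fun (Nat.le_of_ble_eq_true h3) (latB_flat h1) (latB_flat h2) fun t => ?_
  rw [orr_bit]
  constructor
  · rintro ⟨p, hp, rfl⟩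
    have hp : p < n * n := hp
    have hn : 0 < n := by
      rcases Nat.eq_zero_or_pos n with h | h
      · subst h; omega
      · exact h
    refine ⟨p / n, Nat.div_lt_of_lt_mul hp, p % n, Nat.mod_lt _ hn, ?_⟩
    have : p / n * n + p % n = p := Nat.div_add_mod' p n
    show _ = 10 * (d5 N (p / n * n + p % n) * n + d5 N' (p / n * n + p % n))
    rw [this]; rfl
  · rintro ⟨i, hi, j, hj, rfl⟩
    refine ⟨i * n + j, ?_, rfl⟩
    show _ < n * n
    have : (i + 1) * n ≤ n * n := Nat.mul_le_mul_right n hi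
    rw [add_mul] at this
    omega

/-! ### Walks -/

/-- Forced evaluation. -/
def frc (x : ℕ) (k : ℕ → ℕ) : ℕ := Nat.rec (k 0) (fun p _ => k (Nat.succ p)) x

theorem frc_eq (x : ℕ) (k : ℕ → ℕ) : frc x k = k x := by cases x <;> rfl

/-- A row of the first square, one of the second, and the mask of their pairs. -/
abbrev Row := List ℕ × List ℕ × ℕ

/-- Exchange of two rows in the given columns. -/
def sw : List ℕ → List ℕ → ℕ → List ℕ
  | x :: xs, y :: ys, C => (if C % 2 = 0 then x else y) :: sw xs ys (C / 2)
  | _, _, _ => []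

/-- Continuation version of `sw`. -/
def swK (xs : List ℕ) : List ℕ → ℕ → (List ℕ → List ℕ → ℕ) → ℕ :=
  List.rec (fun _ _ k => k [] [])
    (fun x _ ih ys C k => List.rec (k [] [])
      (fun y ys _ => Nat.rec (ih ys (Nat.div C 2) (fun u v => k (x :: u) (y :: v)))
        (fun _ _ => ih ys (Nat.div C 2) (fun u v => k (y :: u) (x :: v))) (Nat.mod C 2)) ys) xs

theorem swK_eq (xs ys : List ℕ) (C : ℕ) (k : List ℕ → List ℕ → ℕ) :
    swK xs ys C k = k (sw xs ys C) (sw ys xs C) := by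
  induction xs generalizing ys C k with
  | nil => cases ys <;> rfl
  | cons x xs ih =>
    cases ys with
    | nil => rfl
    | cons y ys =>
      have h0 : swK (x :: xs) (y :: ys) C k =
        Nat.rec (swK xs ys (C / 2) (fun u v => k (x :: u) (y :: v)))
        (fun _ _ => swK xs ys (C / 2) (fun u v => k (y :: u) (x :: v))) (C % 2) := rfl
      rw [h0]
      rcases h : C % 2 with _ | m
      · simp [ih, sw, h]
      · simp [ih, sw, h]

theorem sw_length : ∀ (xs ys : List ℕ) (C : ℕ), xs.length = ys.length →
    (sw xs ys C).length = xs.length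
  | [], [], _, _ => rfl
  | x :: xs, y :: ys, C, h => by
    simp only [sw, List.length_cons]
    rw [sw_length xs ys]
    simpa using h

theorem sw_get : ∀ (xs ys : List ℕ) (C j : ℕ), xs.length = ys.length →
    (sw xs ys C).getD j 0 = if (C / 2 ^ j) % 2 = 0 then xs.getD j 0 else ys.getD j 0
  | [], [], _, j, _ => by simp [sw]
  | x :: xs, y :: ys, C, 0, h => by simp [sw]
  | x :: xs, y :: ys, C, j + 1, h => by
    simp only [sw, List.getD_cons_succ]
    rw [sw_get xs ys _ _ (by simpa using h), Nat.div_div_eq_div_mul, pow_succ, mul_comm (2 ^ j) 2]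

/-- Row masks. -/
def rmK (n : ℕ) (xs : List ℕ) : List ℕ → ℕ → ℕ → (ℕ → ℕ → ℕ) → ℕ :=
  List.rec (fun _ M V k => k M V)
    (fun x _ ih ys M V k => List.rec (k M V)
      (fun y ys _ => ih ys (Nat.lor M (Nat.pow 2 (Nat.mul 10 (Nat.add (Nat.mul x n) y))))
        (Nat.lor V (Nat.pow 2 y)) k) ys) xs

theorem rmK_eq (n : ℕ) (xs ys : List ℕ) (hl : xs.length = ys.length) (M V : ℕ) (k : ℕ → ℕ → ℕ) :
    ∃ M' V', rmK n xs ys M V k = k M' V' ∧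
      (∀ t, M'.testBit t = true ↔ M.testBit t = true ∨
        ∃ j < xs.length, 10 * (xs.getD j 0 * n + ys.getD j 0) = t) ∧
      (∀ t, V'.testBit t = true ↔ V.testBit t = true ∨ ∃ j < xs.length, ys.getD j 0 = t) := by
  induction xs generalizing ys M V with
  | nil => exact ⟨M, V, rfl, by simp, by simp⟩
  | cons x xs ih =>
    cases ys with
    | nil => simp at hl
    | cons y ys =>
      obtain ⟨M', V', h1, h2, h3⟩ := ih ys (by simpa using hl)
        (M ||| 2 ^ (10 * (x * n + y))) (V ||| 2 ^ y)
      refine ⟨M', V', h1, ?_, ?_⟩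
      · intro t
        rw [h2, Nat.testBit_or, Bool.or_eq_true, Nat.testBit_two_pow, decide_eq_true_iff, or_assoc]
        refine or_congr Iff.rfl ?_
        rw [List.length_cons, Nat.exists_lt_succ_left]
        rfl
      · intro t
        rw [h3, Nat.testBit_or, Bool.or_eq_true, Nat.testBit_two_pow, decide_eq_true_iff, or_assoc]
        refine or_congr Iff.rfl ?_
        rw [List.length_cons, Nat.exists_lt_succ_left]
        rfl

/-- Access to a row. -/
def getK (S : List Row) : ℕ → ℕ → (List ℕ → List ℕ → ℕ) → ℕ :=
  List.rec (fun _ d _ => d)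
    (fun R _ ih i d k => Nat.rec (k R.1 R.2.1) (fun i _ => ih i d k) i) S

theorem getK_eq (S : List Row) (i d : ℕ) (k : List ℕ → List ℕ → ℕ) :
    (S.length ≤ i ∧ getK S i d k = d) ∨
    (i < S.length ∧ getK S i d k = k (S.getD i ([], [], 0)).1 (S.getD i ([], [], 0)).2.1) := by
  induction S generalizing i with
  | nil => left; exact ⟨Nat.zero_le _, rfl⟩
  | cons R S ih =>
    cases i with
    | zero => right; exact ⟨by simp, rfl⟩
    | succ i =>
      rcases ih i with ⟨h1, h2⟩ | ⟨h1, h2⟩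
      · left; exact ⟨by simpa using h1, h2⟩
      · right; exact ⟨by simpa using h1, h2⟩

/-- Replacement of a row. -/
def setK (R : Row) (S : List Row) : ℕ → (List Row → ℕ) → ℕ :=
  List.rec (fun _ k => k [])
    (fun R' T ih i k => Nat.rec (k (R :: T)) (fun i _ => ih i (fun U => k (R' :: U))) i) S

theorem setK_eq (R : Row) (S : List Row) (i : ℕ) (k : List Row → ℕ) :
    setK R S i k = k (S.set i R) := by
  induction S generalizing i k with
  | nil => rfl
  | cons R' S ih =>
    cases i with
    | zero => rfl
    | succ i =>
      have : setK R (R' :: S) (i + 1) k = setK R S i (fun U => k (R' :: U)) := rfl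
      rw [this, ih]; rfl

/-- Total mask. -/
def orM (S : List Row) : ℕ := List.rec 0 (fun R _ ih => Nat.lor R.2.2 ih) S

theorem orM_bit (S : List Row) (t : ℕ) : (orM S).testBit t = true ↔
    ∃ i < S.length, (S.getD i ([], [], 0)).2.2.testBit t = true := by
  induction S with
  | nil => simp [orM]
  | cons R S ih =>
    have : orM (R :: S) = R.2.2 ||| orM S := rfl
    rw [this, Nat.testBit_or, Bool.or_eq_true, ih, List.length_cons, Nat.exists_lt_succ_left]
    rfl

/-- First square of a state. -/
def fA (S : List Row) (i j : ℕ) : ℕ := (S.getD i ([], [], 0)).1.getD j 0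

/-- Second square of a state. -/
def fB (S : List Row) (i j : ℕ) : ℕ := (S.getD i ([], [], 0)).2.1.getD j 0

/-- Invariant of states. -/
structure Inv (n : ℕ) (S : List Row) : Prop where
  len : S.length = n
  lenA : ∀ i < n, (S.getD i ([], [], 0)).1.length = n
  lenB : ∀ i < n, (S.getD i ([], [], 0)).2.1.length = n
  mask : ∀ i < n, ∀ t, (S.getD i ([], [], 0)).2.2.testBit t = true ↔
    ∃ j < n, 10 * (fA S i j * n + fB S i j) = t
  latA : FLat n (fA S)
  latB : FLat n (fB S)

theorem Inv.sp {n : ℕ} {S : List Row} (h : Inv n S) (hn : n ≤ 31) : Sp n (orM S % 1023) := by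
  refine sp_of_fun hn h.latA h.latB fun t => ?_
  rw [orM_bit, h.len]
  constructor
  · rintro ⟨i, hi, ht⟩
    obtain ⟨j, hj, e⟩ := (h.mask i hi t).1 ht
    exact ⟨i, hi, j, hj, e.symm⟩
  · rintro ⟨i, hi, j, hj, e⟩
    exact ⟨i, hi, (h.mask i hi t).2 ⟨j, hj, e.symm⟩⟩

/-- One step of a walk. -/
def stepK (n i k C : ℕ) (S : List Row) (d : ℕ) (K : List Row → ℕ) : ℕ :=
  cond (Nat.beq i k) d <|
  getK S i d fun ai bi => getK S k d fun ak bk => swK bi bk C fun bi' bk' =>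
    rmK n ai bi' 0 0 fun Mi Vi => rmK n ak bk' 0 0 fun Mk Vk =>
      cond (Nat.beq Vi (Nat.sub (Nat.pow 2 n) 1)) (cond (Nat.beq Vk (Nat.sub (Nat.pow 2 n) 1))
        (frc Mi fun Mi => frc Mk fun Mk => setK (ai, bi', Mi) S i fun S =>
          setK (ak, bk', Mk) S k K) d) d

theorem stepK_eq {n i k C : ℕ} {S : List Row} (h : Inv n S) (d : ℕ) (K : List Row → ℕ) :
    stepK n i k C S d K = d ∨ ∃ S', Inv n S' ∧ stepK n i k C S d K = K S' := by
  unfold stepK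
  rcases hik : Nat.beq i k with _ | _
  swap
  · left; rfl
  have hik : i ≠ k := Nat.ne_of_beq_eq_false hik
  rw [cond_false]
  rcases getK_eq S i d _ with ⟨-, e⟩ | ⟨hi, e⟩
  · left; exact e
  rw [e]
  rcases getK_eq S k d _ with ⟨-, e⟩ | ⟨hk, e⟩
  · left; exact e
  rw [e, swK_eq]
  rw [h.len] at hi hk
  set ai := (S.getD i ([], [], 0)).1 with hai
  set bi := (S.getD i ([], [], 0)).2.1 with hbi
  set ak := (S.getD k ([], [], 0)).1 with hak
  set bk := (S.getD k ([], [], 0)).2.1 with hbk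
  have lai : ai.length = n := h.lenA i hi
  have lbi : bi.length = n := h.lenB i hi
  have lak : ak.length = n := h.lenA k hk
  have lbk : bk.length = n := h.lenB k hk
  have lbi' : (sw bi bk C).length = n := by rw [sw_length _ _ _ (by rw [lbi, lbk]), lbi]
  have lbk' : (sw bk bi C).length = n := by rw [sw_length _ _ _ (by rw [lbi, lbk]), lbk]
  obtain ⟨Mi, Vi, e1, hMi, hVi⟩ := rmK_eq n ai (sw bi bk C) (by rw [lai, lbi']) 0 0
    (fun Mi Vi => rmK n ak (sw bk bi C) 0 0 fun Mk Vk =>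
      cond (Nat.beq Vi (Nat.sub (Nat.pow 2 n) 1)) (cond (Nat.beq Vk (Nat.sub (Nat.pow 2 n) 1))
        (frc Mi fun Mi => frc Mk fun Mk => setK (ai, sw bi bk C, Mi) S i fun S =>
          setK (ak, sw bk bi C, Mk) S k K) d) d)
  rw [e1]
  obtain ⟨Mk, Vk, e2, hMk, hVk⟩ := rmK_eq n ak (sw bk bi C) (by rw [lak, lbk']) 0 0
    (fun Mk Vk =>
      cond (Nat.beq Vi (Nat.sub (Nat.pow 2 n) 1)) (cond (Nat.beq Vk (Nat.sub (Nat.pow 2 n) 1))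
        (frc Mi fun Mi => frc Mk fun Mk => setK (ai, sw bi bk C, Mi) S i fun S =>
          setK (ak, sw bk bi C, Mk) S k K) d) d)
  rw [e2]
  simp only [Nat.zero_testBit, Bool.false_eq_true, false_or, lai, lak] at hMi hVi hMk hVk
  rcases hv1 : Nat.beq Vi (Nat.sub (Nat.pow 2 n) 1) with _ | _
  · left; rfl
  rcases hv2 : Nat.beq Vk (Nat.sub (Nat.pow 2 n) 1) with _ | _
  · left; rfl
  right
  obtain ⟨ri1, ri2⟩ := full_mask hVi (Nat.eq_of_beq_eq_true hv1)
  obtain ⟨rk1, rk2⟩ := full_mask hVk (Nat.eq_of_beq_eq_true hv2)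
  simp only [cond_true, frc_eq, setK_eq]
  refine ⟨_, ?_, rfl⟩
  set S' := (S.set i (ai, sw bi bk C, Mi)).set k (ak, sw bk bi C, Mk) with hS'
  have gi : S'.getD i ([], [], 0) = (ai, sw bi bk C, Mi) := by
    simp [hS', List.getD_eq_getElem?_getD, List.getElem?_set, hik.symm, h.len, hi]
  have gk : S'.getD k ([], [], 0) = (ak, sw bk bi C, Mk) := by
    simp [hS', List.getD_eq_getElem?_getD, List.getElem?_set, h.len, hk]
  have go : ∀ x, x ≠ i → x ≠ k → S'.getD x ([], [], 0) = S.getD x ([], [], 0) := by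
    intro x hxi hxk
    simp [hS', List.getD_eq_getElem?_getD, List.getElem?_set, hxi.symm, hxk.symm]
  have fAe : ∀ x, fA S' x = fA S x := by
    intro x; funext j
    unfold fA
    by_cases hxi : x = i
    · subst hxi; rw [gi]
    · by_cases hxk : x = k
      · subst hxk; rw [gk]
      · rw [go x hxi hxk]
  have fBo : ∀ x, x ≠ i → x ≠ k → ∀ j, fB S' x j = fB S x j := by
    intro x hxi hxk j
    unfold fB; rw [go x hxi hxk]
  have fBi : ∀ j, fB S' i j = (sw bi bk C).getD j 0 := by
    intro j; unfold fB; rw [gi]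
  have fBk : ∀ j, fB S' k j = (sw bk bi C).getD j 0 := by
    intro j; unfold fB; rw [gk]
  have sBi : ∀ j, fB S' i j = if (C / 2 ^ j) % 2 = 0 then fB S i j else fB S k j := by
    intro j; rw [fBi, sw_get _ _ _ _ (by rw [lbi, lbk])]; rfl
  have sBk : ∀ j, fB S' k j = if (C / 2 ^ j) % 2 = 0 then fB S k j else fB S i j := by
    intro j; rw [fBk, sw_get _ _ _ _ (by rw [lbi, lbk])]; rfl
  have sB : ∀ j, ∃ σ : ℕ → ℕ, Injective σ ∧ (∀ x < n, σ x < n) ∧ ∀ x, fB S' x j = fB S (σ x) j := by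
    intro j
    by_cases hc : (C / 2 ^ j) % 2 = 0
    · refine ⟨id, injective_id, fun x hx => hx, fun x => ?_⟩
      by_cases hxi : x = i
      · subst hxi; rw [sBi, if_pos hc]; rfl
      · by_cases hxk : x = k
        · subst hxk; rw [sBk, if_pos hc]; rfl
        · exact fBo x hxi hxk j
    · refine ⟨Equiv.swap i k, (Equiv.swap i k).injective, fun x hx => ?_, fun x => ?_⟩
      · rw [Equiv.swap_apply_def]; split_ifs <;> assumption
      · by_cases hxi : x = i
        · subst hxi; rw [sBi, if_neg hc, Equiv.swap_apply_left]
        · by_cases hxk : x = k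
          · subst hxk; rw [sBk, if_neg hc, Equiv.swap_apply_right]
          · rw [Equiv.swap_apply_of_ne_of_ne hxi hxk]; exact fBo x hxi hxk j
  refine ⟨by simp [hS', h.len], ?_, ?_, ?_, ?_, ?_, ?_, ?_⟩
  · intro x hx
    by_cases hxi : x = i
    · subst hxi; rw [gi]; exact lai
    · by_cases hxk : x = k
      · subst hxk; rw [gk]; exact lak
      · rw [go x hxi hxk]; exact h.lenA x hx
  · intro x hx
    by_cases hxi : x = i
    · subst hxi; rw [gi]; exact lbi'
    · by_cases hxk : x = k
      · subst hxk; rw [gk]; exact lbk'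
      · rw [go x hxi hxk]; exact h.lenB x hx
  · intro x hx t
    rw [fAe]
    by_cases hxi : x = i
    · subst hxi
      simp only [fBi]
      rw [gi]; exact hMi t
    · by_cases hxk : x = k
      · subst hxk
        simp only [fBk]
        rw [gk]; exact hMk t
      · rw [go x hxi hxk, h.mask x hx]
        simp only [fBo x hxi hxk]
  · have : fA S' = fA S := funext fAe
    rw [this]; exact h.latA
  · intro x hx j hj
    obtain ⟨σ, -, h2, h3⟩ := sB j
    rw [h3]
    exact h.latB.lt _ (h2 x hx) j hj
  · intro x hx j hj j' hj' e
    by_cases hxi : x = i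
    · subst hxi; rw [fBi, fBi] at e; exact ri2 j hj j' hj' e
    · by_cases hxk : x = k
      · subst hxk; rw [fBk, fBk] at e; exact rk2 j hj j' hj' e
      · rw [fBo x hxi hxk, fBo x hxi hxk] at e; exact h.latB.row x hx j hj j' hj' e
  · intro j hj x hx y hy e
    obtain ⟨σ, h1, h2, h3⟩ := sB j
    rw [h3, h3] at e
    exact h1 (h.latB.col j hj _ (h2 x hx) _ (h2 y hy) e)

/-- A walk: the result collects all counts attained. -/
def run (n f : ℕ) : ℕ → List Row → ℕ → ℕ :=
  Nat.rec (fun _ _ acc => acc)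
    (fun _ ih W S acc => stepK n (Nat.mod W 32) (Nat.mod (Nat.shiftRight W 5) 32)
      (Nat.mod (Nat.shiftRight W 10) 1048576) S acc fun S =>
        frc (Nat.lor acc (Nat.pow 2 (Nat.mod (orM S) 1023))) fun acc =>
          frc (Nat.shiftRight W 30) fun W => ih W S acc) f

theorem run_sp {n : ℕ} (hn : n ≤ 31) (f : ℕ) : ∀ (W : ℕ) (S : List Row) (acc : ℕ), Inv n S →
    (∀ r, acc.testBit r = true → Sp n r) → ∀ r, (run n f W S acc).testBit r = true → Sp n r := by
  induction f with
  | zero => intro W S acc _ h; exact h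
  | succ f ih =>
    intro W S acc hS h
    have e : run n (f + 1) W S acc = stepK n (W % 32) (W >>> 5 % 32) (W >>> 10 % 1048576) S acc
        fun S => frc (acc ||| 2 ^ (orM S % 1023)) fun acc => frc (W >>> 30) fun W =>
          run n f W S acc := rfl
    rw [e]
    rcases stepK_eq (i := W % 32) (k := W >>> 5 % 32) (C := W >>> 10 % 1048576) hS acc
      (fun S => frc (acc ||| 2 ^ (orM S % 1023)) fun acc => frc (W >>> 30) fun W =>
          run n f W S acc) with h1 | ⟨S', h1, h2⟩
    · rw [h1]; exact h
    · rw [h2]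
      simp only [frc_eq]
      apply ih _ _ _ h1
      intro r hr
      rw [Nat.testBit_or, Bool.or_eq_true, Nat.testBit_two_pow, decide_eq_true_iff] at hr
      rcases hr with hr | hr
      · exact h r hr
      · rw [← hr]; exact h1.sp hn

/-- Build a list. -/
def mkLK (f : ℕ → ℕ) (m : ℕ) : List ℕ → (List ℕ → ℕ) → ℕ :=
  Nat.rec (fun acc k => k acc) (fun m ih acc k => frc (f m) fun x => ih (x :: acc) k) m

theorem mkLK_eq (f : ℕ → ℕ) (m : ℕ) : ∀ acc k,
    mkLK f m acc k = k ((List.range m).map f ++ acc) := by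
  induction m with
  | zero => intro acc k; rfl
  | succ m ih =>
    intro acc k
    have : mkLK f (m + 1) acc k = frc (f m) fun x => mkLK f m (x :: acc) k := rfl
    rw [this, frc_eq, ih, List.range_succ]
    simp

/-- Build a state. -/
def mkSK (n NA NB m : ℕ) : List Row → (List Row → ℕ) → ℕ :=
  Nat.rec (fun acc k => k acc) (fun i ih acc k =>
    mkLK (e5 n NA i) n [] fun a => mkLK (e5 n NB i) n [] fun b =>
      rmK n a b 0 0 fun M _ => frc M fun M => ih ((a, b, M) :: acc) k) m

theorem getD_map_range (f : ℕ → ℕ) (n j : ℕ) (hj : j < n) :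
    ((List.range n).map f).getD j 0 = f j := by
  simp [List.getD_eq_getElem?_getD, hj]

/-- Good rows of a packed pair. -/
def GoodRow (n NA NB i : ℕ) (R : Row) : Prop :=
  R.1 = (List.range n).map (e5 n NA i) ∧ R.2.1 = (List.range n).map (e5 n NB i) ∧
  ∀ t, R.2.2.testBit t = true ↔ ∃ j < n, 10 * (e5 n NA i j * n + e5 n NB i j) = t

theorem mkSK_eq (n NA NB m : ℕ) : ∀ acc k, ∃ L : List Row, mkSK n NA NB m acc k = k (L ++ acc) ∧
    L.length = m ∧ ∀ i < m, GoodRow n NA NB i (L.getD i ([], [], 0)) := by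
  induction m with
  | zero => intro acc k; exact ⟨[], rfl, rfl, by simp⟩
  | succ m ih =>
    intro acc k
    have : mkSK n NA NB (m + 1) acc k = mkLK (e5 n NA m) n [] fun a => mkLK (e5 n NB m) n [] fun b =>
      rmK n a b 0 0 fun M _ => frc M fun M => mkSK n NA NB m ((a, b, M) :: acc) k := rfl
    rw [this, mkLK_eq, mkLK_eq, List.append_nil, List.append_nil]
    obtain ⟨M, V, h1, h2, -⟩ := rmK_eq n ((List.range n).map (e5 n NA m))
      ((List.range n).map (e5 n NB m)) (by simp) 0 0 (fun M _ => frc M fun M =>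
        mkSK n NA NB m (((List.range n).map (e5 n NA m), (List.range n).map (e5 n NB m), M) :: acc) k)
    rw [h1, frc_eq]
    obtain ⟨L, h3, h4, h5⟩ := ih
      (((List.range n).map (e5 n NA m), (List.range n).map (e5 n NB m), M) :: acc) k
    refine ⟨L ++ [((List.range n).map (e5 n NA m), (List.range n).map (e5 n NB m), M)], ?_, ?_, ?_⟩
    · rw [h3]; simp
    · simp [h4]
    · intro i hi
      rcases Nat.lt_succ_iff_lt_or_eq.1 hi with h | h
      · rw [List.getD_append _ _ _ _ (by omega)]
        exact h5 i h
      · subst h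
        rw [List.getD_append_right _ _ _ _ (by omega), h4, Nat.sub_self]
        refine ⟨rfl, rfl, fun t => ?_⟩
        show M.testBit t = true ↔ _
        rw [h2]
        simp only [Nat.zero_testBit, Bool.false_eq_true, false_or, List.length_map,
          List.length_range]
        constructor
        · rintro ⟨j, hj, e⟩
          rw [getD_map_range _ _ _ hj, getD_map_range _ _ _ hj] at e
          exact ⟨j, hj, e⟩
        · rintro ⟨j, hj, e⟩
          refine ⟨j, hj, ?_⟩
          rw [getD_map_range _ _ _ hj, getD_map_range _ _ _ hj]
          exact e

/-- A complete walk from packed data. -/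
def walk (n NA NB f W : ℕ) : ℕ :=
  cond (latB n NA) (cond (latB n NB) (cond (Nat.ble n 31)
    (mkSK n NA NB n [] fun S => run n f W S (Nat.pow 2 (Nat.mod (orM S) 1023))) 0) 0) 0

theorem walk_sp (n NA NB f W : ℕ) : ∀ r, (walk n NA NB f W).testBit r = true → Sp n r := by
  unfold walk
  rcases h1 : latB n NA with _ | _
  · simp
  rcases h2 : latB n NB with _ | _
  · simp
  rcases h3 : Nat.ble n 31 with _ | _
  · simp
  have h1 := latB_flat h1
  have h2 := latB_flat h2
  have hn := Nat.le_of_ble_eq_true h3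
  simp only [cond_true]
  obtain ⟨L, h4, h5, h6⟩ := mkSK_eq n NA NB n [] fun S =>
    run n f W S (Nat.pow 2 (Nat.mod (orM S) 1023))
  rw [h4, List.append_nil]
  have eA : ∀ i < n, ∀ j < n, fA L i j = e5 n NA i j := by
    intro i hi j hj
    unfold fA; rw [(h6 i hi).1, getD_map_range _ _ _ hj]
  have eB : ∀ i < n, ∀ j < n, fB L i j = e5 n NB i j := by
    intro i hi j hj
    unfold fB; rw [(h6 i hi).2.1, getD_map_range _ _ _ hj]
  have hI : Inv n L := by
    refine ⟨h5, ?_, ?_, ?_, ⟨?_, ?_, ?_⟩, ⟨?_, ?_, ?_⟩⟩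
    · intro i hi; rw [(h6 i hi).1]; simp
    · intro i hi; rw [(h6 i hi).2.1]; simp
    · intro i hi t
      rw [(h6 i hi).2.2]
      constructor
      · rintro ⟨j, hj, e⟩
        exact ⟨j, hj, by rw [eA i hi j hj, eB i hi j hj]; exact e⟩
      · rintro ⟨j, hj, e⟩
        refine ⟨j, hj, ?_⟩
        rw [eA i hi j hj, eB i hi j hj] at e; exact e
    · intro i hi j hj; rw [eA i hi j hj]; exact h1.lt i hi j hj
    · intro i hi j hj j' hj'; rw [eA i hi j hj, eA i hi j' hj']; exact h1.row i hi j hj j' hj'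
    · intro j hj i hi i' hi'; rw [eA i hi j hj, eA i' hi' j hj]; exact h1.col j hj i hi i' hi'
    · intro i hi j hj; rw [eB i hi j hj]; exact h2.lt i hi j hj
    · intro i hi j hj j' hj'; rw [eB i hi j hj, eB i hi j' hj']; exact h2.row i hi j hj j' hj'
    · intro j hj i hi i' hi'; rw [eB i hi j hj, eB i' hi' j hj]; exact h2.col j hj i hi i' hi'
  apply run_sp hn _ _ _ _ hI
  intro r hr
  have hr : (2 ^ (orM L % 1023)).testBit r = true := hr
  rw [Nat.testBit_two_pow, decide_eq_true_iff] at hr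
  rw [← hr]; exact hI.sp hn

theorem sp_list {n : ℕ} {L : List (ℕ × ℕ × ℕ)}
    (hL : L.all (fun p => okB n p.2.1 p.2.2 p.1) = true) {r : ℕ} (hr : r ∈ L.map (fun p => p.1)) :
    Sp n r := by
  rw [List.mem_map] at hr
  obtain ⟨p, hp, rfl⟩ := hr
  exact sp_okB (List.all_eq_true.1 hL p hp)

/-- Coverage check. -/
def covB (n w : ℕ) (l : List ℕ) : Bool :=
  allB (fun r => Nat.blt r n || Nat.beq r (n + 1) || Nat.beq r (Nat.mul n n - 1) ||
    Nat.testBit w r || l.any (Nat.beq r)) (Nat.mul n n + 1)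

theorem full_small {n w1 w2 : ℕ} (L : List (ℕ × ℕ × ℕ)) (A B f W A' f' W' : ℕ)
    (hL : L.all (fun p => okB n p.2.1 p.2.2 p.1) = true)
    (h1 : Nat.beq (walk n A B f W) w1 = true) (h2 : Nat.beq (walk n A' A' f' W') w2 = true)
    (hc : covB n (Nat.lor w1 w2) (L.map (fun p => p.1)) = true) : Full n := by
  intro r h3 h4 h5 h6
  have h1 := Nat.eq_of_beq_eq_true h1
  have h2 := Nat.eq_of_beq_eq_true h2
  have e : n ^ 2 = Nat.mul n n := sq n
  rw [e] at h4 h6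
  have hc := (allB_iff _ _).1 hc r (by omega)
  simp only [Bool.or_eq_true, List.any_eq_true] at hc
  rcases hc with (((h | h) | h) | h) | ⟨x, h, hx⟩
  · have := Nat.le_of_ble_eq_true h
    omega
  · exact absurd (Nat.eq_of_beq_eq_true h) h5
  · exact absurd (Nat.eq_of_beq_eq_true h) h6
  · have h : (w1 ||| w2).testBit r = true := h
    rw [Nat.testBit_or, Bool.or_eq_true, ← h1, ← h2] at h
    rcases h with h | h
    · exact walk_sp _ _ _ _ _ _ h
    · exact walk_sp _ _ _ _ _ _ h
  · rw [← Nat.eq_of_beq_eq_true hx] at h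
    exact sp_list hL h

end ROrth

namespace ROrth

/-! ### Explicit data -/

theorem sp_3 {r : ℕ} (hr : r ∈ [3, 9]) : Sp 3 r :=
  sp_list (L := [
    (3, 36574364736,
      69826840608),
    (9, 69826840608,
      69861377026)]) (by decide +kernel) hr

theorem sp_4 {r : ℕ} (hr : r ∈ [4, 6, 8, 9, 12, 16]) : Sp 4 r :=
  sp_list (L := [
    (4, 37856178837489841178625,
      1257873498147170388000),
    (6, 37856178837489841178625,
      1293650024351054990400),
    (8, 37856178837489841178625,
      114591176476235276520450),
    (9, 79136642415538821137475,
      114519729155064657415200),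
    (12, 79136642415538821137475,
      1257912832109428375650),
    (16, 41394602915962976995425,
      2473125841909321891875)]) (by decide +kernel) hr

theorem sp_5 {r : ℕ} (hr : r ∈ [5, 7, 10, 11, 12, 13, 14, 15, 16, 17, 18, 19, 21, 25]) : Sp 5 r :=
  sp_list (L := [
    (5, 1499278254598348029276715434150823968,
      1499278254598348029276715434150823968),
    (7, 167575883917625771299906095302150176,
      167575883917625697584989591377643552),
    (10, 167575883917625771299906095302150176,
      84501669482268911987306842472679456),
    (11, 1499278254598348029276715434150823968,
      1333208499140684255685592139742414880),
    (12, 167575883917625771299906095302150176,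
      46854943580549733919517599045093408),
    (13, 1499278254598348029276715434150823968,
      1412431511976713213605541125602510880),
    (14, 167575883917625771299906095302150176,
      84541006262574810377504182298052640),
    (15, 1499278254598348029276715434150823968,
      84501628782572301196221854089578528),
    (16, 167575883917625771299906095302150176,
      84501709096310029006658231412557856),
    (17, 1499278254598348029276715434150823968,
      4029308564983357689525162795482581024),
    (18, 167575883917625771299906095302150176,
      46855020369135434655141524733528096),
    (19, 1499278254598348029276715434150823968,
      1412470926633601419618333907195365408),
    (21, 167575883917625771299906095302150176,
      4029308646682564577964837184351602720),
    (25, 1499278254598348029276715434150823968,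
      4070924343289360377619652785301719072)]) (by decide +kernel) hr

theorem sp_6 {r : ℕ} (hr : r ∈ [6, 8, 9, 10, 11, 12, 13, 14, 15, 16, 17, 18, 19, 20, 21, 22, 23, 24, 25, 26, 27, 28, 29, 30, 31, 32, 34]) : Sp 6 r :=
  sp_list (L := [
    (6, 151157452684815644771047467087941761535819489622494370,
      146859037792724269035776201533213730374697450658106437),
    (8, 151157452684815644771047467087941761535819489622494370,
      146853374473705392532021537196839884470299110988057665),
    (9, 1597608348389564420083128044363979417783796744978497,
      243989114935167615912105593914881790906500625357410339),
    (10, 151157452684815644771047467087941761535819489622494370,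
      149752993722169903919222628964189381361578170447465537),
    (11, 146859037792724269035776201533213730374697450658106437,
      193063136054298346698554462019205877211305074040607780),
    (12, 146859037792724269035776201533213730374697450658106437,
      97284999264098007170557112253498511475361048690790437),
    (13, 146859037792724269035776201533213730374697450658106437,
      143911235998719215186839212030955707162969160417283202),
    (14, 151157452684815644771047467087941761535819489622494370,
      146853374473705392532021537162989958062324980305103940),
    (15, 151157452684815644771047467087941761535819489622494370,
      146858993547871575896068351488775832076312762265898052),
    (16, 151157452684815644771047467087941761535819489622494370,
      146859037792550049780824664179586333031338076936342596),
    (17, 101768976336267673272188629130333192653610562999192705,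
      239547613021677723813063097278573189934377430872525984),
    (18, 151157452684815644771047467087941761535819489622494370,
      146858993547871575896068351522513640326728390901073952),
    (19, 146859037792724269035776201533213730374697450658106437,
      242450019503779817711844760427816703841133322722939907),
    (20, 146859037792724269035776201533213730374697450658106437,
      143724169499613854066574746132928554975345249265718275),
    (21, 151157452684815644771047467087941761535819489622494370,
      196146680514635300678961854806025049505450950472635459),
    (22, 151157452684815644771047467087941761535819489622494370,
      196146680517417451969363439253133346101179804015531075),
    (23, 151157452684815644771047467087941761535819489622494370,
      196146680517417451840736322977418815698497308280850464),
    (24, 151157452684815644771047467087941761535819489622494370,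
      196146680517417451757821753366748483255924084852230176),
    (25, 52383375887690832042533878533393037588068602305646688,
      51070857590051645085862843255224872026439759359543425),
    (26, 52383375887690832042533878533393037588068602305646688,
      97511576346020510556343972068861844761099967215437925),
    (27, 52383375887690832042533878533393037588068602305646688,
      103315195156795531934275159348544243645601709587171429),
    (28, 52383375887690832042533878533393037588068602305646688,
      95835234058679048916788343555602479955555253210843237),
    (29, 52383375887690832042533878533393037588068602305646688,
      97511576346020510597883420231154526213936825319392418),
    (30, 52383375887690832042533878533393037588068602305646688,
      199138505628520928976558871247320811281386396387938307),
    (31, 52383375887690832042533878533393037588068602305646688,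
      103269844187137866713105672117688345961955182508053539),
    (32, 151342882129514989846452745856348426278301593216583844,
      196101595149764278194696133970198311367963609924799618),
    (34, 52383375887690832042533878533393037588068602305646688,
      193292500506445010009744538179867694865334945766707235)]) (by decide +kernel) hr

theorem full_7 : Full 7 :=
  full_small (w1 := 274810798080)
    (w2 := 67108480) [
    (49, 10827387603901014554495780465858398267023274485294074118321278972067908613,
      5576936466686591299557191449087768603626807051332204066884849850402375776),
    (47, 10884217436858265445318420508575552892153205699735451089191489941739309252,
      1939664009102195208618284075268002365778432750427006992133603798696395781),
    (46, 10716962981336915478112618227164786261797195150655621055197820847131787398,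
      7183316090927890921044804174167747614068756934221745238740562379911825569),
    (45, 10827387603901014554495780465858398267023274485294074118321278972067908613,
      5576936466480903524035542593840574242444837361391910068193970156542789728),
    (44, 10884217436858265445318420508575552892153205699735451089191489941739309252,
      5521670109683616800821513496391924253122292917012826861703296438367226885),
    (43, 10827387603901014554495780465858398267023274485294074118321278972067908613,
      5576936466480903524035406674188302468473444537544707683386700104920631392),
    (42, 10827387603901014554495780465858398267023274485294074118321278972067908613,
      5576936466480903426051328341681054936949114340417300103506614372422289504),
    (41, 10827387603901014554495780465858398267023274485294074118321278972067908613,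
      5583838002203110652724389701707276424924709647988582784904781168469248096),
    (40, 10827387603901014554495780465858398267023274485294074118321278972067908613,
      5583838002203110652724525621359540159849799326950278934022903009364838496),
    (39, 10827387603901014554495780465858398267023274485294074118321278972067908613,
      5576936466480903426051328341681050853685326532599191400033719605896841312),
    (38, 10827387603901014554495780465858398267023274485294074118321278972067908613,
      5576828732006526492049336462793383894484162005898864513442896494764132448)]
    10827387603901014554495780465858398267023274485294074118321278972067908613
    5576828732006531150740003971280524659884546075284032513778195470092503136
    11 115059940167294581589719878722411172232366484197870926632754346935940209811981020516815971840164
    10827118012517242883303467343528736154269214950586317213562790139261976772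
    20 332918314334780207822438886329650443524611169777896286659557632884058748503103356659995204314439024804065733674182373091901120245151553187294583359293482367868033282173478938785
    (by decide +kernel) (by decide +kernel) (by decide +kernel) (by decide +kernel)

theorem full_8 : Full 8 :=
  full_small (w1 := 9007164895002624)
    (w2 := 34359737600) [
    (64, 477943769335134938761664582325865910351329459681581066795078957069834357860389934281013407685700,
      479966739071736751923083424827321801283869652584913320985430543515560368294060313406105103466625),
    (62, 477943769335134938761664582325865910351329459681581066795078957069834357860389934281013407685700,
      479836368893460740815591652369294950303457633702717179246444149791654001516485000232120842551425),
    (61, 477943769335134938761664582325865910351329459681581066795078957069834357860389934281013407685700,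
      480096854868934513223873229861706675865961709896970382944285214115589244842605337793933519978625),
    (60, 477943769335134938761664582325865910351329459681581066795078957069834357860389934281013407685700,
      79469170209558538781356836537067465905978184718383039718371279359491129938028636491222002794625),
    (59, 477943769335134938761664582325865910351329459681581066795078957069834357860389934281013407685700,
      479966739071736407325825854564224113563109607939809487342802469387107248174752282228962746269825),
    (58, 477943769335134938761664582325865910351329459681581066795078957069834357860389934281013407685700,
      79729910566110216399082811190016904756530117953547735105995701058827587329517955442960516612225),
    (57, 477943769335134938761664582325865910351329459681581066795078957069834357860389934281013407685700,
      79599667578373330194942022443817617565755187644625796465382318707368114065114694405200351953025),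
    (56, 477943769335134938761664582325865910351329459681581066795078957069834357860389934281013407685700,
      79469170209558194184099266273963202795706080189146888142121897415364263594632239866690474705025),
    (55, 477943769335134938761664582325865910351329459681581066795078957069834357860389934281013407685700,
      79469170209558194184099266273966391061121438077425127926972062610293235181419447534284719620225),
    (54, 477943769335134938761664582325865910351329459681581066795078957069834357860389934281013407685700,
      79469170209558194184099266273963202896041628240718452676818046087327104222520935680895685329025),
    (53, 477943769335134938761664582325865910351329459681581066795078957069834357860389934281013407685700,
      79469170209679603579173196846795194684791462391959099549294642638064423195606861813244459319425)]
    477943769335134938761664582325865910351329459681581066795078957069834357860389934281013407685700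
    79469170209801020384933771219591628324990401997812330035108716771950758169912022943745669431425
    17 502476647123867359221007859211458700213613457089129134876560588579265285892463253409732654809931918393396932466264710892440057084534234307411520278624
    133570876230324325480142977152497731233824140261903943419172914296657926442700843574662680022050
    33 100747058453086929330699463690012626251370276606067319199931765687533947738811014769711180035769385925986201449909563201014674372972222294880733201131885007475622791192342548494253393553313725838554317771213498400436221962855609962980166346568689222883273453540710322021285237678225941143421157
    (by decide +kernel) (by decide +kernel) (by decide +kernel) (by decide +kernel)

theorem full_9 : Full 9 :=
  full_small (w1 := 1180591603125225259008)
    (w2 := 17592186042880) [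
    (81, 21071641521966130533928289975806782714270066354228169380127813563786082012042383287127105308533522633914839354747308377218,
      16061053462091769478812551292224973965034301851623334449294910536797631593318436984118298540389705127980693695363150879873),
    (79, 21071641521966130533928289975806782714270066354228169380127813563786082012042383287127105308533522633914839354747308377218,
      10896553859832039004306631284070873625663837979557544914498133646046664867312016504730706398041410319292180782853740665985),
    (78, 21071641521966130533928289975806782714270066354228169380127813563786082012042383287127105308533522633914839354747308377218,
      16078705560341680667223176051596787500555326223626351583609846309091293827151670668129483114119648787857799720416892263553),
    (77, 21071641521966130533928289975806782714270066354228169380127813563786082012042383287127105308533522633914839354747308377218,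
      3162412713640072763671113710218249758592902886928879354632308921878829154724618116280722277030206127277560958928948403329),
    (76, 21071641521966130533928289975806782714270066354228169380127813563786082012042383287127105308533522633914839354747308377218,
      3162412713640072763671113710218249758592902886928879354632109661561242271649800090562059767846578196656384157631970909313),
    (75, 21071641521966130533928289975806782714270066354228169380127813563786082012042383287127105308533522633914839354747308377218,
      3162412713640072763671113710226397902490776004761156883503609008369613997974631473286916458308857545212721928566806256769),
    (74, 21071641521966130533928289975806782714270066354228169380127813563786082012042383287127105308533522633914839354747308377218,
      3167456170282904531708385732819843154704666092990954522094437946473946114098008628406339978250823848511879430364530318465),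
    (73, 21071641521966130533928289975806782714270066354228169380127813563786082012042383287127105308533522633914839354747308377218,
      3167456170282904531708385732809653996662174391207972333501163813854056145074111228981606321432956780907895951312159874177),
    (72, 21071641521966130533928289975806782714270066354228169380127813563786082012042383287127105308533522633914839354747308377218,
      3162412713640072763671113710218249758592902886928879354632109661561242261419600839678809528895289616447811994419040722049),
    (71, 21071641521966130533928289975806782714270066354228169380127813563786082012042383287127105308533522633914839354747308377218,
      3167456170282904531708385732809653996662055820108703749658598726186194773537431692361872112978150391953175835240558599297),
    (70, 21071641521966130533928289975806782714270066354228169380127813563786082012042383287127105308533522633914839354747308377218,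
      3157369564524800954361911144474018013899819919525616680729435257535888358532625153563602872971859441007765754859269233793)]
    21071641521966130533928289975806782714270066354228169380127813563786082012042383287127105308533522633914839354747308377218
    3162412713640072763671113710212142629545744171013224673777892464132795082684254554029295371614042596088806941421704682625
    25 543462733494541807976456405411976720473857137306477702974475083780023938998188752791144382051643774486740933678273034133853375089467123669312241111816518928543806341165514983640584444263621487507907420137939881919556748513
    16058694040905191203821948554688242822589241520761498998215461259520038374383766022998296637956330872111704335812038630465
    36 2004428486835514787485651334082771278116634783478033745972532885612000215307096965390303662166227610204699127807511159953792228375360477815146732561379124324620935666082049706374081702126197797085329216987292469747518433106326745617377377829526854385775805759471312934964372538394762388980940674843604451206780067103573153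
    (by decide +kernel) (by decide +kernel) (by decide +kernel) (by decide +kernel)

theorem full_10 : Full 10 :=
  full_small (w1 := 618970019606661340430598144)
    (w2 := 36028797018960896) [
    (100, 937034112047618561454136256974086574129824016004992293563513720865040598762551632258977073257368600775449311376287217586602524711696345164180399071269,
      920860317571943927241044993202357546287743566316875007283759323105351774243495554137709314804840459205571894063163932209104610362033166180174674268201),
    (98, 937034112047618561454136256974086574129824016004992293563513720865040598762551632258977073257368600775449311376287217586602524711696345164180399071269,
      307083994061675999640840895511753255261744297568714217731871523508247736344408696413245456570765622701683898322283751193580922736531460847416160293059),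
    (97, 937034112047618561454136256974086574129824016004992293563513720865040598762551632258977073257368600775449311376287217586602524711696345164180399071269,
      204990320502059371548826310282223739315780880959865460615366252822707430199414462910814618686898102860352213630542942946616525519838471668326512728194),
    (96, 937034112047618561454136256974086574129824016004992293563513720865040598762551632258977073257368600775449311376287217586602524711696345164180399071269,
      920844724072105644893896587250559147992605062668803862318339135937959142857567411208538870107245947352480758378327086837256982431918579248863179182121),
    (95, 937034112047618561454136256974086574129824016004992293563513720865040598762551632258977073257368600775449311376287217586602524711696345164180399071269,
      920860317571943927241044993202027200406492298469505127448307109408588078653027779185904373301579443289588395531003878757785469273886738806608520810537),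
    (94, 937034112047618561454136256974086574129824016004992293563513720865040598762551632258977073257368600775449311376287217586602524711696345164180399071269,
      920860338245145087130044024103391518872617469511281667330004197368877636453574218991333372269009891027418338265247224017149069295923236103366581948457),
    (93, 937034112047618561454136256974086574129824016004992293563513720865040598762551632258977073257368600775449311376287217586602524711696345164180399071269,
      920844729788203775589941842962682709593274372721324799360995539320538599704938912171131003313011366406197047158961012890255218064043537379346277732393),
    (92, 937034112047618561454136256974086574129824016004992293563513720865040598762551632258977073257368600775449311376287217586602524711696345164180399071269,
      920844724072105625019400219810633983681140550858771310289979262764413872585374341952747951252306014756062113542838132856391817300908237055766884782121),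
    (91, 937034112047618561454136256974086574129824016004992293563513720865040598762551632258977073257368600775449311376287217586602524711696345164180399071269,
      920844729978734360065039983715191589976967465447203758498492133128461158666006199360566961721826885693430343086314461185715082369143266781706169880617),
    (90, 937034112047618561454136256974086574129824016004992293563513720865040598762551632258977073257368600775449311376287217586602524711696345164180399071269,
      920844729788203951621195383304653733580701405433056586809695415604567068675233077013291149882743027882790627913450905000619978590132083213819337248809),
    (89, 937034112047618561454136256974086574129824016004992293563513720865040598762551632258977073257368600775449311376287217586602524711696345164180399071269,
      920844729978734541774721057611426946624812930104659132241009116033502849164165403369101708239035544031939167421506395456772681562084771408896882380841)]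
    937034112047618561454136256974086574129824016004992293563513720865040598762551632258977073257368600775449311376287217586602524711696345164180399071269
    920844724072105633270865229513848659905249895021203221140891778180975293453036201156763113353628767811660792706542525427134965150905779226610477568041
    33 5830738318054463222144926686777450861182051056445296401745343652087748637436088013980134498203107062233148147060869152859439066215216404163303974723308428427430037784444015226333113984090853624686280460572495724194696228136994261852499392337294963258824679277621937141749908421012892540555780257
    533872276204077887032073190719663229198776274326104494962594065679732612874447162271031472657086774868089307996286638402966253709742299279643352505505
    46 9668826381446117958811394190065820891597389175449611111496363269341065528170252924808383168425135424500205817857642238122624939721052777003509504151890086104330672830264634965796714567798275798559036999142669247136666670317169802333718792853639807407463181310557122849475438013856811193656618322770158437344270584434156875034543119941143704409856052930055060996572030338983962430352901335648704911608878498889922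
    (by decide +kernel) (by decide +kernel) (by decide +kernel) (by decide +kernel)

theorem full_11 : Full 11 :=
  full_small (w1 := 1298074214633633120156329244098560)
    (w2 := 73786976294838200320) [
    (121, 41532667568627467444582172823436495390493228628335386355830736782506332930070273852427721227147810160614531322205586117375077216711812869228733127258999368848802510710483731682106656,
      42294476352876899613323665361330199172305664107777299873973413492081769215129903890629095131478901881447728450842052816553953840646951207350484357165275543703379746864450919438919904),
    (119, 41532667568627467444582172823436495390493228628335386355830736782506332930070273852427721227147810160614531322205586117375077216711812869228733127258999368848802510710483731682106656,
      42294480310163662249932925547857359358747157106720598785904264586687810429401206802862352060883036496952884736460195083601129243754988012457796382999307143772316416555028632062568544),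
    (118, 41532667568627467444582172823436495390493228628335386355830736782506332930070273852427721227147810160614531322205586117375077216711812869228733127258999368848802510710483731682106656,
      42293965987559122382396650699559860852811379081361530598827043778335008466454182202012293962852889390345341019617085319096775164852239689756197325116669568411369861024518572280555744),
    (117, 41532667568627467444582172823436495390493228628335386355830736782506332930070273852427721227147810160614531322205586117375077216711812869228733127258999368848802510710483731682106656,
      42035131629822073426068191216184016697528697985067829875299960936502876927310362482993534924294801212052045278556015124308885328451944227781496776724284891889320940836716566937774304),
    (116, 41532667568627467444582172823436495390493228628335386355830736782506332930070273852427721227147810160614531322205586117375077216711812869228733127258999368848802510710483731682106656,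
      42034878363491200839676864822461729968135973861689556688889656281292189696474708691766740547895670293242763297534360591787449708679191033350280080226049601349577633306764093120751840),
    (115, 41532667568627467444582172823436495390493228628335386355830736782506332930070273852427721227147810160614531322205586117375077216711812869228733127258999368848802510710483731682106656,
      42294476352876899613323665361330199172299757479050505699219212471932624434946584082726725702314960038750451827064512784909065874092913069502994923854604305862024879005414305245079776),
    (114, 41532667568627467444582172823436495390493228628335386355830736782506332930070273852427721227147810160614531322205586117375077216711812869228733127258999368848802510710483731682106656,
      42034878363491200839676864822461729968135973861689556688889656281292189696474708691766740547895670293242763297534360591776201142369705478100458900603681293013514767213836164670859488),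
    (113, 41532667568627467444582172823436495390493228628335386355830736782506332930070273852427721227147810160614531322205586117375077216711812869228733127258999368848802510710483731682106656,
      42553567809600853214187813112335510106179986836469856788043575263533434150857116259832487814721778926696230076960198739269094926773354737858006409369212013997743421948196709171636448),
    (112, 41532667568627467444582172823436495390493228628335386355830736782506332930070273852427721227147810160614531322205586117375077216711812869228733127258999368848802510710483731682106656,
      42294476352876899613323665361330199184780463978766596608262266610973209787271993427469586850159834555988771072685968795979153477489798745238329700123917179354802243189644181684529376),
    (111, 41532667568627467444582172823436495390493228628335386355830736782506332930070273852427721227147810160614531322205586117375077216711812869228733127258999368848802510710483731682106656,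
      42294476352876899613323665361330199172305664107777299873973413492082307909515965845046954847523357437917041776016089720818458605758919513837611549558599150162297291704364269330147552),
    (110, 41532667568627467444582172823436495390493228628335386355830736782506332930070273852427721227147810160614531322205586117375077216711812869228733127258999368848802510710483731682106656,
      42553567809600853214187813112335510106179986836469856788043575263533665021766997391592667436005932048324101413780048620821385794038473157678122636098590121162065551816583751564175584)]
    41532667568627467444582172823436495390493228628335386355830736782506332930070273852427721227147810160614531322205586117375077216711812869228733127258999368848802510710483731682106656
    42294476352876899613323665361330199184780463978766596608262266610973440658181874559229766471443987677616642409505818677531444344754917165058445926853295286519124373058031224077068512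
    43 26349584678324473182433357228537860819427280698906265820858314487587610733249191668812478832432572417374497449155017548326279510819451047054301429963251506493000693666212786614883442657851289131949067895136319606350175975233022280637434561866188735863926944019782242008776929599429351064042453020963535446964803973962299045872447043589906727940017897585683746119729527425916061746729153
    25157480027870950849937778767733612303160501435263821884283221708249191295740950777854146773922007691107392095557388759758714406174160831489571357030089670288166148739758873274034212
    56 104684402374248280030011035715464729650357398791515506256498550720361986747323554445527987552926992563241783990480764066610215862990979100563523547089083537429087700763070427462009381804099399379916323967888782208313045601614444444325589460661241061342496246689695397708668309923255881185820213959474366424768090976104822903024760861332144821504348232417223633394641527790379746462291929555034476709432035738183883958775317876156803113805868838354166207657264723984209929407924275424869047047728849231171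
    (by decide +kernel) (by decide +kernel) (by decide +kernel) (by decide +kernel)

theorem full_12 : Full 12 :=
  full_small (w1 := 10889035741470030226365077630501995413504)
    (w2 := 604462909807314587340800) [
    (144, 1901445967626132076947291919611124059768342036336074844890181492811613928897023519342347444405195576156191173165466151373482721200203253845924202153068351077119302347916293640573776423824270226743641414560350489029825,
      184485177041425394431982484097864539818097603744544422556303705070550171129430692607111646033127649050918193610062142244811497268131945598286372257886146168311864680238957902935682226359840175066678422091223493844000),
    (142, 1783407162198009230461670548673645702644725272522312528443651432188508094030607386852222165850465863774916445941433146524205828397651919598512533150174847730269850554837642169228229703639198326454132360828360604259650,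
      1783580914759297519152180208363949094544106987444334224704063772473236049874683283188901760969138429896643648096421581103418954650226971769674881086971176925072378560638623100548252699387272097612822902801852082258050),
    (141, 1906948239460954951282842068576349373134339425398640773148826023300068780338116599173438199603242903116846985279270536711333872742068744530656666448273785214338226622769667838779340080883188305333263284696145402600800,
      1913212890694018449464801131484927915525846420912957385733460060697723352628514398131055367997202074735269942721980308490509836631249978962742459861098611339205007400298576782589775803751250730746037613329399986433350),
    (140, 1901445967626132076947291919611124059768342036336074844890181492811613928897023519342347444405195576156191173165466151373482721200203253845924202153068351077119302347916293640573776423824270226743641414560350489029825,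
      1906948238658321934332581997809313928770521723033772239838087176116645437860404296994833003439426278361693115251112408135377648671566674506884816398850960273188527548714808731658738494747670672786471359781195186511200),
    (139, 1901445967626132076947291919611124059768342036336074844890181492811613928897023519342347444405195576156191173165466151373482721200203253845924202153068351077119302347916293640573776423824270226743641414560350489029825,
      1907958184435382437241006874015652323101213184623661674125104156305612838991325837743469537535927831581160716546440344508205816092910433540652702702855702030687745499686500711491215023337642724569949610517597953000800),
    (138, 1901445967626132076947291919611124059768342036336074844890181492811613928897023519342347444405195576156191173165466151373482721200203253845924202153068351077119302347916293640573776423824270226743641414560350489029825,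
      1906948238658321934332581997809313928770521723033772239838087176116645437860404296994833003439178382373627643149896958443778661701598853510940659867217083451760317892804326688510914404521096577640133463687360748264800),
    (137, 1901445967626132076947291919611124059768342036336074844890181492811613928897023519342347444405195576156191173165466151373482721200203253845924202153068351077119302347916293640573776423824270226743641414560350489029825,
      1912376698427140000920784476832714811082474322073309512533901540075287121795471020418790412400844097618068072948288552897956487320449593830971664082500602962860238659672351863153123979997122919655654735018306063900000),
    (136, 1901445967626132076947291919611124059768342036336074844890181492811613928897023519342347444405195576156191173165466151373482721200203253845924202153068351077119302347916293640573776423824270226743641414560350489029825,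
      1912334617660980859284360536928058157144641228657751385997038567447571924177823320432834581366383875778294963404772314720900482066617112236141942013148468929436692449319335622255745087389205600563622713917841834319200),
    (135, 1901445967626132076947291919611124059768342036336074844890181492811613928897023519342347444405195576156191173165466151373482721200203253845924202153068351077119302347916293640573776423824270226743641414560350489029825,
      1939266513637435111260659808035719514680154438828295050462543586068941989232970779992747817522748728187658879731601199648227046566997064723815020706413005338932905453615377083089962124354229332296449126660825330818400),
    (134, 1901445967626132076947291919611124059768342036336074844890181492811613928897023519342347444405195576156191173165466151373482721200203253845924202153068351077119302347916293640573776423824270226743641414560350489029825,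
      1896217561419163222477399546834228541681290457881990195596393029476394356461799998753571795348579794765048439008347875837150723988382136352940835307077556951029783815556396276113684489051933228870602994567350760578400),
    (133, 1901445967626132076947291919611124059768342036336074844890181492811613928897023519342347444405195576156191173165466151373482721200203253845924202153068351077119302347916293640573776423824270226743641414560350489029825,
      1896186000603753960940750499277797101752247035909454468674532560016202083083213615896101828140020473812330713033907205374621758553551214254970508817985677352816397323859285324232177056722327765636229731263397567208800)]
    1901445967626132076947291919611124059768342036336074844890181492811613928897023519342347444405195576156191173165466151373482721200203253845924202153068351077119302347916293640573776423824270226743641414560350489029825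
    1896186000603753960940750499277797101622574056055920446992843504854515147694814363876966444368885336377299331560222583766493750967963439096698159405773270150311735752908507037025677390224901816180762345631024120143200
    53 150492992194808822984528340450922664113525387222948900548737558446568749204703748806590816389978131598220921912527561035429965301742464456050490597021426290083480950788197958303939246714747659575552209388505832425412355461790971935262085624995292784397637410913643191926288719807825292981132039460905130268304620937820571041024168871631182910006690641182806196310146666759809854704539313972045482000605399130839253304882761128725403244424480025645328531151799647077781217489155
    1945703749234961319968023785436355807852998386382154856417383913373139140007460149843987896970816765014161050314833997981720746505598976940593900115140600379481211450003351167773433475726830790393141957746493782917350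
    68 247529953196240808602488184194945292133792776283381802874950380537537112087302148589183577645784669107788076860181428681862418246147444051908890842363064777494259759790108604136240258495654105033587545713421052621367267840974455713725144817526920331644346785855799882940079435857182785319787082329870989254566164211028192733240221740175236409103705650564494145080398142200266831614328987888506455832158754108048349313112183366052938769355834495614488857665865064670573350515749246430754838434132816266959550928153599655229926419035424971017406109264717493001125656495948536080772448811683152453572980616978891112
    (by decide +kernel) (by decide +kernel) (by decide +kernel) (by decide +kernel)

theorem full_13 : Full 13 :=
  full_small (w1 := 365375409332725729545969448021929233814386638848)
    (w2 := 4951760157141521099596472320) [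
    (169, 89153593326615456136140052331941652957921665269266768199113640202379135478886079026699862957986319922376362623493549010929254203601341304435700963418522851416989454121499727295037139084374132127696679517285358865229024548586903492968201082507016904288324,
      89627982875313823972042070877746965094457463056626541767404989683260355755364290609994789477665407084851249652730690829047396565148970526115379336306529925978545998152014972643914127025467023356968370459497359121990671055612976049581221575127532095865920),
    (167, 88000647836314703374027777679369442544831674858339407011359156166950805301842482375234798701195798354419713207631652468103124751329280246386610463536079547752649124173850109249417915841121458627495574485873037608551771009694183932448909792653702945902688,
      89626596931576093121423809173386492276904194253375078771751967484713683630800616148433876599356046015183255785139069815192515086088389722044243284534728818291564646857408198845415157493723149470812286626013271700053713906348060593529993498927426945811520),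
    (166, 89626596931576718228699549342088799074790002384915719407138328784781515335334583141776293852389207168221585720427544842211666006290436257502266863333726540217680009743978984771594984815219311813365994546201465329391768698356278968377112880569187866641472,
      88701853478959473414442258489449211976036118416850368946189504514654715713389848554652440731980581146123027097985483736065920592944329218755153243686639626795485420659273557859849596736153058636341541328110832964119379759531247530232841359254754495139904),
    (165, 89153593326615456136140052331941652957921665269266768199113640202379135478886079026699862957986319922376362623493549010929254203601341304435700963418522851416989454121499727295037139084374132127696679517285358865229024548586903492968201082507016904288324,
      89627982875313823972042070877746965094457463056626541767404989683260355755364290609028655097810875257586050956559801694509861104496301200111453850063801254928523408152264105062241619755629290779077008291860268481371577363160702526414403124270278923977792),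
    (164, 89153593326615456136140052331941652957921665269266768199113640202379135478886079026699862957986319922376362623493549010929254203601341304435700963418522851416989454121499727295037139084374132127696679517285358865229024548586903492968201082507016904288324,
      89627982909627426243641800972161883264435156461541499396995548040653545028304845887248207503831654877904784781838179890630321245745236796631639650003998095684334668243425891582825441837599160392154629038675458522984154167464542659368919272962153921053760),
    (163, 89153593326615456136140052331941652957921665269266768199113640202379135478886079026699862957986319922376362623493549010929254203601341304435700963418522851416989454121499727295037139084374132127696679517285358865229024548586903492968201082507016904288324,
      89627982854829703169452322592579336964396722728553566126489828255926076280217707949052947105332883964662147375186380041204490847194703070737174663580152887223239571484418823283431532752653033044629388470209969890500731267257367494465944587306723278259264),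
    (162, 89153593326615456136140052331941652957921665269266768199113640202379135478886079026699862957986319922376362623493549010929254203601341304435700963418522851416989454121499727295037139084374132127696679517285358865229024548586903492968201082507016904288324,
      89627982875260531950460419134523450506692978500146693246956053042049377857267774939202841999710199316689846325762353093099119637372784640621382260607730579745817158578961306382857763475124481514030468535614105946865226593042676279997578896606785663337536),
    (161, 89153593326615456136140052331941652957921665269266768199113640202379135478886079026699862957986319922376362623493549010929254203601341304435700963418522851416989454121499727295037139084374132127696679517285358865229024548586903492968201082507016904288324,
      89627982874887084071803449422671233642061831311028131347478942406347616236016386806081595292609799614750501867508301167343970388280465349928011966025156550408076692276103589378589343637691554520073745305259929499203237849427326386262476041064313429099584),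
    (160, 89153593326615456136140052331941652957921665269266768199113640202379135478886079026699862957986319922376362623493549010929254203601341304435700963418522851416989454121499727295037139084374132127696679517285358865229024548586903492968201082507016904288324,
      89627982854796395655933516150264777180199932510194094242464226834172549052204825926577513392889377707212684949166453659324130073903901683679115714447866958859123976008834342611095958185145048908432977867693410502715304997448920256515311908699281479107648),
    (159, 89153593326615456136140052331941652957921665269266768199113640202379135478886079026699862957986319922376362623493549010929254203601341304435700963418522851416989454121499727295037139084374132127696679517285358865229024548586903492968201082507016904288324,
      89627982908987316393333549368501907696370489892548985963338162028018671578328741155395617391675024087501773699810608150930733976871287083387960113755421756083938291236023763964798216995328474167375814701187781126244983326644905738071223947990351473738816),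
    (158, 89153593326615456136140052331941652957921665269266768199113640202379135478886079026699862957986319922376362623493549010929254203601341304435700963418522851416989454121499727295037139084374132127696679517285358865229024548586903492968201082507016904288324,
      89627982868059043804267323255246154763123860294859557689024723046406675814140628588337432018744789419072921096464634646314147070150864153095457603167011894145279059196861099223007944541205819876210807205335804891249395600302176005347743904597111964107840)]
    89153593326615456136140052331941652957921665269266768199113640202379135478886079026699862957986319922376362623493549010929254203601341304435700963418522851416989454121499727295037139084374132127696679517285358865229024548586903492968201082507016904288324
    89627982908987316393283868789548286085825549714645228108208410464373788885578331143132729062097050787457056914338167953320480144980982235051575582110145290624650850911219391868894809276811614934914334937837331773871708668101836922507771879947345331422272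
    65 765486234905742066819325520038477605989958901373328329318002169076786886575005140194593518780614852794403798980821471038236651139046291199050386134982113256744132446393625719110556729248543659182929101030029760516015280148206943726168026548664981592857645114549345206574978917926596695322399432869239271214680945226339717859698160066618266711319814939795738983978303321522454816213805362503401402412229655727797224542343617987853691702008678096746084934893549399790640472155041130675719051254570539909531753004628040659456615470173864332362475583931333766656200658649224206918480843142
    67375282535788782555039461485339228488551918472077263563617487309307362074385399414992253002132016091132731886207117026025958559691499107297006255903081778610845880330323775325005906237257852514083672713475569248695022447532821581698730777468731889157227
    80 1502617146257288221106110986340424180052058720005635945044441573917516266630867943394024500143496381273540104108925987983486905634263500069200464710732660234136199586244113229250436942871552237831540759950558053121248485447536556458030577105953974573831151028981307236152824331994617136729994550579858666353609336211546650139178508065536904546841310284817833498837303594332782067545803962257012517997174425569168558636732004516480347203580117326660097278290730295997794579570716966552965907090650967163191593468100265139114390669833721314312346008144726582505646847873242079635796201858166692438733330267528366347591780298454276115365460368049692474156558511635542151380201263238803780290134267941796163767398677774726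
    (by decide +kernel) (by decide +kernel) (by decide +kernel) (by decide +kernel)

theorem full_14 : Full 14 :=
  full_small (w1 := 49039857307708443467466942609533064662436260331864981504)
    (w2 := 162259276829213363391578010238976) [
    (196, 4274618825541355251237810893693961798343113244244828374240498830635249766967059977403121774721641033139622533222726252796227088958319667669894621568172886302218907165148220841058800185045783545161066401167921329873796126587001723846594108078575454725595665953416988175659117928934626380407441825,
      4214665968100929744220386616767156323082639285634666862123111333679779175619836300457467828355420985264960475734484203895610360129081501528639840962386846830700433544348681421479867691638990699964635873769192090569615622230259463961653982719818239671564685611846957006407309928949272535308342312),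
    (194, 3963020269266166912170500862541726109910289227247882995159628970458850850494375998532467876265867420715905995565808897182307866481223662194616682541418424680078825541431723895047528893541899783327500978201221879265234129562570874317134886829798922079701948962977264160488588778338806859219305536,
      3963985998333079464724481252753314270802037847280189968107301304181990656681603531619042781150870283576192403114618227028821109241662200838939234849449195547605840754288477375418802680949248182402589530448994615896618865894801897030372274557458568323263013742043961578309854086555521123781481568),
    (193, 4274618825541355251237810893693961798343113244244828374240498830635249766967059977403121774721641033139622533222726252796227088958319667669894621568172886302218907165148220841058800185045783545161066401167921329873796126587001723846594108078575454725595665953416988175659117928934626380407441825,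
      4274628885219436544526284514772619073486171437827055319958816706412929655572023429296802988450407579377544129019415805686498917511909980436585014209060762482926660492837244904780739680690496803582312686704870173263817664368992218034705277530094854813076507364046594661262015184061986378467416392),
    (192, 4274618825541355251237810893693961798343113244244828374240498830635249766967059977403121774721641033139622533222726252796227088958319667669894621568172886302218907165148220841058800185045783545161066401167921329873796126587001723846594108078575454725595665953416988175659117928934626380407441825,
      2039287738534478180005415330769188854174285984877192655028646473968305412110702578209159168701916830237407675365537490893300861853891031964913730343094290743263897674718425953789623129104870900815546518560554321805606061157931700690291792877918025112524764240052874975418686549796626769699345736),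
    (191, 4274618825541355251237810893693961798343113244244828374240498830635249766967059977403121774721641033139622533222726252796227088958319667669894621568172886302218907165148220841058800185045783545161066401167921329873796126587001723846594108078575454725595665953416988175659117928934626380407441825,
      4273693258939974646939998131581231609532769487362685562145611552184064968787982298368702880365009700635615007465292661282201849102041109474473403268251440999897076247303879421597128745337323061007148064609785296372219217682861363984425440058632104589583709487695364156724330644015798604623419712),
    (190, 4274618825541355251237810893693961798343113244244828374240498830635249766967059977403121774721641033139622533222726252796227088958319667669894621568172886302218907165148220841058800185045783545161066401167921329873796126587001723846594108078575454725595665953416988175659117928934626380407441825,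
      2039287738534478180005415330769188854174285992036918634439011324045505949464416832429554655583806265025397970930920435613900738008411096186026067923197901353012873415209251618293223390211298704286180649904495451162296769867801449109035000077565080314036528985268457635961686110888077008351466824),
    (189, 4274618825541355251237810893693961798343113244244828374240498830635249766967059977403121774721641033139622533222726252796227088958319667669894621568172886302218907165148220841058800185045783545161066401167921329873796126587001723846594108078575454725595665953416988175659117928934626380407441825,
      2039287738534478180005415330769188854174285992036918634439011324045505949464416832429554655583806265025397970930920435613900738008411096186026067923197901353012873415209252114085199982883656662306066535957112085163226378187290244328328529626330384872223823640996232050808386383002254370265044296),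
    (188, 4274618825541355251237810893693961798343113244244828374240498830635249766967059977403121774721641033139622533222726252796227088958319667669894621568172886302218907165148220841058800185045783545161066401167921329873796126587001723846594108078575454725595665953416988175659117928934626380407441825,
      1719953288730107339800811124770596495357295926242038674944697963197215263879061555961046964231130715739715743358259593973820877178019179611922924906330640295095488133712022574789959118694999550534746065373499546217846562586691407425082083960456606635635515782463259987014189350000279382553466184),
    (187, 4274618825541355251237810893693961798343113244244828374240498830635249766967059977403121774721641033139622533222726252796227088958319667669894621568172886302218907165148220841058800185045783545161066401167921329873796126587001723846594108078575454725595665953416988175659117928934626380407441825,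
      1719953289018216865818381840825782574216930661708339824648610130547450083532392956790818421557752420028713861061652933677953977857313398136980118516042215297860192161393795052468894855572316064768630445187927280244571323058930014339550097064863847434346418749446885651164354796446276034539754824),
    (186, 4274618825541355251237810893693961798343113244244828374240498830635249766967059977403121774721641033139622533222726252796227088958319667669894621568172886302218907165148220841058800185045783545161066401167921329873796126587001723846594108078575454725595665953416988175659117928934626380407441825,
      1719953289081240824634727228275149673081135119249001617172745701145621863087030741532009795423064897262778957411399933154033133089609072682434153878682620032146762971730715555626109419132380036078765431861404790057770668797322448683617485595764356532339300038603795045837483594676201707093038408),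
    (185, 4274618825541355251237810893693961798343113244244828374240498830635249766967059977403121774721641033139622533222726252796227088958319667669894621568172886302218907165148220841058800185045783545161066401167921329873796126587001723846594108078575454725595665953416988175659117928934626380407441825,
      1719953290809897980740150038777897327180394520401591594940289059762711608151491070024098310807796736299318961431867969270204259485788100831595791516192822087013172415964333849068242626214081542982477887070855684911870292097827071888683829826102820102050105729848243346622896071381722377940571464)]
    4274618825541355251237810893693961798343113244244828374240498830635249766967059977403121774721641033139622533222726252796227088958319667669894621568172886302218907165148220841058800185045783545161066401167921329873796126587001723846594108078575454725595665953416988175659117928934626380407441825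
    1719953289081240824634725380792028582439299551319835837860217262666951659359999227896147949887706303342928898762106354921641373330160684743611449016695694539054058010689274336941619183362679081811933269612937610599314751901249242015976476652529596851363736416921821703509705530404788800486315336
    77 122735417118079363630849393508991412473201648966602571348623516337808344438307372508889316644572016608263214750945352607466175548949235669608830180244222196414931047649235494725358286327317467674184043298925005216618418790862558773576939776916881790985440115323936100186478367208509719840743002540208272018283511869332737893006764274540338793343847275312895693059659690550694744108065752399918015063938471050028908801266413080379511873701710236270743812829607382250938534528441380786508475470723772162499130572330311999671512693016836097932475945966092120206984746479237524016231456131474307442378715865269809775698299705675083042134099521750491710541816374247957611364449581096482890504488292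
    3005660720988072109438841277453463033214400910801272911776754434093961381037244013774782207840130295778345414813830526975889813511802491069190875510207250226571591470369382992685557438058988267966064290349832272687940273594039790972315921968876305176355482166161587802762897970718233145988461828
    94 294201432839743485320498743440460773368876904651252513150954977128182731943253918829793098814668586027529530971463795229762180425734745883771527354433130931384311390721600064342813952910677852329117528182358813438577104167857719767759857718242795105630973995562841485266474561334359706904622104947399938241850574268361118750127812197882762389180680755770791918065373496423144448123281247157487229304368871272752006660194761589805780942511607098294266331435383781753272206332771826580995184747639943454703164752246675759967446624640440493598389180433373878219218875320936448953713285582283121857736339240227650292344768627261876088219618597332807415691178202369093334052051381252459393420499934778268119663923904901302024757676463367084504279215395328934730564753265815520077921083468575511940598980541528758001722507580485277940940625754395377827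
    (by decide +kernel) (by decide +kernel) (by decide +kernel) (by decide +kernel)

theorem full_15 : Full 15 :=
  full_small (w1 := 26328072917139296674479506910283784113444446866906821331334987776)
    (w2 := 10633823966279326983230456482242658304) [
    (225, 205357056474654735340633012326910742457683935266793857912491031531605725949187696227131584543120064636181228539437810878897841856394942588029887857316721456186008827732721224242819109830408830926982379028894365680688071624294434439348244755342424289883986368210715908299753631458075352200228006457977443629830734833417266189127236406454434,
      204897611562021908048815967285528730153412394373733341483607748675162788098493845984571803091308623964458411979288977846404613437246991068462700789835163382120449413296683295041188272012945810620047612448746795872536061060427289080708695898568518568677131055194882867243604019388702278102574135627692693876372992252458924033881198863559821),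
    (223, 204897611562021908060783569148524963235224577895896379739365808628593748017256959477402161084897288431463046343614484368867687613373301129741692587482072729162247314935208715199930840713845304013798794472284714769001716009519177035057998512950929388046111389713229944994748852490152968365913116871990462299076997929056324297714513061588109,
      205357056473411177082263598860276165425454610617086583834773384956973591983904749084540937906039177496603041153140518291993322356138436160124570553276210906387284904166784913030474930806000317163718345094945100995876370146070334964440216184960067259279254067928922775504040305444741854488012163581698108263586140995141306854942222611261602),
    (222, 190695704834634105096170947473528280338239106945766124434952125021461093030678894574875453207343514888214607977411416084322060026715821614865927924291476332871886202681203030269796590239164423409376136097661229779190981016169017213144207858912433693179718214070198587106266297607379095146986183867822123893519590497443721091298437231848898,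
      134601630283831301583382340586910862085212627479636982018484232702760798857517683927219061464071738606689029916497114381813828652672356518491071412268029801232364904719607942641979842840539241175560625505659300891255554907968357129322348447937802033828773221654503244303703912424099179995620017791961401106586580039058303945867764107117826),
    (221, 205357056474654735340633012326910742457683935266793857912491031531605725949187696227131584543120064636181228539437810878897841856394942588029887857316721456186008827732721224242819109830408830926982379028894365680688071624294434439348244755342424289883986368210715908299753631458075352200228006457977443629830734833417266189127236406454434,
      187984295605649083552641014307718964976728607820401242663869510214059970767394394959403348512945515588105057921058098167723271134225040911592350021775771740443876728873401489757737755896232245264281370977705925353514140149897729688062258938404989278291040346998861487091892960061295708489638751985418110016420382864873076947334011259432070),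
    (220, 205357056474654735340633012326910742457683935266793857912491031531605725949187696227131584543120064636181228539437810878897841856394942588029887857316721456186008827732721224242819109830408830926982379028894365680688071624294434439348244755342424289883986368210715908299753631458075352200228006457977443629830734833417266189127236406454434,
      202227087990028491530308738738717100956711386015185597295211595576698848905335289234142220166348413394262544573398952051251486565836389453815168433320199790285100789813553985721405802120671678831037482499796148969500533248168695819937601406703896165031914054079170412067922774596991265032259341885572114738985311488126541014724413714836614),
    (219, 205357056474654735340633012326910742457683935266793857912491031531605725949187696227131584543120064636181228539437810878897841856394942588029887857316721456186008827732721224242819109830408830926982379028894365680688071624294434439348244755342424289883986368210715908299753631458075352200228006457977443629830734833417266189127236406454434,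
      204897611562021908048815967285528730153412394373733341483607854931033382702346674186731105913735028834516796067194145498787972600824585520092779281626249390516496781287006321281753591156631037829578674224205989512568626977994029360898572000024151430280700368541624910300371624978706526174436941755331668490852021135267864171374332841536653),
    (218, 205357056474654735340633012326910742457683935266793857912491031531605725949187696227131584543120064636181228539437810878897841856394942588029887857316721456186008827732721224242819109830408830926982379028894365680688071624294434439348244755342424289883986368210715908299753631458075352200228006457977443629830734833417266189127236406454434,
      204897611562021907653885117955463243853141242576987822896121107093205934816498203881380132316459153328392185778996230973074093195517384611654858081056781284714183071540075088641228526994001489721227280961229884689485470652520762999080153897556009108771744362256409248621182407132413346386634390813844358180648242125186885318620078412115085),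
    (217, 205357056474654735340633012326910742457683935266793857912491031531605725949187696227131584543120064636181228539437810878897841856394942588029887857316721456186008827732721224242819109830408830926982379028894365680688071624294434439348244755342424289883986368210715908299753631458075352200228006457977443629830734833417266189127236406454434,
      204897611562021907653885117955463243853141242576987822896121222203732412304005434433719377040754425270955435207560162596489398956059778600920776447163791127143234386862925033735174289399660485864885931217977344466187417063218064969285853007466278042175611118382046461932680646521584615131152430785453247346333856748229903800904306888256653),
    (216, 205357056474654735340633012326910742457683935266793857912491031531605725949187696227131584543120064636181228539437810878897841856394942588029887857316721456186008827732721224242819109830408830926982379028894365680688071624294434439348244755342424289883986368210715908299753631458075352200228006457977443629830734833417266189127236406454434,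
      204897611562021907653885117955811546898020816284109767289517531526515121146950100865313297185089443018837177562672895637945295602138922697410358194263415504612269119273436305450473614854432746415279630352968025691426088188686414586603968497335579719238859367234217911593801650608490512274855462944588693971119010157146205875396092759354509),
    (215, 205357056474654735340633012326910742457683935266793857912491031531605725949187696227131584543120064636181228539437810878897841856394942588029887857316721456186008827732721224242819109830408830926982379028894365680688071624294434439348244755342424289883986368210715908299753631458075352200228006457977443629830734833417266189127236406454434,
      5498518186513473402366322167168471389263808713343663344862471656711619951359967799446503790264450899474445431979447450030984834369545692158882191260935460376334690973848240364539580893469530000470585676745337436158360361998667877064212441190931445058221709399383271601055939848854262662340308551936692284115518829710462998305697937206413),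
    (214, 205357056474654735340633012326910742457683935266793857912491031531605725949187696227131584543120064636181228539437810878897841856394942588029887857316721456186008827732721224242819109830408830926982379028894365680688071624294434439348244755342424289883986368210715908299753631458075352200228006457977443629830734833417266189127236406454434,
      204897611562021907282889476769400871953996465245204177001584251162396866229627890191902189263895436912236449624079654062671145254281135440163196408387531882975556581871943857505020153033113111044155631468907593377682053007562839480600197240863691894174198092410590028976118813643803544714442488352494248317506146318777080091503060502949005)]
    205357056474654735340633012326910742457683935266793857912491031531605725949187696227131584543120064636181228539437810878897841856394942588029887857316721456186008827732721224242819109830408830926982379028894365680688071624294434439348244755342424289883986368210715908299753631458075352200228006457977443629830734833417266189127236406454434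
    19741310570478361313579115209457438418642575242735556871982579668474386360363034070610417872737202286462011109757462753520317417934487222910681303547291281752385987544176486152027725924323419780377478258968419003520238603998249984035118321009215752608535012872213773750309759637342293222360753978851492050162742552852456351342520139230349
    90 11832504798048693748439254565241827187263679607623574202644204844038054368526608549642407613589815706806398171769141023290497110628182658612918149654261815728141552590610019588861205686563745053725512628909423334522166771842004925901164605143470476079292392904471277615577920871938615219418760481878407785474116370136696863062894661819997543033943160901421060736869395442662660866475251090786619903295626116888679923538217542324806825381492881508288277277859774418841421188130839227528619459480990804329302127955852261068036517605821881254696787502078975537148385459561166800248003599786675917337073766355746106606245887698307778607362706448657636232203360347776625137499110308490103638900398369478054238196752077302879318128737955135447057086278296832999011715647392401197338979924034320385833769734810867097959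
    71326161360786739139336347120305542229547301653149395559469840433950266611671456812219682398292855063298804912042552391377693666016047922357363762213391426826718218592206494436429570407602708985416212291883983518196358387290422888885132489319706424059771279928136933638297464456882425552207176738198971201092130697594534499237552497951918
    109 677271038103967226592718066737365646865766835568080022713437658904918582366178063156881787980388074414170522523216715067232571678251958460683062357631809315315141536275246418349135002003305356889694064997530848742593889779199309032359168878538603665705227532787303063220874919875198300511579299867291764694675142473974083683728790247438795042283087948471309068754831047826948969052413104924829651979665240817902437241658616730885722959819130384132607518232083726897182226375367753489772258524138697788205667766181604136357518334590832293874974299382778586433934362635915136015231977447109337565586340886887318926476681552245673713707689867450705178643641770287176583831292341598747774238764412378344781016778229375925587369710760041168950935350320337348699683706154683158873183252697585414690828896088550767494107321276469626343651784156002539835937810027512598640465075237920490527882607276101491790896124323450079619868160174836900920897317674051456734022404001241313544948486433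
    (by decide +kernel) (by decide +kernel) (by decide +kernel) (by decide +kernel)

theorem full_16 : Full 16 :=
  full_small (w1 := 56539106072908298546665520023771998709904576536073460677499357918769709056)
    (w2 := 1393796574908163946345982392040522593402880) [
    (256, 10029548179575040015915791026774813188686535191414585933046687500595670233155487106168172314817699015165464701614584090528327724436127666642242480867751882377036752480193205609301304269072477856858490625363564425844504602128066674849436284791140432558133891598365170050990191585755923107817532292591979195208605868750057572157173937794859107282392990231483191416186583658613720386441475,
      10008561965743126426154162575686367879096473031088313216813152897331715436145686059681983438958192159817143641152186615602458134854485876285013781868838597513099389658193884377276508768066615016808700712005662509064225074046789554062588334122945051706372358438198057756033739411275723912717198217085342905026512449411890795200143882930501717155928118713625058567223044280584276578506050),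
    (254, 9945613146215141779997034646913096497424024004135507280817163001463196379811281993564177004439249402719944176981028700265646526167666412578901167953436041440893806257015146306976189423875094465075505857002730013274172982260177801411840861060220536858853891459653224075606261004532394428155696543208076971879932137064464290794082893537202692737818299010593984388767696278962628799245350,
      4070227107118715369319626893723915117410755290040817624798750320927505955790619694801019356181516972590345674164150667431110448726928025918447235833529621217629353611480554206314161338115426371270914257668658039542856988675349432570214493677707056096163692799031041546684978834910821254096194870876440693630828393474756009377790906048007974925310371090413640803815231482163391543443750),
    (253, 9924629411951714157869882836818521853252195012239409077703540763829424820061361429637719581374527726654779120012133067208518016920736294411365846174625703697870398134651177200930208674873924933874320698562925890039660033604765764510509280001177875124819955249986834344024940957722456575353143472780831461228338721799803591079658212012775696609677014289440622043162095672680432724410575,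
      3440655427618476051775067307164121180654166070844229188001671000739217392188535120851403426361820198605916543032450936131180007628955952095810657984658373557816575872024422696035116512473216333094378962255748722153711634232376066942038608047289844966635785505927087334319017691386091308888131843006193774778935734548711367076364358797739606981577389555157092860457374288408767965965350),
    (252, 10029548179575040015915791026774813188686535191414585933046687500595670233155487106168172314817699015165464701614584090528327724436127666642242480867751882377036752480193205609301304269072477856858490625363564425844504602128066674849436284791140432558133891598365170050990191585755923107817532292591979195208605868750057572157173937794859107282392990231483191416186583658613720386441475,
      10008560104659877962789008202586755506222686926250042989539266516258424166834014446833100258003760428080053598234590218092892452002787214421406094177593891234186846406535260204805110646380447782016540496896465060732385222730282091765446107536219096256403044658457540385298174537282592243666532839147379076894578431814070047573019884894857100928623721478525533617392672813189618136880450),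
    (251, 10029548179575040015915791026774813188686535191414585933046687500595670233155487106168172314817699015165464701614584090528327724436127666642242480867751882377036752480193205609301304269072477856858490625363564425844504602128066674849436284791140432558133891598365170050990191585755923107817532292591979195208605868750057572157173937794859107282392990231483191416186583658613720386441475,
      10008558863824097126801700185081500618366890542238599685345361842056881474228021525836107878682503601643701492089128851548204422777334588030311239637122263798018617530706508522869082940943970906022221273214932001923017214807725956076708641972072666024078631439246470103693233563033715219681737539380724977407955067020564873401248164093169946506412220957255418634606697375539780178510150),
    (250, 10029548179575040015915791026774813188686535191414585933046687500595670233155487106168172314817699015165464701614584090528327724436127666642242480867751882377036752480193205609301304269072477856858490625363564425844504602128066674849436284791140432558133891598365170050990191585755923107817532292591979195208605868750057572157173937794859107282392990231483191416186583658613720386441475,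
      10008561965743126426154162575686367879096473031088313216813152897331715436145686059681983438958192159817144775656019746420451595820053974595236744480857862379859188546563916160100370550331141034733685783164885925848498225521318429511452829378699515363710133721344786827485727881457144582469013937836625582877470550133430580053266232797860579019826621635349070011551236316878214880662850),
    (249, 10029548179575040015915791026774813188686535191414585933046687500595670233155487106168172314817699015165464701614584090528327724436127666642242480867751882377036752480193205609301304269072477856858490625363564425844504602128066674849436284791140432558133891598365170050990191585755923107817532292591979195208605868750057572157173937794859107282392990231483191416186583658613720386441475,
      10008561965743126426154162374104361609077442853595095179453718931176513677969338335153864702556044650650629198551944604437745640978435348642010428050651045196861152606805673872605982116418072245226965380652178640319963634667044306159344998015696063646801611184558983323312804857195207866089226222797210722920755897295316553386542738017739559091681275761782995952826076205701290509309250),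
    (248, 10029548179575040015915791026774813188686535191414585933046687500595670233155487106168172314817699015165464701614584090528327724436127666642242480867751882377036752480193205609301304269072477856858490625363564425844504602128066674849436284791140432558133891598365170050990191585755923107817532292591979195208605868750057572157173937794859107282392990231483191416186583658613720386441475,
      10008561965743126426154162575752051165596966123584984645186477708215924768038211606080998061799105318722407449079081559017991390277965907179074723076715596828171735487760070155967722446282555473871292974379797500421133845598033172710637553889670280566645703480216763226569244945306260669867482410421243334079106565776106275463429418612908970911454539660564163184398110454192247548515650),
    (247, 10029548179575040015915791026774813188686535191414585933046687500595670233155487106168172314817699015165464701614584090528327724436127666642242480867751882377036752480193205609301304269072477856858490625363564425844504602128066674849436284791140432558133891598365170050990191585755923107817532292591979195208605868750057572157173937794859107282392990231483191416186583658613720386441475,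
      10008561965743126426154162575686367879096473031088313216813152897331715436145686059681983438958192156248304195309441828255079647987592279518916231686762779332605661520554907431262995431218077416977532480778379009461140388269019208910024541412130636341115135326079654153294088811051010580472632729409349623930748829449043492004742668560509944683625683782492316110985241796813555903075650),
    (246, 10029548179575040015915791026774813188686535191414585933046687500595670233155487106168172314817699015165464701614584090528327724436127666642242480867751882377036752480193205609301304269072477856858490625363564425844504602128066674849436284791140432558133891598365170050990191585755923107817532292591979195208605868750057572157173937794859107282392990231483191416186583658613720386441475,
      10008561965743126426154162575686367879096473031088313216813152897331715436145686059681983438958192156248306464317108089891066569918728476139362156910801309066125259297294970996910718995747129452827502623096825843029686691218076081113653060779740607298675761009910053790545027722108122385906350374038533620754763690465911064656842110939907964511955370177449271405044740562287240555107650),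
    (245, 10029548179575040015915791026774813188686535191414585933046687500595670233155487106168172314817699015165464701614584090528327724436127666642242480867751882377036752480193205609301304269072477856858490625363564425844504602128066674849436284791140432558133891598365170050990191585755923107817532292591979195208605868750057572157173937794859107282392990231483191416186583658613720386441475,
      10008567548993105229794025602616868460469207382634925064376188220524779495369042494899846004827752812042042970457503459876459109513653164864927289047402591679458029181828826805218546499892347705268940127041416694747611329637222043877038431174700994190965244529041175633335679233432712489746553303838479326654648922008939528073553609351196779907802749251972117278344747273479720518653250),
    (19, 9380916425527604656225637322046275688903075195451141297361066600402261873285786743884912533999005410935278974336158968169797624683556220369237912940212426574487874085445868891463022917333153889243414975943277170686374263722332656257728958265191901393416770637676224692329203793789934951842258937710524244833532433186647755869997284791055160179504828967158706160321476162384107248139725,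
      10050469680726352009274295255305621694216408837417678175093662404397324294786882077028202219681016262997030480757362390555430542989633023747693304300008212693010069418474143688360504123154737265381175823626553852321436212328215649111455854577257974784641452430737324596561370946346866891214004274174488318397678424026370898581442732594860814218651139812371922594497952854902038855794125)]
    10029548179575040015915791026774813188686535191414585933046687500595670233155487106168172314817699015165464701614584090528327724436127666642242480867751882377036752480193205609301304269072477856858490625363564425844504602128066674849436284791140432558133891598365170050990191585755923107817532292591979195208605868750057572157173937794859107282392990231483191416186583658613720386441475
    10008560104660039734552448336331693489399319219443450588637664598085056400603460962427167316895556411117474207228088340517254728109703933461684981705591039627552782234923916945189904268821634102193883699416487789498490013742265880391693872938223800063966946701580677666690777388969620471881710945575589058121551155261822855553925743596004704314073896798621592149457903547063545820976450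
    104 11266403846042937653786799332596289352430954021166896991510825542420692845611723882595485061462804552562916571155592635554955234409605477911857736150485628162266937580380140297140635604079565909563962017897792001145407141574869062087669588643656837540071447429528049311240442569774191086809740849913281255502290671892312734905652414032131041041541705606231605946425042556433769745631614265419827169281642612001781257018270091235806159757934671078974470258760378710381728587166011969497724505567045845076879563052888389449010439048209829006705890129392271671539647062375973768161113087947839150984938322400717318418791751585681414831551062438067243193437975424185381108995187704296109211751615220526583695021280563482435171740526387108672954471327121066520462942654701844641661956687556853197151310663841875732469738182109414530742385385598705838621592124365428129843024215286777734488850121835633972121006309880987084680507066048036585865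
    9981687861590940931628800285317740858327807857524692071493588172859588712139248884554020524739788892879254418248713660157285831803480033079018312733313439639266936383827713226141863603998178442827068310843827777380723293377533001786304728634136076148377988649048720053749846012929579630805482160443993968321421960692310642115273546632042470158289751856027478023724736408085565032310825
    121 42829748616421081437753592646987223769058380446616598045921092382578931499581733783611825313865567537136246359854104714783122963046578008778706578045746525004737553252805249412542051739216080035112224884680645731201721874406930287116936597386261383728228674723440075758469118309682765287843800923958424902266252129303154985196472889557614887969140796051290552438420877206172814199986805134228926579674453999957082666310551635416880052457205311104387382856772381584394203940000883315279473016546666241324540799521673523700737359602608825118523002312423070087409069528226149324908757419032115665305851050853166790282021838371789871872525754890538665324787329544104900398195711160078155846762441174346743316924128238316833649138651503847973475671922830205421025420070882377158956921151954036053894530563602504748885464874395508830139291022227498751105994660112076294368066937064029961778607818959413645353609505298424862010108341032209740922385667488963323005047249441902054081742510937131184050063656258439238474482507680387048067439450185950243758921406589078323344567016869220865128534118723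
    (by decide +kernel) (by decide +kernel) (by decide +kernel) (by decide +kernel)

theorem full_17 : Full 17 :=
  full_small (w1 := 485667223056432267729865476705879726295226300430309150762031894255655316387318988800)
    (w2 := 365375409332725729550921208179070754913982742528) [
    (289, 492615271455799977841783030315133982537222724087954769047577295733433430268263271823991624307017469191420926163627243746117309900515614329150430413039069750187866989455571907086856615523765932512830931121177938361769724822810377189533150720771684540076195975693731235530652554349879958088311500885424695464726654978025912553331911301776807559535409725903901561355650513369563028421467637632397205034111087229278463436385034747862267370,
      497522120605139489789779939677942759019703545161422340595077855882017551984273853531407030647673804831512178913496722504477281549889996601558803110705852712684884961575890811653257958368194399366039824358753242770009317581490445552621188544373067261116516783803748633807754143498198839464969720248920424521888252301131442733321189114998003266141253492543425015712132712200528458495887832586615257364029507574802665537667065280325779490),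
    (287, 471607868535571516423608142876265093341128227758263392655210921303574188051025973018467883283009249896954272032000499931085992957356314619019500793374510749741174736982184898169236952336835238124186280451495128739441426115396326708262286064965143282260767815037528455452475209627107682493410567834797791574886986819501300302252600888830808147165373415781132488753952166595803504241484605287165497270477447185666871682387155768854093325,
      471822528830867484081348285062359528983513628291350066109935426693282094131996391863237935391828555044235254014808106224201461354806585644912769268821436559957535485770046724433385209302383425230256062989115011124499666232637890746324997527299796246595288696988871481667326683623031916119130920796915651353232803665222724973033502610196341076516822080366047907740364808801984686651920928900415308028689796319009727374841816414244245677),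
    (286, 489671173792416053099898534546355759498512136595022070647925898194904576551678606776061876061789895969570635399852061129195219218495885654593367414317019619404661231485842792932382458957479906838408359597187649096663860257486413867489678441967884175087126536326702401263743876480750287967342461076551286484572401012186112667730392581591819175631686432069752434440420328115191883754308381169378508017497665982518388299977853865576169860,
      406254861200409949672466636573390377155568014135442201409910454113397473503816995525486183516812594292060157966714189812284824833348870456706261352211478133082536445376061216525017842398670366286883420302674226820406517335760171894898006478638177579615729753340313741867145364975557245259083508323165206658137299030479587992717038243558356482697479500250022440943151878555835283977366767287524524456898888073363794185156898200126460170),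
    (285, 492615271455799977841783030315133982537222724087954769047577295733433430268263271823991624307017469191420926163627243746117309900515614329150430413039069750187866989455571907086856615523765932512830931121177938361769724822810377189533150720771684540076195975693731235530652554349879958088311500885424695464726654978025912553331911301776807559535409725903901561355650513369563028421467637632397205034111087229278463436385034747862267370,
      497522120605139489789779939677942759011129194883643148898828047902543045082539170588129743710169830710323294095231126592426851799741731454862429650795693492651001407712668586659778315701754212141116491908705727171497866098368778665263586667637451781447899691103229860278209414790913662565533330320978092087197528116462373878931680468647334692697529710432404217468888199328508261043787905170465703769500083554461817072878867935139233826),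
    (284, 492615271455799977841783030315133982537222724087954769047577295733433430268263271823991624307017469191420926163627243746117309900515614329150430413039069750187866989455571907086856615523765932512830931121177938361769724822810377189533150720771684540076195975693731235530652554349879958088311500885424695464726654978025912553331911301776807559535409725903901561355650513369563028421467637632397205034111087229278463436385034747862267370,
      497522120606052567769964666433797529033715867348685000819902861270644940359360632877546133162116143338997634666166923886861697666250661956651690768093775697524297217490733970362104749032309534035030546001445844929271440049140284081744151647865429846061470489873705125936927587212772386726334541784585028931861398490939023628712503069448759207156558908036637610952196124325792199735744882357195130482027116644312923852157345644653346850),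
    (283, 492615271455799977841783030315133982537222724087954769047577295733433430268263271823991624307017469191420926163627243746117309900515614329150430413039069750187866989455571907086856615523765932512830931121177938361769724822810377189533150720771684540076195975693731235530652554349879958088311500885424695464726654978025912553331911301776807559535409725903901561355650513369563028421467637632397205034111087229278463436385034747862267370,
      497522120605139499922471583543347816780324003184110692123211134496141334642607051807053655798021362543235424611118712820834195023602117693909233982351672917172466016891100624432292867379563544291466016797807164884068151544178319230315345390302568463583197552726326966696716458300488362131287178599215219184933630059815620310877734411029470316622706586248589255063989793453755010541427608482495373277536551177674331808536514344313454626),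
    (282, 492615271455799977841783030315133982537222724087954769047577295733433430268263271823991624307017469191420926163627243746117309900515614329150430413039069750187866989455571907086856615523765932512830931121177938361769724822810377189533150720771684540076195975693731235530652554349879958088311500885424695464726654978025912553331911301776807559535409725903901561355650513369563028421467637632397205034111087229278463436385034747862267370,
      497522120605139489789779939677942759219252060717010806971616978779148051280011708846344559819365087334469182357972216604662215533558468338321831741658369397642025769727513118244859166053506915435400756332289305459030716520721165287370485458938862011472371614877762474670683004962661707970229279415152222303530217325149530429282237125446220581102725717975705529359163465272205190960691190405660490486042953939935731130040715917940523042),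
    (281, 492615271455799977841783030315133982537222724087954769047577295733433430268263271823991624307017469191420926163627243746117309900515614329150430413039069750187866989455571907086856615523765932512830931121177938361769724822810377189533150720771684540076195975693731235530652554349879958088311500885424695464726654978025912553331911301776807559535409725903901561355650513369563028421467637632397205034111087229278463436385034747862267370,
      497522120605139489789779939677942759011129194883643148898828047902543045082539170588129743710169830710201047227616793048870293845235123302827694687955835873423138865895735483520773921939959391773719860363010767319101269658127295571605094141075547460455211312916318810062500125050990335806941587737495295942551724020641745906746532586739864047133992025223608393069108779670748307143172768804656748792081592684262580121933528245107720226),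
    (280, 492615271455799977841783030315133982537222724087954769047577295733433430268263271823991624307017469191420926163627243746117309900515614329150430413039069750187866989455571907086856615523765932512830931121177938361769724822810377189533150720771684540076195975693731235530652554349879958088311500885424695464726654978025912553331911301776807559535409725903901561355650513369563028421467637632397205034111087229278463436385034747862267370,
      497522120605139489789779939677942758944613023031780328467314386001165052147870115028160487467714758739888308838382830334954960258586131705806308226129573007841031387528275333085284391995505439695457426161542745153422409337508564690126171328746657899332462098368325651653184091144855103548876480731415616990986058809477721903937123547926196649694017580214988303313935867795449726095733767520472001327734885872692774249156868748659163170),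
    (279, 492615271455799977841783030315133982537222724087954769047577295733433430268263271823991624307017469191420926163627243746117309900515614329150430413039069750187866989455571907086856615523765932512830931121177938361769724822810377189533150720771684540076195975693731235530652554349879958088311500885424695464726654978025912553331911301776807559535409725903901561355650513369563028421467637632397205034111087229278463436385034747862267370,
      497522120520140233076082321378518891290624056483571847947916760108086868115429022268931849047817683352753104690127872583033211065228147290597081734511837555147522706064355318030799252527403375488004019441402313112858490226351626681919162117940380923461566846946879336432264887749492118084471324090220075756736245631750264732496833704554307055869109878563951275250615434372133940111906528754117846043956192449386051692595806237782999074),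
    (278, 492615271455799977841783030315133982537222724087954769047577295733433430268263271823991624307017469191420926163627243746117309900515614329150430413039069750187866989455571907086856615523765932512830931121177938361769724822810377189533150720771684540076195975693731235530652554349879958088311500885424695464726654978025912553331911301776807559535409725903901561355650513369563028421467637632397205034111087229278463436385034747862267370,
      497522120520140233920474071810549432960151331670852339932258858012664797089633449376151485776672357569332503407017247375722694873771373488584708581147044453869972579131502482970646089644035518940547535474883389349622764026651128030323627855169911869138055091232833423332183232572484849223896063946589990948796735170423108713456763322265021323086823863825746766450347540081819940073147759558250043870934858361120717145740967284896464930)]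
    492615271455799977841783030315133982537222724087954769047577295733433430268263271823991624307017469191420926163627243746117309900515614329150430413039069750187866989455571907086856615523765932512830931121177938361769724822810377189533150720771684540076195975693731235530652554349879958088311500885424695464726654978025912553331911301776807559535409725903901561355650513369563028421467637632397205034111087229278463436385034747862267370
    497522120520140233076082321378518891192640667838453277612457671555777863932328397424447752489101343841408130270892365328943774599585410512188853210497604461832869626255713577069709536597936346706720321124942352459888419675769864011724611749326409200568002822711838943475254495715494278565091805798239322075472836931722970064564599403689206888207180190499647350982535519913056832929885578595845256566839040468577841856125899653046894626
    119 1578584528777352705897836155061696611514935998357982627187046074097640719059914349836493655766787047897479871330427223785057424907468896883102055832442468765885530011142241134935457572758011078267881779260686002538365664403265442644538502668136455260882382701922277006481800176240998759590630430521489589888620893835530238348056457814100759977886782813745573417409981793575280124220571302304303293280043113864947786883329659976681348746969225512085924746544036603640913927811975962155454758680376914012607228858136524256229759283998695533554372254983192038232732151787928408868371305092481743439169790164199370615675488407535440329323621409409635839047998241579877759540310183079654851925260530167085737221226253879780254417689588841309880504077075763491968496164163187845035482736498274727449979242893275828238746425299494787137827939792533625919505382545170584979232349889430457308759647945569974006893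38000762543353388025724856895130675701324230231317253124765630604344225651038914031175768668303902297567244196538404532868639070129698112800452464339086051890613865941378
    39941619062017008820381802644318360652569575708353621649081184476044485911820493545178427935158997936995541089928820244663642264853889898547708397614110092380356006144984080977561175513850634681376664135237262800689321649291984322591994723759866201642970959096755241133301072852820113135737108924734017507512117941235963462531790147542201791619453549147717048566346106275520671107615707640557423270230938611984111829958672467576825094
    142 3896126182260085661919389442608131053523796655680732856059426640716629864056590355589119041322567894864621178047100853118183757714252262028534275708245638010929388012394914114306210104700505985909654765461797279706046878186120730680168644977523828011201466896986357765094083542861613269499121295009675661473889003611733843555620522758842352633440278763289359528409783715147429866046124388416170567402307381698611921614517495103779339097734077135977502531318768406603059767859330906409242760607167224988198373628227523624280090292992405416176366204270642663331672960238984848194895852835271637454569524990753017934513573790612294123249241294763806011614754523786313823315235136924337673594560803813997969002553489276801192762770306956631539155171822384285123220982585323871556351590562488443254244893090137769197372159405565673229169620765458970132918411211236793316257047921903451498247269505356799390152559099610071659347892846142952682233194360940659801782003636709874960349458266074243698093313541734305973271203371959177800665964605301251179008582376329325707690701717694823083943465131854894662559327293732207714866842237444692543930021171349770399435309783384303689802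11778455193469708135133549474210077845790341239318804232975031359094533756741259589312483746394710951854464
    (by decide +kernel) (by decide +kernel) (by decide +kernel) (by decide +kernel)

theorem full_18 : Full 18 :=
  full_small (w1 := 16687398718132110018711107079449625895333245957026133292996672974354304030365349612273845403648)
    (w2 := 383123885216472214589586756787577295904684780545114112) [
    (324, 23923605309158396052693522207310801371002905343324475785802391320849933379496628205065607896575989033838797122385072231181141168977467058413642114866470515424849703309895356652391080140150977719271259519654466216043154467448326751991107256511379121606527635229820693682776028563561964726114826379243366243518378897350562105904831519534360623371138078733874170745611716235704935694071902495797083907702943582682548311837363714955345612118440163239581613366647523210044730072602602593521893,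
      23910799905037912326082601808220666002305046709541749555160643816694352456995686890456552567559122298300961933312978946027399699203158856768722248377776074724395292477208696331897847262631003648187795073455423290428421570317892037167507015454079974846363957641049308062261957072498774369853820232461844644415348254490082712252574811345041963855288568210322401955157901293252036771402075310491143488800879538466837463826116769278372434611662297595128836761203703102354445476937079956444258),
    (322, 25518493936173760895384227743493601333832970974402898996883431496654607164999913141039453295128450742395178633481132298719932872660267498536736163774701489019436420404031522299696393311970134030707724802880401763993788423986379856700962180591073733708244944708224439270472341705059909630323404328794065641115987619093006160670060724647670104215196519515072092401801852433097420537829732434343308858170730308197917955287295253123292648578477480526757315090721165892225820646196683338088587,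
      25427539599243536624207534765246120177501056397710455832779171500464212951481817654513266698597883309604652024791981678893997857932651174283698629256027015351469666795398118828976683507680133226728274698889458307834330106797947789160728814673099969928281589734238179633643580612191743172839677662592336688124478936898485465275645571928250640715045003872915000653289481885131077121412583823003198323455197013262702901140580765505442468231807676455614710751128533016636080674496617363255855),
    (321, 24018561477871899445610042604190870003175894904617678584703439727845869731299316754356384068169818846733901325214595547962813363168412435781365079698048476118554475624541461621321228237741287728616140429126853144153135173516345616279162629117961491242277536622931695844473677690667023739967761930780748280530497520757651150064129488468508744036125321823787211347159105072795861061866884165740618272809491359301024358496598393154079286168294586328580272271676396602660231564063768539529345,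
      22651390632786760701911506000987733650735079906147494858249174333487371243007289833956720244920332073801786368625090805028142041728284061669116466077417396032201141785223886006613460019927206207529932333486620936719440342502222720344295692659794699234456305475349914230030478490353910234268781239779947963481969618239987469951162376668323080690561618641205205539987032358463592324480622633936173225261840111404152090872193623509972805345353274019673096621284602021687449422324689501718624),
    (320, 23923605309158396052693522207310801371002905343324475785802391320849933379496628205065607896575989033838797122385072231181141168977467058413642114866470515424849703309895356652391080140150977719271259519654466216043154467448326751991107256511379121606527635229820693682776028563561964726114826379243366243518378897350562105904831519534360623371138078733874170745611716235704935694071902495797083907702943582682548311837363714955345612118440163239581613366647523210044730072602602593521893,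
      23910799905037912326082601808220666002305046709541749555160643816694352456995686890456552567559122298300961933312978946027399632481550963273938603366687502520432793605000307718224400546338340095317616511691148125175839780638970552480195766602927294079770705726487836219773661498719063814296405820212803483803379044262250380813328750154967398054605307351005621257642206530658714046719649947649848318622187031304811161580567182081374687722607937594157158204268615565216143381991960794895458),
    (319, 24907535189242655563469885282559563074470689494444161334830849026401504827920470071061447420790746615846085550901808604185289445123296984121842859293113585180887608867383181706763696179819021634326834219080727552829754860797428666234179300248255888467731892723783670178953042789533117015720988830241088274118116372260708965420992312279605761760485922796149613971652574091545811297162321458974316195250099946601426844338147398185171895153615444519483258797541614799909621256830652243251621,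
      25283520095569846893552742260887126790935288660522570737152644894782168391036841556279140986451383340485736161711870044366673944416161592004051255032154316920175482593865663257209365318662946214107761881923041850474878088309306559566190825843434342950076487131148744764205407722336184654012533505080161839622039659194434853420541067911957214198499972491064064533665626118460005417045427891925362920001278003954991245061316020249172342064227353859135790461985240071623219925351320077314308),
    (318, 23923605309158396052693522207310801371002905343324475785802391320849933379496628205065607896575989033838797122385072231181141168977467058413642114866470515424849703309895356652391080140150977719271259519654466216043154467448326751991107256511379121606527635229820693682776028563561964726114826379243366243518378897350562105904831519534360623371138078733874170745611716235704935694071902495797083907702943582682548311837363714955345612118440163239581613366647523210044730072602602593521893,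
      23910799905037912326082601808220666002305046709541749555160643816694352456995686890456552567559122298300883162341779093397629202195870229228114122622140317986994099151176452286132146110489126369074036909706256750656166267152268186622359334129257289903800003346908811779623467577316217935210440083099232206954451646099854323387068633526823311890317719750746828400043679519534304701331701671275314614624609282009711115253185030550808003910342445885640639432712995769218076413334593721603170),
    (317, 23923605309158396052693522207310801371002905343324475785802391320849933379496628205065607896575989033838797122385072231181141168977467058413642114866470515424849703309895356652391080140150977719271259519654466216043154467448326751991107256511379121606527635229820693682776028563561964726114826379243366243518378897350562105904831519534360623371138078733874170745611716235704935694071902495797083907702943582682548311837363714955345612118440163239581613366647523210044730072602602593521893,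
      23912222658944850744598289397035592572106351835378916762759256489463994084860088380506762347217983130777429474562028974118373437093776422541663466636064711257687859725337486580695405951644607354243416895705439023934673942850665698071636391873556696923941932463397398843985099095502624954490795381961867720741947803106776483284562285873051007254561907140586940940209000792375621303756776434708884309510176576150328287048880004067294785076128294700804107161774011396256723125382422927512674),
    (316, 23923605309158396052693522207310801371002905343324475785802391320849933379496628205065607896575989033838797122385072231181141168977467058413642114866470515424849703309895356652391080140150977719271259519654466216043154467448326751991107256511379121606527635229820693682776028563561964726114826379243366243518378897350562105904831519534360623371138078733874170745611716235704935694071902495797083907702943582682548311837363714955345612118440163239581613366647523210044730072602602593521893,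
      23910799905037912326082601808220666002300898933794742356059476308657667632632744215849122087771118949993202956503127577481516800205040248101033053949607571183177321568122544052743537378120538355731370326461048878594846678004407749107455499071470933509779226679385059289416797529538880929161753217655368435551547754776376248953741515746196736384468200301631607761052702041854871540084657101579685875970166382833221311590921611310501589063014013215788656142761774128404904166588984581428322),
    (315, 23923605309158396052693522207310801371002905343324475785802391320849933379496628205065607896575989033838797122385072231181141168977467058413642114866470515424849703309895356652391080140150977719271259519654466216043154467448326751991107256511379121606527635229820693682776028563561964726114826379243366243518378897350562105904831519534360623371138078733874170745611716235704935694071902495797083907702943582682548311837363714955345612118440163239581613366647523210044730072602602593521893,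
      23912222532754520777259844888320879800705875892786547941684851166916361148952574005199528454783959897698578095829763132119194929515295606955506877289059042821738804280277337285585066286968198744063009860782416970114432256413522241971667535344773083550050622588479945290491412195149972457443559920537105262384482710262146777097595754995150295506810847614536413089122794266832778958547569375580015394836250495028262047167066329928067207003734496713706465219429809752517734444324671425352802),
    (314, 23923605309158396052693522207310801371002905343324475785802391320849933379496628205065607896575989033838797122385072231181141168977467058413642114866470515424849703309895356652391080140150977719271259519654466216043154467448326751991107256511379121606527635229820693682776028563561964726114826379243366243518378897350562105904831519534360623371138078733874170745611716235704935694071902495797083907702943582682548311837363714955345612118440163239581613366647523210044730072602602593521893,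
      23912222532754520777259844884790148706586480743082132201538482921802236596724409405052353118516442764613622793665578740651363384947702395773938659397308981487169428396109214261626574366918100809149909241218955265854117104244533859225361298733221333858371986935517036396197662346019712975982464142063691488619835882859974857073702597484884317479684235042461945149357026478837747619961348757340481923247520858107057004696219050945182198888226593279808341494193339491296009512953603058832482),
    (313, 23923605309158396052693522207310801371002905343324475785802391320849933379496628205065607896575989033838797122385072231181141168977467058413642114866470515424849703309895356652391080140150977719271259519654466216043154467448326751991107256511379121606527635229820693682776028563561964726114826379243366243518378897350562105904831519534360623371138078733874170745611716235704935694071902495797083907702943582682548311837363714955345612118440163239581613366647523210044730072602602593521893,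
      23910799736784139036298009129934382307109942487081267392529660967213224895402907231459879847115274720087355267726725421476652822098993003076931487862491707150969810285536512147815579332145233061630503460279868936006478964729257801455871748333792489254060447859579968296255269793164428547763258732626135176542866031308857030174868669243649967145103558366471411651327386930837230646698355095918564682129021257977314510958198960210226887284519346535306418723577988729423480335024961015518306)]
    23923605309158396052693522207310801371002905343324475785802391320849933379496628205065607896575989033838797122385072231181141168977467058413642114866470515424849703309895356652391080140150977719271259519654466216043154467448326751991107256511379121606527635229820693682776028563561964726114826379243366243518378897350562105904831519534360623371138078733874170745611716235704935694071902495797083907702943582682548311837363714955345612118440163239581613366647523210044730072602602593521893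
    23906531475063323780750946363489602597706027109569765769733822951477519774166207934933001131518056446732346834529680425285007738154672609579849259250150334500237989944683539101835765181348719863020301560829436808176414197226495682516283665171475496055337285011055081929468519260561660934756776214187510522188371338284855963272328547654384289374399477665126688084766754163204280880126517183612197647691735580883444947303143302823336688667611907527501437246939856764502147238238522189550690
    134 168736370040871213387149713819699087862878317357356657865643020014575718277793958615977807461708827075754446567627144894006426720004562241247414318811369489846974224743027476447457141512238613316707169045404829828693176181350024100815395655863087160927245011924032648200506737402078403051260631874748148537324872890542371644446695571100416860388398157626662355093698574729085568945096095848081713846680983209411405431155417232906443855987612041814416148418600606209347082662129510918818024139384926001162234367946881631984480512034089052694993015991226294678848656322353746479807620068830343358384106234894031881279136567827176932447116644684546292066311945579476310886292588455649212004654350038714984958137538475445338278554464296084980694654338206868244639872925424945738361982315186988709292596051422674544558873759326668857671803904320558694135686764187866244161491246005448781103009983931413965619106738739068302904536412882756235495399960857061241318198733080016048607683531937586973284159612166076865099074973856387704414582529281266123342375467679870132555522770373060090008546234352266893260237678372829497516687152471754091616199023718738521784555166150614708009939413371598750904909734577103241572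
    3576161014663488708957597928709938519458080095475182503762609446881529352244061114104704653321100265553345517830735957157378452486685228514851895841801470504255607967794457078184933630983485777887486324913557389892679959159158189282207316309450050457641201619342224227995104673490157506224159441628338023118004050197566303466108730029975630681135426752499358214415496422983581033798725435712118788492681223139269052594790718042534664859506671842169454765288017684170577332835168984177709
    161 5943429330650034809320390749655509074092061604827049015596242447299356647644318493166733333283722562528524011251684848237191162307486197683427124016063846066598064309561975762996292684206820912603541790790010570836838000390295939096534591347932548175931481385229269565132381053518231547603318586299406058000569124454989214231050410147052348443208506093053332555455626489970335932286291648037641966471329949639849870607631038671644835185342501037011492990513912955032042165333424894594955038897457587095578782759232999894616798686139486783861786713550082063081734963447627672698449969615218266611716374288282419072505842487093964560883815161672632212942076763922765622813983484066395254897435255722612650606814467776541931811376577551647386408350750934735424382540587301590318106635528516038421238960644294227042490822096655796283796510946695825612111191507691055889282709293310549063918929502891146664210308245974922871148110813619661682210433589191228099607658685594643307891488803146796872865910813179865474591807233236700974284915450995794691755974369804035618193831304311362126888319220202669744060236975290224554337634675453048072345582099783764256125134618953736493059905785902149431694020153008139615767729300179959777047778050976863406827034288425469551461048143534289269017727328526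182096357518353721122362968670007456561926406648809591745480616767441254835008331334413032737794234161612315486453788837373428386682436149990118197355618049999108
    (by decide +kernel) (by decide +kernel) (by decide +kernel) (by decide +kernel)

theorem full_19 : Full 19 :=
  full_small (w1 := 2293498615990071511610820895302086940796564988766546612672841270501432353003194157439467804664427477729280)
    (w2 := 401734511064747568885490523085290650630550748445698207252480) [
    (361, 1286644147368217064391026654591952402512742726098353220230140129021322461926159493911741842062875562779056994678970518838419349950329583136130108794462146675199298835276775068663754582415204057983606227656956131301657607791262105761354127062300254847021165131074158755686444559054717412053828208599431232345937522382389872426787510121759388631951543624701901849343939963601635683608762619637229174090357048638670254797129660835467366941779462187211349178828392649214515312193883369298065836603929382534206044971575263471562540374433600490283312,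
      1309064037147770531153154474761115669538528664726058908964964866081500950313184330362845025452376198842990603969800223608863325435315134682874766926005384128761728811901657100823544758586278327806861060462591269819830883955263168925644750673732423579032695739873301868587305918409997147680055644690192642120119782259715787109342633261806895213246359590286962266860439287365000032058926834968740985969756224323860497971205218370957061955351889231125490729303269736999826880176230378969746679012844229147305878242186928942221361214595140672374016),
    (359, 1255673593045641626528540888944336230095179488965284124321959084442246283882426299791153788258109176236832785463298299889263026045778715649978206216019196111374546444935468527517863063573851294713434720799687870082345690016046201778215505626428639448296555477361236733421048333992582226958816642208043504758837076430837700136962724612570242330750729025985519495350922442820878435156001331325031537909593796063012607964964736859365588257193650612364893326688066845189533410262154163683225168218924213613492452581322676859459064074312784321553985,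
      1254953384962528935994777575682182372802235063989208359730930945975569878891044452180537267603652789832953114631848079565851384973700431001910486104755322233766902805123484708395145515388065904126587160767033760495980574169355639177701799654559709803868708583559500262765563030009201642125154994313442095560344240997269408528474445589008986186277400955267744471561485254866960559022125009090885533319780719983692076142443827660753892088383254817635662680049746052859774638477946396458668309589546437904097884611270149837649996662484074854857802),
    (358, 1251635083966928798659924259326620906926430277005430794894055683327129234438115585110727387233470102343590631571072624443142049303689695816053597096929927450514886729066216861780081926755985213938159582320254169081221204973337479328241848190800211775323061658913590696901012031205175577987763217331078691840257865252136656089944456465923712051749367607638917886933436613867889681315822278686498700004433004171667514842896000139812828426158904626465230723923336327628783363872433530270669039354025206066264827786716110852547159346248398119931399,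
      1182216846467239037130252770108012452362986268672652495618404995398564381569301884267742000377102356849274656709600985225321725459114785307770215518374114013078802885719215593890923273029533933120669722291976651613848959851118787401812315944290176483211702675898985229698414200139638452055265857895870939143749110415227307111399042729503989458758959589744887532386468492803358038640337873550923832547604946232241777741047375335821771625079835624157890020614650833726408834520951147060254343885323233099173194357634745174476673359135511535681711),
    (357, 1286644147368217064391026654591952402512742726098353220230140129021322461926159493911741842062875562779056994678970518838419349950329583136130108794462146675199298835276775068663754582415204057983606227656956131301657607791262105761354127062300254847021165131074158755686444559054717412053828208599431232345937522382389872426787510121759388631951543624701901849343939963601635683608762619637229174090357048638670254797129660835467366941779462187211349178828392649214515312193883369298065836603929382534206044971575263471562540374433600490283312,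
      1309064037147770531153154474761115669538528664726058908964964866081500950313184330362845025452376198842990601049250699668231211537150891288597792123635587713881793227828601366994876244006093769233011051950115848798115415901965810768539700527979933591219906385002846220007463397712933612758327101412041700612941733095747848486525615163769465102284250964905129016187158397364341478073566914703049315213754702475977553222435587444528047110652739029692852856491802760471991414333884123249589602921896332728448689963963935641803108979001574546294016),
    (356, 1286644147368217064391026654591952402512742726098353220230140129021322461926159493911741842062875562779056994678970518838419349950329583136130108794462146675199298835276775068663754582415204057983606227656956131301657607791262105761354127062300254847021165131074158755686444559054717412053828208599431232345937522382389872426787510121759388631951543624701901849343939963601635683608762619637229174090357048638670254797129660835467366941779462187211349178828392649214515312193883369298065836603929382534206044971575263471562540374433600490283312,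
      1308784942635015818313287490931522182090343303992259247331091664099039515254035478226243782219073543118577820169472305726938964724459974634425388070406265382295592151916966151751774585670148338530579252189994335016461538758050314892215866796741045136463457322598894907085082774686637386543913743226015522904256888743169010572024131613891717633465619791768640166154595597805778581231204253653505618790654299555305544542679187442808315007834036038734706133246452295256007361376272900029924803139621696535975977188718663151976528360037052113306880),
    (355, 1286644147368217064391026654591952402512742726098353220230140129021322461926159493911741842062875562779056994678970518838419349950329583136130108794462146675199298835276775068663754582415204057983606227656956131301657607791262105761354127062300254847021165131074158755686444559054717412053828208599431232345937522382389872426787510121759388631951543624701901849343939963601635683608762619637229174090357048638670254797129660835467366941779462187211349178828392649214515312193883369298065836603929382534206044971575263471562540374433600490283312,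
      1309064037147770531153154474761566571996569010166619674542045889108519512612721032897328458753546669444747380680328459543714983022088264104748937486010434982918341870768335593930158873111364180489514116139554483256336846343305118462570011215102937511852603187579387545236588274546316562324080986517421137377707335820079105110000915336449217116104756516335665068427542265499691650309791798160957197210452703122865376845600194413293321818332262898025863940021295302779987015086346930021938649280372783411032116527062069014885295032694491686454528),
    (354, 1286644147368217064391026654591952402512742726098353220230140129021322461926159493911741842062875562779056994678970518838419349950329583136130108794462146675199298835276775068663754582415204057983606227656956131301657607791262105761354127062300254847021165131074158755686444559054717412053828208599431232345937522382389872426787510121759388631951543624701901849343939963601635683608762619637229174090357048638670254797129660835467366941779462187211349178828392649214515312193883369298065836603929382534206044971575263471562540374433600490283312,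
      1309064037147770531153154474761115669538528664726058908964964866081499790861531998676594742246695061407503208779424700109364686154552841808304878509302337492648909209181894521688826306567252149720334902727838042255091092549360012177340859484624202441042505673154084834991719919843526469216765595798358374618419729094069455727839143355200267526079579570518999660522988050552747977706022451338560105472920822553917865355865324382557610893764956770806649806252473415295229945937737703464522049079667798681619130031673211463848268173571502115996928),
    (353, 1286644147368217064391026654591952402512742726098353220230140129021322461926159493911741842062875562779056994678970518838419349950329583136130108794462146675199298835276775068663754582415204057983606227656956131301657607791262105761354127062300254847021165131074158755686444559054717412053828208599431232345937522382389872426787510121759388631951543624701901849343939963601635683608762619637229174090357048638670254797129660835467366941779462187211349178828392649214515312193883369298065836603929382534206044971575263471562540374433600490283312,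
      1309064037147770531176393810492747220527543065377485641484176659618885270360624229750738902517662721063502741775344745051329444192739891632925067140951908866262216875860428930104893324638788171895027840063588530348659827662914302006577267301989744427616270878478554323238610921711673838794050419197233829730079471844311719826220576825092149207248071166680030284648939672552424813280800058108580009208279435260244826907426665457598761229983717692785059780136513369145050270467215884967204121438477119145192061450109542511973837043779978812015872),
    (352, 1286644147368217064391026654591952402512742726098353220230140129021322461926159493911741842062875562779056994678970518838419349950329583136130108794462146675199298835276775068663754582415204057983606227656956131301657607791262105761354127062300254847021165131074158755686444559054717412053828208599431232345937522382389872426787510121759388631951543624701901849343939963601635683608762619637229174090357048638670254797129660835467366941779462187211349178828392649214515312193883369298065836603929382534206044971575263471562540374433600490283312,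
      1309064037147770531153154474760890218289351580775171810119502916636175520217532743024810859330416993742071924442436195373682553822802530921558261285429928356316506911408356090769391316231744405537531437926377623444016539616415934118545945504384546700862732765577951520961702014876374153702172802828597494669555855271893448844705492991588278441395003830417027456202102541389985381305881607787286406714240294010767554324096138405962361436499182912864617743284759604112513063373450740220166885924568081248882692965194026975744787715898042590774528),
    (351, 1286644147368217064391026654591952402512742726098353220230140129021322461926159493911741842062875562779056994678970518838419349950329583136130108794462146675199298835276775068663754582415204057983606227656956131301657607791262105761354127062300254847021165131074158755686444559054717412053828208599431232345937522382389872426787510121759388631951543624701901849343939963601635683608762619637229174090357048638670254797129660835467366941779462187211349178828392649214515312193883369298065836603929382534206044971575263471562540374433600490283312,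
      1309064037147770531153154474761566571996569010166619674542045889108519512612721032897328458753546669444747377759778935603082869123924020710471962683640638568038406286695279860101490358531179621915664107627079062234621378290007760305464961069350447524039813832708931896656745753849253027402352443239270195870529286656111166487183897238411787005142647890953831817754261375499033096324431877895265526454451181274982432096830563486864306973633112696593226067209828326252151549244000674301781573189424886992174928248839075714467042797100925560374528),
    (350, 1286644147368217064391026654591952402512742726098353220230140129021322461926159493911741842062875562779056994678970518838419349950329583136130108794462146675199298835276775068663754582415204057983606227656956131301657607791262105761354127062300254847021165131074158755686444559054717412053828208599431232345937522382389872426787510121759388631951543624701901849343939963601635683608762619637229174090357048638670254797129660835467366941779462187211349178828392649214515312193883369298065836603929382534206044971575263471562540374433600490283312,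
      1309064037147770531153154474760890218302789521595576287490783875257386286181454900405339158977999640275432119530570852962347156984799962974734012477188564694363089487269606217062696317742281172296784014960237233733381621025366798472814753885423727092221382186772455237262708427652079634515698976032622798380091313292690636323190917892459775893054647084581165777632806722344135793009796076658112921846521529175538004741869397265131880742800618963386958142226439741977793277616667283056297948245128154204765452253764958171543752715853212565980416)]
    1286644147368217064391026654591952402512742726098353220230140129021322461926159493911741842062875562779056994678970518838419349950329583136130108794462146675199298835276775068663754582415204057983606227656956131301657607791262105761354127062300254847021165131074158755686444559054717412053828208599431232345937522382389872426787510121759388631951543624701901849343939963601635683608762619637229174090357048638670254797129660835467366941779462187211349178828392649214515312193883369298065836603929382534206044971575263471562540374433600490283312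
    1309064037147770277325375603981888971286190828245894313723340967012003501145480669743205600567060592372115350814224305338041082266646787971457344642200733759512870575240571629720283316420791781741470745096432329640270688946467743725332272214969093031105076734310622062123470228265271448607850797453667181520424369139495580892968409461338533795189700669500692002079890830608954950768813095850498203016586228125468422136611823694518378725710217028378387894478588163542810100695661057218564639186491840248299738144863901655851796757852520501560576
    151 3620693294033321508069080113219146692069269540199711588806522409190574595885466028167911501644299546401085439160557162798279510920684908283098011137641661008513635131670406865535505514831993014935274203461602369705085602617511200416681380448601813284396769167602621646286496192851649387952313235085882252976400290791850755223351022407987350850348653517254153423039576071862637584894073991432560687964511929735077671415431140816694885036743796553050130443567941024682247130298358956637110621274466015413838472736177294210530153477089344672608817364416965024861433384311392459315970074609132543547223762469336185159261664641021768752366697594161347972098495907961436445007168196581139033816114417819099419736294421937834100442579169152349179458465709904729283408031282096238170727175613764459539678172388483093021394687130812263969965247329566766511580978080917583756644620584993302320211797457008053040292363436515413140718645606428697729384708475242424888712239423360721779932896999820696161124877285838006064745191371867284331033677122994649139409511469247413714691266817947264665101114550831309846637172638417782047743821331077770805103642128887543647158153196418914497938053373067978552255308709863511689607907213392962954650551860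32341783473117447255044183464490365376385302636284558893275475031570265533278201550619458087608849924723573778909751591730958818
    871056205479029282657332754854429410007984327499603656864004044069305901119202644004323895239618910268738025494519380601443904821932208116558971163689012247103410093302083124663760843069788022853719197385462421586632431650305491937502705607824691950608707875830240578600082806135343486262238245407936604468773394718472292544247316500651145576256225392263484246183207237756435498413322089885546791481085086535531242166497426566429669352563896903426139649618352044391863362524383040839695492042901119699590842256085781291709974632182439743717929
    180 7224072427796217934280295557601941566362303996974709408671368590760099597783548118794767145608164607053844174579587686059991928867161777076862534344067619255343116579573633915196029996649683479953197403003258864615998744139818039998896836125835853594534467062762286767216980785049617574853181031106092796802030385717209902293826041449819404698044168957233635025995073596579768154570788108817120604915775323594867910577093797957252267889816469442923908933666947272458196405077193614921372776665010006414124828114089002127500426712115628549690013310658101927486126055929618659358828125761059040119844634118852441379260656935116707538957222759416436981568276822218189619280690407217251338148670489419236644366060394347332274458803231488136152346764491333121345497075164162531718757427570231632095030859407974417820179074305519194937711300761457502322551204328686485706692995363994642881146814153162252293371276725764076217826138638089926154393429219977591361433896139303312707748583853807553082295658772594738216483041317688859971405398972902651755741549495042022395895906064647304401600903841752455486770775104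458077702734070702678884092709868824895027439240005528131064226582240453115804895205583989877611742906101742009335814398476815782288229859395315270754309673150203878894678439038557219979787947113721364298478736874791690426655177523872741341730034670376338063777269063050481854226915135375737736988211994294602306704268885205082379210690858675063191351478023964486775255466347082554475681879657236275796546718465129901454087374073936154733727657534063632601997040293220535820564773969509156184842962136189730692420138
    (by decide +kernel) (by decide +kernel) (by decide +kernel) (by decide +kernel)

theorem full_20 : Full 20 :=
  full_small (w1 := 1260864198284623334792929283204595641762551656654892608377678692020875929999467800838339417834790891720032026714177536)
    (w2 := 1684996666696914987166688442938726917102321526408785780068972494848) [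
    (400, 68860960404715244148662734153741085119373872122465435380230322182118985330793891997908013026378951588254231599637047311935824004254178332997889204795680104243280356639737309553801790816338536081245972498002832464960530431123578204474669114970141774206190974213175800961531629046881173043579709634729249375983113440832693099697626588733462859721590530084243955015335776641671898653300268084963140094604931031112652765620451584518982162533441665524963267838240380461633794212980103662552548891829212215709376727732002850832720127014120431968936425083111008226720644609180921716472351365878798450800331250,
      69671133274300415219060601589020147853800657234782744766400857967339958538258018672238637600272824645418502429337732795750804647433584345625307963102642737470554868554420852925906257150345331307263862860597935882167439130092158480193933318261119571730202446095034791090312329721119888310599424010635409946307565075412012085082192829469402332206507037715908707909664860196716583643577742985093209385456877029257323741270083315714975446179792471905120260479739265330143488842579459996863595338481893192670900625092103492854061308143840357588675622489384875378986230660354928816553226215399305212365084000),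
    (398, 66727022936456128997666350570699259847770301383003098107419668217001461984232686909891241294224942656685426912892446822372026027319844582692481465016965354959987986883724209348131319158749766144615232390761221859803826441259167489007737450814829426121944928944495054268680212377830633166259202531894265765968441842773996017245991623949283481943766202634257091517488893223096970094900596350829207757712519068933917101479565765021241782421406574414127238638298429154794957220566995130654187747713948390688059682124440083202753439182092177569859481291306102691573591855793918982345372378142642564336169250,
      66770425053502963516029390198342333491129488109410505164297577944340308328350448563892888727708740262769430224703529786338881523555015392659238879575995345368272463683049954269942369036227285828752448906913741684357670972606028958485203293289350026612573246977008603009288182921966798683607173937796307291556234639877905634403348920937575244754016710402980573490952687498266601006926724372052387608322772249570561970975815470423722661549035356198456892336661445230972816784499128379384109609250369357582388325775032451894157979129333335443025566546277640113890287569310175517428271969382247482482984000),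
    (397, 69913684176808855830509586357363067175643190149506238936143634267280749720118855911986131693666487533242783948563565326006646465260891253128523098110829437174319464571562424245665122803643372652447377774643196649139312559204575569065698902340533626909855165750258574466861441604871936961900188821232198940463198920197613482993248166309160271123633603443437977453892796192247442419257661099694473971826477877693145092671950825089977366058596260967268468431071483815872347968723592911739253662025671881829499230052144641833512983796566862178357583953848527847840442395483576726476112547461601866937615875,
      63070411600818770621690764553865864549380363325296208436225422138199835861773254066042269507834528070718931373005025150284726217332712822569040308926792527097005803960835594784631291457385823284852849484820179171837429102509455753674239084660827175484589605507769232802106765106912951359255916115074400876153497078304974388742031744238242264197519984198507317016966505136795922354253043177944800297517132304429312391658674753089182408365150796507744020067622651162212145221119277821160474505050274641563094542337035121970325066082210246075397798721382163953037420447697243156101986995499281095758186500),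
    (396, 68860960404715244148662734153741085119373872122465435380230322182118985330793891997908013026378951588254231599637047311935824004254178332997889204795680104243280356639737309553801790816338536081245972498002832464960530431123578204474669114970141774206190974213175800961531629046881173043579709634729249375983113440832693099697626588733462859721590530084243955015335776641671898653300268084963140094604931031112652765620451584518982162533441665524963267838240380461633794212980103662552548891829212215709376727732002850832720127014120431968936425083111008226720644609180921716472351365878798450800331250,
      69671133274300415219060601589020147853800657234782744766400857967339958538258018672238637600272824645418502429337732795750804647433584345625307963102642737470554868554420852925906257150345331307263862860597935882167439130092158480193933318261119571730202446095034791090312329721119888310599424010635409946307565075412012085082192829469402332206507037715908707909664860196716583643577742985093209385456877029257323741270083315714975446179792471905120260479739265330143488842579459995733861050487577151342109142365270836619837059640683897222137905150682128502843983159899073681559684835483171924773148000),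
    (395, 68860960404715244148662734153741085119373872122465435380230322182118985330793891997908013026378951588254231599637047311935824004254178332997889204795680104243280356639737309553801790816338536081245972498002832464960530431123578204474669114970141774206190974213175800961531629046881173043579709634729249375983113440832693099697626588733462859721590530084243955015335776641671898653300268084963140094604931031112652765620451584518982162533441665524963267838240380461633794212980103662552548891829212215709376727732002850832720127014120431968936425083111008226720644609180921716472351365878798450800331250,
      8676690087898064982498370561193889482232645378156443348953800217119680984726172804359358552105136418580548547996415131951832021516454803176187898248279110908533849036849165279476474030103778087305196732101225539253283518419798711299592171812649406967376202713587967747800410190725540571635060938749965026184457294242610359016761942408168501015557441403160858111722923040174722559500523515733944304833788188020762980923712274100433710677282639221842714268907781330301345653503204936580493746964775011118844704726833949986688330492872621141401227079628902904742804933135060704749608890795824842782774625),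
    (394, 68860960404715244148662734153741085119373872122465435380230322182118985330793891997908013026378951588254231599637047311935824004254178332997889204795680104243280356639737309553801790816338536081245972498002832464960530431123578204474669114970141774206190974213175800961531629046881173043579709634729249375983113440832693099697626588733462859721590530084243955015335776641671898653300268084963140094604931031112652765620451584518982162533441665524963267838240380461633794212980103662552548891829212215709376727732002850832720127014120431968936425083111008226720644609180921716472351365878798450800331250,
      69671133274300415219060601589020147853800657234782744766400857967339958538258018672238637600272826325161104931010506912507947672124357966089680680755795064750231099270779208121207642151566162518787577621700170792318543518977548336177224288985058731581730422760959513439623598919687697006916292575581388329029445797579855508927782389774609152258320583116028922046533942922874820809568915623857228742486741790557140775469485489064021615122141027739271478704613057671596520902143806137653231007279826194191246070229174658266761335193932534001123126560971007513421831173979617172184499228641234829740316000),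
    (393, 68860960404715244148662734153741085119373872122465435380230322182118985330793891997908013026378951588254231599637047311935824004254178332997889204795680104243280356639737309553801790816338536081245972498002832464960530431123578204474669114970141774206190974213175800961531629046881173043579709634729249375983113440832693099697626588733462859721590530084243955015335776641671898653300268084963140094604931031112652765620451584518982162533441665524963267838240380461633794212980103662552548891829212215709376727732002850832720127014120431968936425083111008226720644609180921716472351365878798450800331250,
      69671133274300415219060601589020147853800657234782744766400857967337829211539666587551994712845101047595943224959700215945566684091080074030949838993377713499234800613449934991845475108300635769607798644721703241614980825424839234121156171403433581763898187011941047437487383086667295148835035973958885902399649292434993692823710784463047556618647608441012012127447593837725246568734275179290169680356254608386615309512012352352655001782751354307621261750304754989268452333207880541155592303386260566016839034543664349045504987500227906315157622948422820562722591290049697573813470523626833359178012000),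
    (392, 68860960404715244148662734153741085119373872122465435380230322182118985330793891997908013026378951588254231599637047311935824004254178332997889204795680104243280356639737309553801790816338536081245972498002832464960530431123578204474669114970141774206190974213175800961531629046881173043579709634729249375983113440832693099697626588733462859721590530084243955015335776641671898653300268084963140094604931031112652765620451584518982162533441665524963267838240380461633794212980103662552548891829212215709376727732002850832720127014120431968936425083111008226720644609180921716472351365878798450800331250,
      69671133274300415219060601589020147853800657234782744766400857967339958538258018672238637600272824645418502429337732795750804647433584345625307963102642737470554868568050097035092603145870459345465157463762245185888370976623190160329553876654468546639661431886081009991750796936450778541646229747824821115149079608930233669759955012113236475242110645325423310731761604554061657723744029996352770129025310508806263906063923820616391537151331598232785179634598780192221690956480716138234725942556714847084069388548194252906391460535621704700248841877064594521422977057870941033741456392477528787552540000),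
    (391, 68860960404715244148662734153741085119373872122465435380230322182118985330793891997908013026378951588254231599637047311935824004254178332997889204795680104243280356639737309553801790816338536081245972498002832464960530431123578204474669114970141774206190974213175800961531629046881173043579709634729249375983113440832693099697626588733462859721590530084243955015335776641671898653300268084963140094604931031112652765620451584518982162533441665524963267838240380461633794212980103662552548891829212215709376727732002850832720127014120431968936425083111008226720644609180921716472351365878798450800331250,
      69671133274300415219060601589021209239057984669095902133584626207317777903022703203158121437237870577205034376784156283598933930632903508295639411849903522383655368386907264382150883388922794853837237604264490127940977473285433222935910354501800706169743482866343891509162687121858823667325457972061463794413604010431119662057777959952406060639162743136809800015892611707501511317112090388564713785184510453533631105518310228995220269993176602685397700069772064429487296133111801468383314029963854266777506040835011955622109032902995102672640991473064015453119797462931446871557070332090283132750108000),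
    (390, 68860960404715244148662734153741085119373872122465435380230322182118985330793891997908013026378951588254231599637047311935824004254178332997889204795680104243280356639737309553801790816338536081245972498002832464960530431123578204474669114970141774206190974213175800961531629046881173043579709634729249375983113440832693099697626588733462859721590530084243955015335776641671898653300268084963140094604931031112652765620451584518982162533441665524963267838240380461633794212980103662552548891829212215709376727732002850832720127014120431968936425083111008226720644609180921716472351365878798450800331250,
      69671133274300415219249024341058656785557728264949986413524558618335678797044258907924918230752091163147004748411119094135105975451307901601213733296189728418868555940340808477868322833345172031401548600094663201101899854998208268690924937237659996102944905365132197272605219602375018726139460456787451498084114022272112017118670342290999517506953311687417631703380068554515904194649423583324410274556567806609913149030013220141494535914837956626595738918038078434527421509725262384586331278445321739370579429850989280630766510511714702966932657323769998161474155108577393133251593513161722592266524000),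
    (389, 68860960404715244148662734153741085119373872122465435380230322182118985330793891997908013026378951588254231599637047311935824004254178332997889204795680104243280356639737309553801790816338536081245972498002832464960530431123578204474669114970141774206190974213175800961531629046881173043579709634729249375983113440832693099697626588733462859721590530084243955015335776641671898653300268084963140094604931031112652765620451584518982162533441665524963267838240380461633794212980103662552548891829212215709376727732002850832720127014120431968936425083111008226720644609180921716472351365878798450800331250,
      69671133274300415219249024341058833510349109444355380546862391828287064270648737753060203485358039241561392248416627938137020124835362629302496236129391174693264482572114574257273696021559339430807841386514043948557694599832185601423484168507604441747857744931965635122694872127800273888942044274784395511625094826797494020938832430045040530751967591291687953169208924627675817194485669116310680128845793129832240601384064581917162305749585477998157676330724900654109091119215238789052383268915123087775739076652154056198644525432714849003110159853267156473996532746056297560832054421858186347972892000)]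
    68860960404715244148662734153741085119373872122465435380230322182118985330793891997908013026378951588254231599637047311935824004254178332997889204795680104243280356639737309553801790816338536081245972498002832464960530431123578204474669114970141774206190974213175800961531629046881173043579709634729249375983113440832693099697626588733462859721590530084243955015335776641671898653300268084963140094604931031112652765620451584518982162533441665524963267838240380461633794212980103662552548891829212215709376727732002850832720127014120431968936425083111008226720644609180921716472351365878798450800331250
    69671133274300415219249024341058833510349109444355380546862391828287064270648737753060203486128624519966666619515025006033904629658575349025333145757241960498710492816331414370330864054810441247130258878093821116895922700235927169333442897191529247940637770536434731574959745501484890608943866407868054834116481431269748341874817892777562041537783925468291290428077776367949117406123146916343181475685834077040051524764555564558170005069818844222670128959020681420443616096329963870483048229829760340524046712600929048538407672881689490057122535562465013080743351753966912176628806558161259914889500000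
    168 55837949196829235618431255550757923197941537849502541886543153228844430744613248581609905655999634843105909851219101404352720519505948266676133069974290288895133986113799627579272833178818492465617387436041937417718739226074099109221131902273065241008364380402091754392925257045463455802618556593019314205947881205954667395721869450553106854753753491728827911639773059345202314110265664844766322302747022749664483438780481358741251813033349415325310863057126289599977532272467264911756423089843224713777601820252085833810140614324376445933745049502756618793460886218809913825789045160562998110004031200887355959771262276722100394773002577244543609521929939342268064419126101371832337497593513861367290751139948219229004806536235298265007150983032691813560651951853492610285276681132858541000043369230853842766882080572094276807085529541965727481438316428200542802075830070237386597831177471999886086027752059492555017611415592894083471261682464803429551698284509858132545730488985278604990217603682894675876960835186901424593002377083804915139950529049349174182611736259382952789474152534784103651966737949627563221802537432548122975329120854100630911607538582145205227997548664757656595092915294611751668344176634034007271776026860886639441225398238969478205103819888547668012783597215668491461546466021708915600838409223905484505033854450460902954722242942978641236680702827873388949351384964656442678141484086851396733170306628937046613000783189317138111839528824861173424630462242346109072095237895467657133555939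
    68448194892416010584313314293846048303395975897881491334327451137035175287076406102527248159444888078316313867594672515123491182850553221006044257469079704281044280509698519410309783573277711477459340243205710827562672504252360220411220348080355309994644534199437404509643771032531828944486289847171735562058586559347780817593151795898790419452416043915255583988771002990787277530998511714601746166522150601475288991985239200489688450575364187134174426475806060365203001275693050583865472772351422451624632535200951523878136615557562975627314957312830731385984234273493398962310222039993271668961744000
    201 5759663804101777302158514914813350407532597388964850773046886604701511774960252717023596655281478811421351575085066093879795180772064709576129616544562717972268718081271391123494451596103605641347874749422741707496488177985856870585876151947563792326362374978834612974889070366154776787491196045512443631577848193193565456825373754956996300712240539509697469921201063127227243073008298043776684771041522614939956986599547223338879333938144486205434851562137211788160449526361503550949947839813058946711871385680051999362964842815030910393660193861413075507701931222086557109867635573763122335577280794298588219223488559810408483184467521526828290065772940385781437065166303835516415566793822705906860344555568990572988173049463115641961465360008004211524693420808306586813830893226243711507060704562606349451815146455308572931997292495996838031557633417925056839688504470412390633421296937076627092144015200398655423610710670945061720625170863709394255876140723590077753676326041123429980268751252040591797420747157890263251973056826923105011297027715363027600133255275920612961386187582634191231845889152001625048728018722216313460074498002007278703020687309956533853589278922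6216753495277404734602540974954815027060885860672594077046181626047695718756977482425563530460066185430793976178357320297201104324324876099638227816549154628589404900496296067958208648716606134622086193010973287230177296330292684250822542812548221822540922188467928141212829557708980504388712097287024880164303776662489200275738385445830056148175363723734518546490959589349711164187981341697784360246704019991370052317917520212840447096748355000876001916528736108317734834109094393810164594674423813608328418112535310226834132654074236992685135822484107633270277122761138343516548589320085711940828209049782607783070700846587938271660459
    (by decide +kernel) (by decide +kernel) (by decide +kernel) (by decide +kernel)

end ROrth

namespace ROrth
open Finset Function
set_option linter.unusedSectionVars false

/-! ### Exhaustive search for small orders: definitions -/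

/-- Options: a mask and a payload. -/
abbrev Opt := ℕ × ℕ

/-- Forced evaluation, Boolean version. -/
def frb (x : ℕ) (k : ℕ → Bool) : Bool := Nat.rec (k 0) (fun p _ => k (Nat.succ p)) x

theorem frb_eq (x : ℕ) (k : ℕ → Bool) : frb x k = k x := by cases x <;> rfl

/-- Force a list of options. -/
def fol (L : List Opt) : (List Opt → Bool) → Bool :=
  List.rec (fun k => k []) (fun o _ ih k =>
    frb o.1 fun x => frb o.2 fun y => ih fun l => k ((x, y) :: l)) L

theorem fol_eq (L : List Opt) (k : List Opt → Bool) : fol L k = k L := by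
  induction L generalizing k with
  | nil => rfl
  | cons o L ih =>
    have : fol (o :: L) k = frb o.1 fun x => frb o.2 fun y => fol L fun l => k ((x, y) :: l) := rfl
    rw [this, frb_eq, frb_eq, ih]

/-- Force a list of lists of options. -/
def foll (Ls : List (List Opt)) : (List (List Opt) → Bool) → Bool :=
  List.rec (fun k => k []) (fun L _ ih k => fol L fun l => ih fun ls => k (l :: ls)) Ls

theorem foll_eq (Ls : List (List Opt)) (k : List (List Opt) → Bool) : foll Ls k = k Ls := by
  induction Ls generalizing k with
  | nil => rfl
  | cons L Ls ih =>
    have : foll (L :: Ls) k = fol L fun l => foll Ls fun ls => k (l :: ls) := rfl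
    rw [this, fol_eq, ih]

/-- Depth first search through pairwise disjoint options: `k` holds at each leaf. -/
def dfs (Ls : List (List Opt)) : ℕ → ℕ → (ℕ → Bool) → Bool :=
  List.rec (fun _ w k => k w)
    (fun L _ ih u w k => List.rec true (fun o _ ihL =>
      Nat.rec (cond (frb (Nat.lor u o.1) fun u' => frb (Nat.lor w o.2) fun w' => ih u' w' k)
        ihL false) (fun _ _ => ihL) (Nat.land o.1 u)) L) Ls

/-- Symbols allowed in a cell. -/
def allowed (n : ℕ) (c : ℕ → ℕ) (i j : ℕ) : List ℕ :=
  match i, j with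
  | 0, j => [j]
  | i + 1, 0 => [i + 1]
  | 1, j + 1 => [c (j + 1)]
  | _ + 2, _ + 1 => List.range n

/-- Option of a cell of the first square. -/
def aopt (i j v : ℕ) : Opt := (2 ^ (6 * j + v) ||| 2 ^ (36 + (6 * i + v)), v <<< (3 * (6 * i + j)))

/-- The lists of options for the first square. -/
def alists (n : ℕ) (c : ℕ → ℕ) : List (List Opt) :=
  (List.range (n * n)).map fun q => (allowed n c (q / n) (q % n)).map (aopt (q / n) (q % n))

/-- Position of the lowest bit of a six bit number. -/
def low (m : ℕ) : ℕ := Nat.mod (Nat.shiftRight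
  101169779403443228389237721279163912198924333333925339200 (Nat.mul 3 m)) 8

/-- Search for the partial permutations inside the free cells `F`; `K` is the table of compatible
cells, `P` the table of payloads. -/
def msr (K P : ℕ) (is : List ℕ) : ℕ → ℕ → (ℕ → Bool) → Bool :=
  List.rec (fun _ ch k => frb ch k)
    (fun i _ ih F ch k => (Nat.rec (fun _ => false) (fun _ ihm m => Nat.rec true (fun _ _ =>
      frb (low m) fun b =>
        cond (frb (Nat.land F (Nat.shiftRight K (Nat.mul 36 (Nat.add (Nat.mul 6 i) b)))) fun F' =>
          ih F' (Nat.lor ch (Nat.mod (Nat.shiftRight P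
            (Nat.mul 42 (Nat.add (Nat.mul 6 i) b))) (Nat.pow 2 42))) k)
          (frb (Nat.sub m (Nat.pow 2 b)) ihm) false) m) 7 : ℕ → Bool)
      (Nat.mod (Nat.shiftRight F (Nat.mul 6 i)) 64)) is

/-- Number of ones of a six bit number. -/
def pop6 (m : ℕ) : ℕ := Nat.mod (Nat.shiftRight
  5266721624626081916652898579601397356032429460333936579656 (Nat.mul 3 m)) 8

/-- No forbidden value can be reached from `t` with `m` classes left; the forbidden values
are given by a mask. -/
def cut (lo hi bad t m : ℕ) : ℕ := Nat.mod (Nat.shiftRight bad (Nat.add t (Nat.mul lo m)))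
  (Nat.pow 2 (Nat.succ (Nat.mul (Nat.sub hi lo) m)))

/-- Search for one class. -/
def one (K P : ℕ) (is : List ℕ) (b F : ℕ) (k : ℕ → Bool) : Bool :=
  frb (Nat.land F (Nat.shiftRight K (Nat.mul 36 b))) fun F' =>
    msr K P is F' (Nat.lor (Nat.pow 2 b) (Nat.pow 2 (Nat.add 36 b))) k

/-- Remove cells. -/
def rmv (F ch : ℕ) : ℕ := Nat.xor F (Nat.mod ch (Nat.pow 2 36))

/-- Search through the classes of the second square. -/
def cls (K P lo hi bad : ℕ) (is bs : List ℕ) : ℕ → ℕ → Bool :=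
  List.rec (fun _ _ => false) (fun b bs ih F t =>
    one K P is b F fun ch => frb (Nat.add t (pop6 (Nat.shiftRight ch 36))) fun t' =>
      Nat.rec true (fun _ _ => frb (rmv F ch) fun F' => ih F' t')
        (cut lo hi bad t' (List.length bs))) bs

/-- Entry of the packed square. -/
def en3 (w i j : ℕ) : ℕ := Nat.mod (Nat.shiftRight w (Nat.mul 3 (Nat.add (Nat.mul 6 i) j))) 8

/-- Packed table. -/
def bld (s : ℕ) (f : ℕ → ℕ) (m : ℕ) : ℕ :=
  Nat.rec 0 (fun q ih => Nat.lor ih (Nat.shiftLeft (f q) (Nat.mul s q))) m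

/-- The cells of a column. -/
def colm (j : ℕ) : ℕ := Nat.shiftLeft 1090785345 j

/-- The cells outside the column of a cell. -/
def kr (q : ℕ) : ℕ := Nat.xor (Nat.sub (Nat.pow 2 36) 1) (colm (Nat.mod q 6))

/-- Payload of a cell. -/
def pl (w q : ℕ) : ℕ := Nat.lor (Nat.pow 2 q) (Nat.pow 2 (Nat.add 36 (en3 w 0 q)))

/-- Symbol masks. -/
def sm (w : ℕ) (m : ℕ) : ℕ :=
  Nat.rec 0 (fun q ih => Nat.lor ih (Nat.pow 2 (Nat.add (Nat.mul 36 (en3 w 0 q)) q))) m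

/-- The cells compatible with a given one in a transversal. -/
def kt (S w q : ℕ) : ℕ := Nat.land (kr q) (Nat.xor (Nat.sub (Nat.pow 2 36) 1)
  (Nat.mod (Nat.shiftRight S (Nat.mul 36 (en3 w 0 q))) (Nat.pow 2 36)))

/-- The cells of the square. -/
def cells (n : ℕ) : ℕ := bld 6 (fun _ => Nat.sub (Nat.pow 2 n) 1) n

/-- The type of a permutation: fixed points of square and cube. -/
def typ (n : ℕ) (f : ℕ → ℕ) : ℕ :=
  Nat.rec 0 (fun j ih => Nat.add ih (Nat.add (cond (Nat.beq (f (f j)) j) 1 0)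
    (cond (Nat.beq (f (f (f j))) j) 7 0))) n

/-- All types of rows are at least `t`. -/
def good (n t w : ℕ) : Bool :=
  allB (fun i => Nat.ble t (typ n (en3 w (i + 1)))) (n - 1)

/-- Small orders: the complete search. -/
def search (n bad : ℕ) (bs is : List ℕ) (c : ℕ → ℕ) : Bool :=
  foll (alists n c) fun Ls => frb (bld 36 kr 36) fun K => frb (typ n c) fun t => dfs Ls 0 0 fun w =>
    cond (good n t w)
      (frb (bld 42 (pl w) 36) fun P => cls K P 1 n bad is bs (cells n) 0) true

/-- Nested search for transversals. -/
def nest (K KT P bad : ℕ) (is bs : List ℕ) : ℕ → List ℕ → ℕ → Bool :=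
  List.rec (fun F sk s => cond (Nat.ble s 2) (cls K P 1 5 bad is sk F (Nat.sub 36 (Nat.mul 6 s)))
      (cls K P 5 5 bad is sk F 18))
    (fun b _ ih F sk s => cond (one KT P is b F fun ch => frb (rmv F ch) fun F' => ih F' sk s)
      (cond (Nat.ble s 2) (ih F (b :: sk) (Nat.succ s)) true) false) bs

/-- The search for order six. -/
def search6 (bad : ℕ) (bs is : List ℕ) (c : ℕ → ℕ) : Bool :=
  foll (alists 6 c) fun Ls => frb (bld 36 kr 36) fun K => frb (typ 6 c) fun t => dfs Ls 0 0 fun w =>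
    cond (good 6 t w)
      (frb (bld 42 (pl w) 36) fun P => frb (sm w 36) fun S => frb (bld 36 (kt S w) 36) fun KT =>
        nest K KT P bad is bs (cells 6) [] 0) true

/-- A function given by a list. -/
def fnl (l : List ℕ) (j : ℕ) : ℕ := l.getD j 0
end ROrth

namespace ROrth
open Finset Function

/-! ### Soundness of the search -/

theorem dfs_nil (u w : ℕ) (k : ℕ → Bool) : dfs [] u w k = k w := rfl

theorem dfs_cons (L : List Opt) (Ls : List (List Opt)) (u w : ℕ) (k : ℕ → Bool)
    (h : dfs (L :: Ls) u w k = true) (o : Opt) (ho : o ∈ L) (hd : o.1 &&& u = 0) :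
    dfs Ls (u ||| o.1) (w ||| o.2) k = true := by
  have key : ∀ L' : List Opt, (List.rec true (fun o _ ihL =>
      Nat.rec (cond (frb (Nat.lor u o.1) fun u' => frb (Nat.lor w o.2) fun w' => dfs Ls u' w' k)
        ihL false) (fun _ _ => ihL) (Nat.land o.1 u)) L' : Bool) = true → o ∈ L' →
        dfs Ls (u ||| o.1) (w ||| o.2) k = true := by
    intro L'
    induction L' with
    | nil => intro _ h; simp at h
    | cons a L' ih =>
      intro h hm
      simp only at h
      have hz : (Nat.land a.1 u = 0) ∨ ∃ p, Nat.land a.1 u = p + 1 := by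
        cases Nat.land a.1 u with
        | zero => exact Or.inl rfl
        | succ p => exact Or.inr ⟨p, rfl⟩
      rcases hz with hz | ⟨p, hz⟩
      · rw [hz] at h
        change cond (frb (Nat.lor u a.1) fun u' => frb (Nat.lor w a.2) fun w' => dfs Ls u' w' k)
          _ false = true at h
        rw [frb_eq, frb_eq] at h
        rcases hb : dfs Ls (Nat.lor u a.1) (Nat.lor w a.2) k with _ | _
        · rw [hb] at h; simp at h
        · rw [hb] at h
          simp only [cond_true] at h
          rcases List.mem_cons.1 hm with rfl | hm
          · exact hb
          · exact ih h hm
      · rw [hz] at h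
        simp only at h
        rcases List.mem_cons.1 hm with rfl | hm
        · have : Nat.land o.1 u = 0 := hd
          omega
        · exact ih h hm
  exact key L h ho

theorem dfs_sound (L : ℕ → List Opt) (o : ℕ → Opt) (ks : List ℕ) (k : ℕ → Bool) (u w : ℕ)
    (ho : ∀ q ∈ ks, o q ∈ L q) (hu : ∀ q ∈ ks, (o q).1 &&& u = 0)
    (hp : ks.Pairwise fun q q' => (o q').1 &&& (o q).1 = 0)
    (h : dfs (ks.map L) u w k = true) :
    ∃ w', k w' = true ∧ ∀ t, w'.testBit t = true ↔
      w.testBit t = true ∨ ∃ q ∈ ks, (o q).2.testBit t = true := by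
  induction ks generalizing u w with
  | nil => exact ⟨w, h, by simp⟩
  | cons q ks ih =>
    rw [List.map_cons] at h
    have h1 := dfs_cons _ _ _ _ _ h (o q) (ho q (by simp)) (hu q (by simp))
    rw [List.pairwise_cons] at hp
    obtain ⟨w', hw, ht⟩ := ih (u ||| (o q).1) (w ||| (o q).2) (fun x hx => ho x (by simp [hx]))
      (fun x hx => by
        rw [Nat.and_or_distrib_left, hu x (by simp [hx]), hp.1 x hx]; rfl) hp.2 h1
    refine ⟨w', hw, fun t => ?_⟩
    rw [ht, Nat.testBit_or]
    simp only [Bool.or_eq_true, List.mem_cons, exists_eq_or_imp, or_assoc]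

theorem low_lt : ∀ m < 64, ∀ b < 6, m.testBit b = true → b ≠ low m →
    (m - 2 ^ low m).testBit b = true := by decide +kernel

/-- The inner loop of `msr`. -/
def msi (f : ℕ → Bool) (fu : ℕ) : ℕ → Bool :=
  Nat.rec (fun _ => false) (fun _ ihm m => Nat.rec true (fun _ _ =>
      frb (low m) fun b => cond (f b) (frb (Nat.sub m (Nat.pow 2 b)) ihm) false) m) fu

theorem msi_sound (f : ℕ → Bool) (b : ℕ) (hb : b < 6) (fu : ℕ) : ∀ m < 64, m.testBit b = true →
    msi f fu m = true → f b = true := by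
  induction fu with
  | zero => intro m _ _ h; simp [msi] at h
  | succ fu ih =>
    intro m hm ht h
    have hm0 : ∃ p, m = p + 1 := by
      cases m with
      | zero => simp at ht
      | succ p => exact ⟨p, rfl⟩
    have e : msi f (fu + 1) m = frb (low m) fun b =>
        cond (f b) (frb (Nat.sub m (Nat.pow 2 b)) (msi f fu)) false := by
      obtain ⟨p, rfl⟩ := hm0
      rfl
    rw [e, frb_eq, frb_eq] at h
    rcases hf : f (low m) with _ | _
    · rw [hf] at h; simp at h
    · rw [hf] at h
      simp only [cond_true] at h
      by_cases hbl : b = low m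
      · rw [hbl, hf]
      · exact ih (m - 2 ^ low m) (lt_of_le_of_lt (Nat.sub_le _ _) hm) (low_lt m hm b hb ht hbl) h

theorem msr_cons (K P i : ℕ) (is : List ℕ) (F ch : ℕ) (k : ℕ → Bool) :
    msr K P (i :: is) F ch k = msi (fun b => frb (F &&& (K >>> (36 * (6 * i + b)))) fun F' =>
          msr K P is F' (ch ||| ((P >>> (42 * (6 * i + b))) % 2 ^ 42)) k) 7
          ((F >>> (6 * i)) % 64) := rfl

theorem msr_sound (K P : ℕ) (p : ℕ → ℕ) (is : List ℕ) (F ch : ℕ) (k : ℕ → Bool)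
    (hp : ∀ i ∈ is, p i < 6) (hF : ∀ i ∈ is, F.testBit (6 * i + p i) = true)
    (hK : is.Pairwise fun i i' => K.testBit (36 * (6 * i + p i) + (6 * i' + p i')) = true)
    (h : msr K P is F ch k = true) :
    ∃ ch', k ch' = true ∧ ∀ t, ch'.testBit t = true ↔
      ch.testBit t = true ∨ ∃ i ∈ is, t < 42 ∧ P.testBit (42 * (6 * i + p i) + t) = true := by
  induction is generalizing F ch with
  | nil =>
    have : msr K P [] F ch k = frb ch k := rfl
    rw [this, frb_eq] at h
    exact ⟨ch, h, by simp⟩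
  | cons i is ih =>
    rw [msr_cons] at h
    rw [List.pairwise_cons] at hK
    have h1 := msi_sound _ (p i) (hp i (by simp)) 7 _ (Nat.mod_lt _ (by norm_num)) (by
      have : (64 : ℕ) = 2 ^ 6 := by norm_num
      rw [this, Nat.testBit_mod_two_pow, Nat.testBit_shiftRight, hF i (by simp)]
      simp [hp i (by simp)]) h
    rw [frb_eq] at h1
    obtain ⟨c', hc, ht⟩ := ih _ _ (fun x hx => hp x (by simp [hx])) (fun x hx => by
      rw [Nat.testBit_and, hF x (by simp [hx]), Nat.testBit_shiftRight, hK.1 x hx]; rfl) hK.2 h1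
    refine ⟨c', hc, fun t => ?_⟩
    rw [ht, Nat.testBit_or, Nat.testBit_mod_two_pow, Nat.testBit_shiftRight]
    simp only [Bool.or_eq_true, Bool.and_eq_true, decide_eq_true_eq, List.mem_cons,
      exists_eq_or_imp, or_assoc]

theorem one_sound (K P b : ℕ) (p : ℕ → ℕ) (is : List ℕ) (F : ℕ) (k : ℕ → Bool)
    (hp : ∀ i ∈ is, p i < 6) (hF : ∀ i ∈ is, F.testBit (6 * i + p i) = true)
    (hK : is.Pairwise fun i i' => K.testBit (36 * (6 * i + p i) + (6 * i' + p i')) = true)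
    (hb : ∀ i ∈ is, K.testBit (36 * b + (6 * i + p i)) = true)
    (h : one K P is b F k = true) :
    ∃ ch', k ch' = true ∧ ∀ t, ch'.testBit t = true ↔
      (t = b ∨ t = 36 + b) ∨ ∃ i ∈ is, t < 42 ∧ P.testBit (42 * (6 * i + p i) + t) = true := by
  unfold one at h
  rw [frb_eq] at h
  obtain ⟨c', hc, ht⟩ := msr_sound K P p is _ _ k hp (fun i hi => by
    have : (F &&& (K >>> (36 * b))).testBit (6 * i + p i) = true := by
      rw [Nat.testBit_and, hF i hi, Nat.testBit_shiftRight, hb i hi]; rfl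
    exact this) hK h
  refine ⟨c', hc, fun t => ?_⟩
  rw [ht]
  have : (Nat.lor (Nat.pow 2 b) (Nat.pow 2 (Nat.add 36 b))).testBit t = true ↔
      (t = b ∨ t = 36 + b) := by
    change (2 ^ b ||| 2 ^ (36 + b)).testBit t = true ↔ _
    rw [Nat.testBit_or, Nat.testBit_two_pow, Nat.testBit_two_pow]
    simp only [Bool.or_eq_true, decide_eq_true_eq]
    rw [eq_comm, @eq_comm _ (36 + b)]
  rw [this]

theorem pop6_eq : ∀ m < 64, pop6 m = ((Finset.range 6).filter fun v => m.testBit v = true).card := by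
  decide +kernel

/-- Data of a class, with symbols `s`, first column `b`, columns `p`. -/
def cnt (s : ℕ → ℕ) (p : ℕ → ℕ → ℕ) (is : List ℕ) (b : ℕ) : ℕ :=
  ((Finset.range 6).filter fun v => v = b ∨ ∃ i ∈ is, s (6 * i + p b i) = v).card

/-- Description of the payload table. -/
def PTab (P : ℕ) (s : ℕ → ℕ) : Prop :=
  ∀ q < 36, s q < 6 ∧ ∀ t < 42, (P.testBit (42 * q + t) = true ↔ t = q ∨ t = 36 + s q)

theorem chosen_low {P : ℕ} {s : ℕ → ℕ} (hP : PTab P s) {is : List ℕ} {p : ℕ → ℕ} {b ch : ℕ}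
    (his : ∀ i ∈ is, 1 ≤ i ∧ i < 6) (hp : ∀ i ∈ is, p i < 6) (hb : b < 6)
    (hch : ∀ t, ch.testBit t = true ↔
      (t = b ∨ t = 36 + b) ∨ ∃ i ∈ is, t < 42 ∧ P.testBit (42 * (6 * i + p i) + t) = true)
    {i' x : ℕ} (hi' : i' ∈ is) (hx : x < 6) (hne : x ≠ p i') {F : ℕ}
    (hF : F.testBit (6 * i' + x) = true) : (rmv F ch).testBit (6 * i' + x) = true := by
  have h0 : ch.testBit (6 * i' + x) = false := by
    rw [← Bool.not_eq_true, hch]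
    have := his i' hi'
    rintro (h | ⟨i, hi, h1, h2⟩)
    · omega
    · have a1 := his i hi
      have a2 := hp i hi
      rw [(hP (6 * i + p i) (by omega)).2 _ h1] at h2
      rcases h2 with h2 | h2
      · have : i = i' := by omega
        subst this
        omega
      · omega
  change (F ^^^ (ch % 2 ^ 36)).testBit (6 * i' + x) = true
  rw [Nat.testBit_xor, Nat.testBit_mod_two_pow, h0, hF]
  simp

theorem chosen_cnt {P : ℕ} {s : ℕ → ℕ} (hP : PTab P s) {is : List ℕ} {p : ℕ → ℕ → ℕ} {b ch : ℕ}
    (his : ∀ i ∈ is, 1 ≤ i ∧ i < 6) (hp : ∀ i ∈ is, p b i < 6) (hb : b < 6)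
    (hch : ∀ t, ch.testBit t = true ↔
      (t = b ∨ t = 36 + b) ∨ ∃ i ∈ is, t < 42 ∧ P.testBit (42 * (6 * i + p b i) + t) = true) :
    pop6 (Nat.shiftRight ch 36) = cnt s p is b := by
  have hlt : ch < 2 ^ 42 := by
    apply Nat.lt_pow_two_of_testBit
    intro t ht
    rw [← Bool.not_eq_true, hch]
    rintro (h | ⟨i, hi, h1, h2⟩) <;> omega
  have e : ch >>> 36 < 64 := by
    rw [Nat.shiftRight_eq_div_pow]
    omega
  change pop6 (ch >>> 36) = _
  rw [pop6_eq _ e]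
  unfold cnt
  congr 1
  apply Finset.filter_congr
  intro v hv
  rw [Finset.mem_range] at hv
  rw [Nat.testBit_shiftRight, hch]
  constructor
  · rintro (h | ⟨i, hi, h1, h2⟩)
    · left; omega
    · right
      have a1 := his i hi
      have a2 := hp i hi
      rw [(hP (6 * i + p b i) (by omega)).2 _ h1] at h2
      exact ⟨i, hi, by omega⟩
  · rintro (h | ⟨i, hi, h1⟩)
    · left; omega
    · right
      have a1 := his i hi
      have a2 := hp i hi
      refine ⟨i, hi, by omega, ?_⟩
      rw [(hP (6 * i + p b i) (by omega)).2 _ (by omega)]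
      omega

/-- Description of the table of compatible cells. -/
def KTab (K : ℕ) : Prop := ∀ q < 36, ∀ q' < 36, q % 6 ≠ q' % 6 → K.testBit (36 * q + q') = true

/-- Hypotheses on the classes. -/
structure Cl (p : ℕ → ℕ → ℕ) (is bs : List ℕ) : Prop where
  is1 : ∀ i ∈ is, 1 ≤ i ∧ i < 6
  nd : is.Nodup
  b6 : ∀ b ∈ bs, b < 6
  p6 : ∀ b ∈ bs, ∀ i ∈ is, p b i < 6
  pb : ∀ b ∈ bs, ∀ i ∈ is, p b i ≠ b
  inj : ∀ b ∈ bs, ∀ i ∈ is, ∀ i' ∈ is, p b i = p b i' → i = i'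

theorem Cl.sub {p : ℕ → ℕ → ℕ} {is bs bs' : List ℕ} (h : Cl p is bs) (hs : ∀ b ∈ bs', b ∈ bs) :
    Cl p is bs' :=
  ⟨h.is1, h.nd, fun b hb => h.b6 b (hs b hb), fun b hb => h.p6 b (hs b hb),
    fun b hb => h.pb b (hs b hb), fun b hb => h.inj b (hs b hb)⟩

theorem Cl.one {p : ℕ → ℕ → ℕ} {is bs : List ℕ} (h : Cl p is bs) {K P F b : ℕ}
    (hK : KTab K) (hb : b ∈ bs) {k : ℕ → Bool}
    (hF : ∀ i ∈ is, F.testBit (6 * i + p b i) = true)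
    (ho : one K P is b F k = true) :
    ∃ ch', k ch' = true ∧ ∀ t, ch'.testBit t = true ↔
      (t = b ∨ t = 36 + b) ∨ ∃ i ∈ is, t < 42 ∧ P.testBit (42 * (6 * i + p b i) + t) = true := by
  refine one_sound K P b (p b) is F k (h.p6 b hb) hF ?_ ?_ ho
  · refine h.nd.imp_of_mem ?_
    intro i i' hi hi' hne
    have a1 := h.is1 i hi
    have a2 := h.is1 i' hi'
    have a3 := h.p6 b hb i hi
    have a4 := h.p6 b hb i' hi'
    apply hK _ (by omega) _ (by omega)
    intro e
    exact hne (h.inj b hb i hi i' hi' (by omega))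
  · intro i hi
    have a1 := h.is1 i hi
    have a3 := h.p6 b hb i hi
    have a4 := h.b6 b hb
    have a5 := h.pb b hb i hi
    apply hK _ (by omega) _ (by omega)
    omega

theorem cls_cons (K P lo hi bad : ℕ) (is bs : List ℕ) (b F t : ℕ) :
    cls K P lo hi bad is (b :: bs) F t = one K P is b F fun ch =>
      frb (t + pop6 (Nat.shiftRight ch 36)) fun t' =>
      Nat.rec true (fun _ _ => frb (rmv F ch) fun F' => cls K P lo hi bad is bs F' t')
        (cut lo hi bad t' (List.length bs)) := rfl

theorem cls_sound {K P lo hi bad : ℕ} {s : ℕ → ℕ} {p : ℕ → ℕ → ℕ} {is bs : List ℕ}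
    (hK : KTab K) (hP : PTab P s) (hc : Cl p is bs)
    (hpw : bs.Pairwise fun b b' => ∀ i ∈ is, p b i ≠ p b' i) {F t : ℕ}
    (hF : ∀ b ∈ bs, ∀ i ∈ is, F.testBit (6 * i + p b i) = true)
    (hlo : ∀ b ∈ bs, lo ≤ cnt s p is b) (hhi : ∀ b ∈ bs, cnt s p is b ≤ hi)
    (h : cls K P lo hi bad is bs F t = true) :
    bad.testBit (t + (bs.map (cnt s p is)).sum) = false := by
  induction bs generalizing F t with
  | nil => exact absurd h (by simp [cls])
  | cons b bs ih =>
    rw [cls_cons] at h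
    rw [List.pairwise_cons] at hpw
    obtain ⟨ch, h1, hch⟩ := hc.one hK (b := b) (by simp) (hF b (by simp)) h
    rw [frb_eq, chosen_cnt hP hc.is1 (hc.p6 b (by simp)) (hc.b6 b (by simp)) hch] at h1
    rw [List.map_cons, List.sum_cons, ← Nat.add_assoc]
    rw [← Bool.not_eq_true]
    intro hbad
    have hsum : lo * bs.length ≤ (bs.map (cnt s p is)).sum ∧
        (bs.map (cnt s p is)).sum ≤ hi * bs.length := by
      have := List.card_nsmul_le_sum (bs.map (cnt s p is)) lo (by
        intro x hx
        obtain ⟨y, hy, rfl⟩ := List.mem_map.1 hx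
        exact hlo y (by simp [hy]))
      have h2 := List.sum_le_card_nsmul (bs.map (cnt s p is)) hi (by
        intro x hx
        obtain ⟨y, hy, rfl⟩ := List.mem_map.1 hx
        exact hhi y (by simp [hy]))
      simp only [List.length_map, smul_eq_mul] at this h2
      constructor
      · rw [Nat.mul_comm]; exact this
      · rw [Nat.mul_comm]; exact h2
    have hcut : cut lo hi bad (t + cnt s p is b) bs.length ≠ 0 := by
      intro h0
      have h2 : (cut lo hi bad (t + cnt s p is b) bs.length).testBit
          ((bs.map (cnt s p is)).sum - lo * bs.length) = true := by
        change ((bad >>> (t + cnt s p is b + lo * bs.length)) %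
          2 ^ ((hi - lo) * bs.length + 1)).testBit _ = true
        rw [Nat.testBit_mod_two_pow, Nat.testBit_shiftRight, Nat.sub_mul]
        rw [show t + cnt s p is b + lo * bs.length +
          ((bs.map (cnt s p is)).sum - lo * bs.length) = 
          t + cnt s p is b + (bs.map (cnt s p is)).sum by omega, hbad]
        simp only [Bool.and_true, decide_eq_true_eq]
        omega
      rw [h0] at h2
      simp at h2
    obtain ⟨c', hc'⟩ := Nat.exists_eq_succ_of_ne_zero hcut
    rw [hc'] at h1
    simp only [frb_eq] at h1
    have := ih (hc.sub fun x hx => by simp [hx]) hpw.2 (F := rmv F ch) (fun b' hb' i hi => by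
      refine chosen_low hP hc.is1 (hc.p6 b (by simp)) (hc.b6 b (by simp)) hch hi
        (hc.p6 b' (by simp [hb']) i hi) (fun e => hpw.1 b' hb' i hi e.symm)
        (hF b' (by simp [hb']) i hi)) (fun x hx => hlo x (by simp [hx]))
        (fun x hx => hhi x (by simp [hx])) h1
    rw [hbad] at this
    simp at this
end ROrth

namespace ROrth
open Finset Function

/-- Table of compatible cells for transversals. -/
def KTTab (K : ℕ) (s : ℕ → ℕ) : Prop :=
  ∀ q < 36, ∀ q' < 36, q % 6 ≠ q' % 6 → s q ≠ s q' → K.testBit (36 * q + q') = true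

theorem cnt_eq_image {P : ℕ} {s : ℕ → ℕ} (hP : PTab P s) {p : ℕ → ℕ → ℕ} {b : ℕ} (hb : b < 6)
    (hp : ∀ i ∈ [1, 2, 3, 4, 5], p b i < 6) :
    cnt s p [1, 2, 3, 4, 5] b =
      ((Finset.range 6).image fun i => if i = 0 then b else s (6 * i + p b i)).card := by
  unfold cnt
  congr 1
  ext v
  simp only [Finset.mem_filter, Finset.mem_range, Finset.mem_image]
  have hm : ∀ i, i ∈ [1, 2, 3, 4, 5] ↔ 1 ≤ i ∧ i < 6 := by
    intro i; simp only [List.mem_cons, List.not_mem_nil, or_false]; omega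
  constructor
  · rintro ⟨hv, h | ⟨i, hi, h⟩⟩
    · exact ⟨0, by norm_num, by simp [h]⟩
    · refine ⟨i, ((hm i).1 hi).2, ?_⟩
      rw [if_neg (by have := (hm i).1 hi; omega), h]
  · rintro ⟨i, hi, h⟩
    by_cases h0 : i = 0
    · rw [if_pos h0] at h
      exact ⟨by omega, Or.inl h.symm⟩
    · rw [if_neg h0] at h
      have hi' := (hm i).2 (by omega)
      have := hp i hi'
      have := (hP (6 * i + p b i) (by omega)).1
      exact ⟨by omega, Or.inr ⟨i, hi', h⟩⟩

theorem cnt_le (s : ℕ → ℕ) (p : ℕ → ℕ → ℕ) (is : List ℕ) (b : ℕ) : cnt s p is b ≤ 6 := by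
  unfold cnt
  exact (Finset.card_filter_le _ _).trans (by simp)

theorem cnt_pos (s : ℕ → ℕ) (p : ℕ → ℕ → ℕ) (is : List ℕ) (b : ℕ) (hb : b < 6) :
    1 ≤ cnt s p is b := by
  unfold cnt
  rw [Nat.succ_le_iff, Finset.card_pos]
  exact ⟨b, by simp [hb]⟩

theorem Cl.oneT {p : ℕ → ℕ → ℕ} {bs : List ℕ} (h : Cl p [1, 2, 3, 4, 5] bs) {K P F b : ℕ}
    {s : ℕ → ℕ} (hP : PTab P s) (hs : ∀ b < 6, s b = b)
    (hK : KTTab K s) (hb : b ∈ bs) {k : ℕ → Bool} (h6 : cnt s p [1, 2, 3, 4, 5] b = 6)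
    (hF : ∀ i ∈ [1, 2, 3, 4, 5], F.testBit (6 * i + p b i) = true)
    (ho : ROrth.one K P [1, 2, 3, 4, 5] b F k = true) :
    ∃ ch', k ch' = true ∧ ∀ t, ch'.testBit t = true ↔
      (t = b ∨ t = 36 + b) ∨ ∃ i ∈ [1, 2, 3, 4, 5], t < 42 ∧
        P.testBit (42 * (6 * i + p b i) + t) = true := by
  rw [cnt_eq_image hP (h.b6 b hb) (h.p6 b hb)] at h6
  have hinj := Finset.card_image_iff.1 (h6.trans (Finset.card_range 6).symm)
  refine one_sound K P b (p b) _ F k (h.p6 b hb) hF ?_ ?_ ho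
  · refine h.nd.imp_of_mem ?_
    intro i i' hi hi' hne
    have a1 := h.is1 i hi
    have a2 := h.is1 i' hi'
    have a3 := h.p6 b hb i hi
    have a4 := h.p6 b hb i' hi'
    apply hK _ (by omega) _ (by omega)
    · intro e
      exact hne (h.inj b hb i hi i' hi' (by omega))
    · intro e
      refine hne (hinj (by simp; omega) (by simp; omega) ?_)
      simp only
      rw [if_neg (by omega), if_neg (by omega), e]
  · intro i hi
    have a1 := h.is1 i hi
    have a3 := h.p6 b hb i hi
    have a4 := h.b6 b hb
    have a5 := h.pb b hb i hi
    apply hK _ (by omega) _ (by omega)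
    · omega
    · intro e
      rw [hs b a4] at e
      have : 0 = i := hinj (by simp) (by simp; omega) (by
        simp only
        rw [if_pos trivial, if_neg (by omega)]
        exact e)
      omega

theorem nest_nil (K KT P bad : ℕ) (is : List ℕ) (F : ℕ) (sk : List ℕ) (s : ℕ) :
    nest K KT P bad is [] F sk s = cond (Nat.ble s 2) (cls K P 1 5 bad is sk F (36 - 6 * s))
      (cls K P 5 5 bad is sk F 18) := rfl

theorem nest_cons (K KT P bad : ℕ) (is : List ℕ) (b : ℕ) (bs : List ℕ) (F : ℕ) (sk : List ℕ)
    (s : ℕ) : nest K KT P bad is (b :: bs) F sk s =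
      cond (one KT P is b F fun ch => frb (rmv F ch) fun F' => nest K KT P bad is bs F' sk s)
      (cond (Nat.ble s 2) (nest K KT P bad is bs F (b :: sk) (s + 1)) true) false := rfl

theorem nest_sound {K KT P bad : ℕ} {s : ℕ → ℕ} {p : ℕ → ℕ → ℕ} {bs sk : List ℕ}
    (hK : KTab K) (hKT : KTTab KT s) (hs : ∀ b < 6, s b = b) (hP : PTab P s)
    (hbad : ∀ r < 33, bad.testBit r = false)
    (hc : Cl p [1, 2, 3, 4, 5] (bs ++ sk))
    (hpw : (bs ++ sk).Pairwise fun b b' => ∀ i ∈ [1, 2, 3, 4, 5], p b i ≠ p b' i) {F : ℕ}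
    (hF : ∀ b ∈ bs ++ sk, ∀ i ∈ [1, 2, 3, 4, 5], F.testBit (6 * i + p b i) = true)
    (h5 : ∀ b ∈ sk, cnt s p [1, 2, 3, 4, 5] b ≤ 5) (hl : bs.length + sk.length ≤ 6)
    (hsk : sk.length ≤ 3)
    (h : nest K KT P bad [1, 2, 3, 4, 5] bs F sk sk.length = true) :
    bad.testBit (6 * (6 - bs.length - sk.length) +
      ((bs ++ sk).map (cnt s p [1, 2, 3, 4, 5])).sum) = false := by
  induction bs generalizing F sk with
  | nil =>
    rw [List.nil_append] at *
    rw [nest_nil] at h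
    simp only [List.length_nil, Nat.sub_zero]
    by_cases h2 : sk.length ≤ 2
    · rw [Nat.ble_eq_true_of_le h2, cond_true] at h
      have := cls_sound hK hP hc hpw hF (fun b hb => cnt_pos _ _ _ _ (hc.b6 b hb)) h5 h
      rwa [show 6 * (6 - sk.length) = 36 - 6 * sk.length by omega]
    · have h3 : sk.length = 3 := by omega
      rw [h3] at h ⊢
      have hb2 : Nat.ble 3 2 = false := rfl
      rw [hb2, cond_false] at h
      by_contra hb
      have hge : 33 ≤ 18 + (sk.map (cnt s p [1, 2, 3, 4, 5])).sum := by
        by_contra hlt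
        exact hb (hbad _ (by omega))
      match sk, h3 with
      | [x, y, z], _ =>
        have e1 := h5 x (by simp)
        have e2 := h5 y (by simp)
        have e3 := h5 z (by simp)
        simp only [List.map_cons, List.map_nil, List.sum_cons, List.sum_nil] at hge
        refine hb (cls_sound hK hP hc hpw hF (fun b hb => ?_) h5 h)
        simp only [List.mem_cons, List.not_mem_nil, or_false] at hb
        rcases hb with rfl | rfl | rfl <;> omega
  | cons b bs ih =>
    rw [nest_cons] at h
    have hc1 := cnt_le s p [1, 2, 3, 4, 5] b
    simp only [List.length_cons] at hl
    have hx : ∀ X Y : Bool, cond X Y false = true → X = true ∧ Y = true := by decide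
    obtain ⟨hX, hY⟩ := hx _ _ h
    rw [List.cons_append, List.map_cons, List.sum_cons]
    by_cases h6 : cnt s p [1, 2, 3, 4, 5] b = 6
    · obtain ⟨ch, h1, hch⟩ := hc.oneT hP hs hKT (b := b) (by simp) h6 (hF b (by simp)) hX
      rw [frb_eq] at h1
      rw [List.cons_append, List.pairwise_cons] at hpw
      have := ih (hc.sub fun x hx => by
        rw [List.cons_append]; exact List.mem_cons_of_mem _ hx) hpw.2 (F := rmv F ch)
        (fun b' hb' i hi => by
          have hb'' : b' ∈ b :: bs ++ sk := by
            rw [List.cons_append]; exact List.mem_cons_of_mem _ hb'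
          refine chosen_low hP hc.is1 (hc.p6 b (by simp)) (hc.b6 b (by simp)) hch hi
            (hc.p6 b' hb'' i hi) (fun e => hpw.1 b' hb' i hi e.symm)
            (hF b' hb'' i hi)) h5 (by omega) hsk h1
      rw [← this]
      congr 1
      simp only [List.length_cons]
      omega
    · by_cases h2 : sk.length ≤ 2
      · rw [Nat.ble_eq_true_of_le h2, cond_true] at hY
        have hper : (bs ++ b :: sk).Perm (b :: bs ++ sk) := by
          rw [List.cons_append]; exact List.perm_middle
        have := ih (sk := b :: sk) (hc.sub fun x hx => hper.mem_iff.1 hx)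
          ((hper.pairwise_iff (fun {x y} hxy i hi e => hxy i hi e.symm)).2 hpw) (F := F)
          (fun x hx => hF x (hper.mem_iff.1 hx))
          (fun x hx => by
            rcases List.mem_cons.1 hx with rfl | hx
            · omega
            · exact h5 x hx) (by simp only [List.length_cons]; omega)
            (by simp only [List.length_cons]; omega) hY
        rw [← this]
        congr 1
        have e := (hper.map (cnt s p [1, 2, 3, 4, 5])).sum_eq
        rw [e, List.cons_append, List.map_cons, List.sum_cons]
        simp only [List.length_cons]
        omega
      · apply hbad
        have e1 := List.sum_le_card_nsmul (bs.map (cnt s p [1, 2, 3, 4, 5])) 6 (by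
          intro x hx
          obtain ⟨y, hy, rfl⟩ := List.mem_map.1 hx
          exact cnt_le _ _ _ _)
        have e2 := List.sum_le_card_nsmul (sk.map (cnt s p [1, 2, 3, 4, 5])) 5 (by
          intro x hx
          obtain ⟨y, hy, rfl⟩ := List.mem_map.1 hx
          exact h5 y hy)
        simp only [List.length_map, smul_eq_mul] at e1 e2
        rw [List.map_append, List.sum_append]
        simp only [List.length_cons]
        omega

/-! ### Tables -/

theorem bld_succ (s : ℕ) (f : ℕ → ℕ) (m : ℕ) :
    bld s f (m + 1) = bld s f m ||| (f m <<< (s * m)) := rfl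

theorem bld_bit (s : ℕ) (f : ℕ → ℕ) (m x : ℕ) : (bld s f m).testBit x = true ↔
    ∃ q < m, s * q ≤ x ∧ (f q).testBit (x - s * q) = true := by
  induction m with
  | zero => 
    have : bld s f 0 = 0 := rfl
    simp [this]
  | succ m ih =>
    rw [bld_succ, Nat.testBit_or, Bool.or_eq_true, ih, Nat.testBit_shiftLeft]
    simp only [ge_iff_le, Bool.and_eq_true, decide_eq_true_eq]
    constructor
    · rintro (⟨q, h1, h2⟩ | h)
      · exact ⟨q, by omega, h2⟩
      · exact ⟨m, by omega, h⟩
    · rintro ⟨q, h1, h2⟩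
      rcases Nat.lt_succ_iff_lt_or_eq.1 h1 with h | rfl
      · exact Or.inl ⟨q, h, h2⟩
      · exact Or.inr h2

theorem kr_bit : ∀ a < 6, ∀ q < 36, a ≠ q % 6 → (kr a).testBit q = true := by decide +kernel

theorem kr_mod (q : ℕ) : kr q = kr (q % 6) := by
  have : ∀ x, kr x = Nat.xor (Nat.sub (Nat.pow 2 36) 1) (colm (x % 6)) := fun _ => rfl
  rw [this, this, Nat.mod_mod]

theorem ktab_kr : KTab (bld 36 kr 36) := by
  intro q hq q' hq' hne
  rw [bld_bit]
  refine ⟨q, hq, by omega, ?_⟩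
  rw [Nat.add_sub_cancel_left, kr_mod]
  exact kr_bit _ (Nat.mod_lt _ (by norm_num)) _ hq' hne

theorem pl_bit (w q t : ℕ) : (pl w q).testBit t = true ↔ t = q ∨ t = 36 + en3 w 0 q := by
  change (2 ^ q ||| 2 ^ (36 + en3 w 0 q)).testBit t = true ↔ _
  rw [Nat.testBit_or, Nat.testBit_two_pow, Nat.testBit_two_pow]
  simp only [Bool.or_eq_true, decide_eq_true_eq]
  rw [eq_comm, @eq_comm _ (36 + _)]

theorem ptab_pl {w : ℕ} (hw : ∀ q < 36, en3 w 0 q < 6) : PTab (bld 42 (pl w) 36) (en3 w 0) := by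
  intro q hq
  refine ⟨hw q hq, fun t ht => ?_⟩
  rw [bld_bit]
  constructor
  · rintro ⟨q', h1, h2, h3⟩
    rw [pl_bit] at h3
    have := hw q' h1
    have e : q' = q := by omega
    subst e
    rw [Nat.add_sub_cancel_left] at h3
    exact h3
  · intro h
    refine ⟨q, hq, by omega, ?_⟩
    rw [Nat.add_sub_cancel_left, pl_bit]
    exact h

theorem sm_succ (w m : ℕ) : sm w (m + 1) = sm w m ||| 2 ^ (36 * en3 w 0 m + m) := rfl

theorem sm_bit (w m x : ℕ) : (sm w m).testBit x = true ↔ ∃ q < m, x = 36 * en3 w 0 q + q := by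
  induction m with
  | zero =>
    have : sm w 0 = 0 := rfl
    simp [this]
  | succ m ih =>
    rw [sm_succ, Nat.testBit_or, Bool.or_eq_true, ih, Nat.testBit_two_pow, decide_eq_true_eq]
    constructor
    · rintro (⟨q, h1, h2⟩ | h)
      · exact ⟨q, by omega, h2⟩
      · exact ⟨m, by omega, h.symm⟩
    · rintro ⟨q, h1, h2⟩
      rcases Nat.lt_succ_iff_lt_or_eq.1 h1 with h | rfl
      · exact Or.inl ⟨q, h, h2⟩
      · exact Or.inr h2.symm

theorem kttab_kt (w : ℕ) : KTTab (bld 36 (kt (sm w 36) w) 36) (en3 w 0) := by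
  intro q hq q' hq' hne hs
  rw [bld_bit]
  refine ⟨q, hq, by omega, ?_⟩
  rw [Nat.add_sub_cancel_left]
  change (kr q &&& ((2 ^ 36 - 1) ^^^ ((sm w 36 >>> (36 * en3 w 0 q)) % 2 ^ 36))).testBit q' = true
  rw [Nat.testBit_and, Nat.testBit_xor, Nat.testBit_two_pow_sub_one, Nat.testBit_mod_two_pow,
    Nat.testBit_shiftRight, kr_mod, kr_bit _ (Nat.mod_lt _ (by norm_num)) _ hq' hne]
  have : (sm w 36).testBit (36 * en3 w 0 q + q') = false := by
    rw [← Bool.not_eq_true, sm_bit]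
    rintro ⟨x, hx, h⟩
    have e : x = q' := by omega
    subst e
    omega
  rw [this]
  simp [hq']

theorem cells_bit {n i j : ℕ} (hn : n ≤ 6) (hi : i < n) (hj : j < n) :
    (cells n).testBit (6 * i + j) = true := by
  unfold cells
  rw [bld_bit]
  refine ⟨i, hi, by omega, ?_⟩
  rw [Nat.add_sub_cancel_left]
  change (2 ^ n - 1).testBit j = true
  rw [Nat.testBit_two_pow_sub_one]
  simpa using hj
end ROrth

namespace ROrth
open Finset Function

theorem typ_eq (n : ℕ) (f : ℕ → ℕ) : typ n f = ∑ j ∈ Finset.range n,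
    ((if f (f j) = j then 1 else 0) + if f (f (f j)) = j then 7 else 0) := by
  have hc : ∀ a b c : ℕ, cond (Nat.beq a b) c 0 = if a = b then c else 0 := by
    intro a b c
    by_cases h : a = b
    · rw [if_pos h, h, Nat.beq_refl, cond_true]
    · rw [if_neg h, show Nat.beq a b = false from by
        rw [← Bool.not_eq_true]; exact fun h' => h (Nat.eq_of_beq_eq_true h'), cond_false]
  induction n with
  | zero => rfl
  | succ n ih =>
    rw [Finset.sum_range_succ, ← ih, ← hc, ← hc]
    rfl

theorem typ_congr {n : ℕ} {f g : ℕ → ℕ} (h : ∀ j < n, f j = g j) (hg : ∀ j < n, g j < n) :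
    typ n f = typ n g := by
  rw [typ_eq, typ_eq]
  apply Finset.sum_congr rfl
  intro j hj
  rw [Finset.mem_range] at hj
  have h1 := hg j hj
  have h2 := hg _ h1
  rw [h j hj, h _ h1, h _ h2]

/-- A normalized pair of squares. -/
structure Nrm (n : ℕ) (c : ℕ → ℕ) (A B : ℕ → ℕ → ℕ) : Prop where
  la : FLat n A
  lb : FLat n B
  r0 : ∀ j < n, A 0 j = j
  c0 : ∀ i < n, A i 0 = i
  r1 : ∀ j < n, A 1 j = c j
  b0 : ∀ j < n, B 0 j = j
  ty : ∀ i, i + 1 < n → typ n c ≤ typ n (A (i + 1))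

theorem aopt_bit (i j v t : ℕ) : (aopt i j v).1.testBit t = true ↔
    t = 6 * j + v ∨ t = 36 + (6 * i + v) := by
  unfold aopt
  rw [Nat.testBit_or, Nat.testBit_two_pow, Nat.testBit_two_pow]
  simp only [Bool.or_eq_true, decide_eq_true_eq]
  rw [eq_comm, @eq_comm _ (36 + _)]

theorem en3_bit (w i j b : ℕ) : (en3 w i j).testBit b = true ↔
    b < 3 ∧ w.testBit (3 * (6 * i + j) + b) = true := by
  change ((w >>> (3 * (6 * i + j))) % 2 ^ 3).testBit b = true ↔ _
  rw [Nat.testBit_mod_two_pow, Nat.testBit_shiftRight]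
  simp

theorem Nrm.dfs {n : ℕ} {c : ℕ → ℕ} {A B : ℕ → ℕ → ℕ} (h : Nrm n c A B) (hn : n ≤ 6)
    (hn2 : 2 ≤ n) {k : ℕ → Bool} (hd : dfs (alists n c) 0 0 k = true) :
    ∃ w, k w = true ∧ (∀ i < n, ∀ j < n, en3 w i j = A i j) ∧ ∀ q < 36, en3 w 0 q < 6 := by
  have hdm : ∀ q < n * n, q / n < n ∧ q % n < n := fun q hq =>
    ⟨Nat.div_lt_of_lt_mul hq, Nat.mod_lt _ (by omega)⟩
  obtain ⟨w, hw, hb⟩ := dfs_sound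
    (fun q => (allowed n c (q / n) (q % n)).map (aopt (q / n) (q % n)))
    (fun q => aopt (q / n) (q % n) (A (q / n) (q % n))) (List.range (n * n)) k 0 0
    (fun q hq => by
      obtain ⟨hi, hj⟩ := hdm q (List.mem_range.1 hq)
      apply List.mem_map_of_mem
      generalize q / n = i at *
      generalize q % n = j at *
      match i, j with
      | 0, j => simp [allowed, h.r0 j hj]
      | i + 1, 0 => simp [allowed, h.c0 _ hi]
      | 1, j + 1 => simp [allowed, h.r1 _ hj]
      | i + 2, j + 1 =>
        have := h.la.lt _ hi _ hj
        simpa [allowed] using this)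
    (fun q hq => by simp)
    (by
      refine List.nodup_range.imp_of_mem ?_
      intro q q' hq hq' hne
      obtain ⟨hi, hj⟩ := hdm q (List.mem_range.1 hq)
      obtain ⟨hi', hj'⟩ := hdm q' (List.mem_range.1 hq')
      have e1 := Nat.div_add_mod q n
      have e2 := Nat.div_add_mod q' n
      generalize q / n = i at *
      generalize q % n = j at *
      generalize q' / n = i' at *
      generalize q' % n = j' at *
      have v1 := h.la.lt i hi j hj
      have v2 := h.la.lt i' hi' j' hj'
      apply Nat.eq_of_testBit_eq
      intro t
      rw [Nat.zero_testBit, ← Bool.not_eq_true, Nat.testBit_and, Bool.and_eq_true, aopt_bit,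
        aopt_bit]
      rintro ⟨h1 | h1, h2 | h2⟩
      · have e3 : j = j' := by omega
        subst e3
        have e4 : i = i' := h.la.col j hj i hi i' hi' (by omega)
        subst e4
        omega
      · omega
      · omega
      · have e3 : i = i' := by omega
        subst e3
        have e4 : j = j' := h.la.row i hi j hj j' hj' (by omega)
        subst e4
        omega) hd
  have hbit : ∀ t, w.testBit t = true ↔ ∃ i < n, ∃ j < n,
      3 * (6 * i + j) ≤ t ∧ (A i j).testBit (t - 3 * (6 * i + j)) = true := by
    intro t
    rw [hb]
    simp only [Nat.zero_testBit, Bool.false_eq_true, false_or, aopt, Nat.testBit_shiftLeft,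
      Bool.and_eq_true, decide_eq_true_eq, List.mem_range]
    constructor
    · rintro ⟨q, hq, h1⟩
      exact ⟨q / n, (hdm q hq).1, q % n, (hdm q hq).2, h1⟩
    · rintro ⟨i, hi, j, hj, h1⟩
      have e1 : (n * i + j) / n = i := by
        rw [Nat.mul_add_div (by omega), Nat.div_eq_of_lt hj, Nat.add_zero]
      have e2 : (n * i + j) % n = j := by
        rw [Nat.mul_add_mod, Nat.mod_eq_of_lt hj]
      refine ⟨n * i + j, ?_, ?_⟩
      · nlinarith
      · rw [e1, e2]; exact h1
  have hA3 : ∀ i < n, ∀ j < n, ∀ x, (A i j).testBit x = true → x < 3 := by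
    intro i hi j hj x hx
    have h1 := h.la.lt i hi j hj
    have h2 := Nat.ge_two_pow_of_testBit hx
    by_contra h3
    have : 2 ^ 3 ≤ 2 ^ x := Nat.pow_le_pow_right (by norm_num) (by omega)
    omega
  have hval : ∀ i < n, ∀ j < n, en3 w i j = A i j := by
    intro i hi j hj
    apply Nat.eq_of_testBit_eq
    intro x
    rw [Bool.eq_iff_iff, en3_bit, hbit]
    constructor
    · rintro ⟨hx, i', hi', j', hj', h1, h2⟩
      have h3 := hA3 i' hi' j' hj' _ h2
      have e1 : i' = i := by omega
      have e2 : j' = j := by omega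
      subst e1 e2
      rwa [Nat.add_sub_cancel_left] at h2
    · intro hx
      exact ⟨hA3 i hi j hj x hx, i, hi, j, hj, by omega, by rwa [Nat.add_sub_cancel_left]⟩
  refine ⟨w, hw, hval, fun q hq => ?_⟩
  have hq2 : en3 w 0 q = en3 w (q / 6) (q % 6) := by
    unfold en3
    congr 3
    simp only [Nat.mul_zero, Nat.add_eq, Nat.mul_eq, Nat.zero_add]
    omega
  by_cases hc : q / 6 < n ∧ q % 6 < n
  · rw [hq2, hval _ hc.1 _ hc.2]
    have := h.la.lt _ hc.1 _ hc.2
    omega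
  · have : en3 w 0 q = 0 := by
      apply Nat.eq_of_testBit_eq
      intro x
      rw [Nat.zero_testBit, ← Bool.not_eq_true, en3_bit, hbit]
      rintro ⟨hx, i', hi', j', hj', h1, h2⟩
      have h3 := hA3 i' hi' j' hj' _ h2
      omega
    omega

/-- The number of pairs. -/
def pc (n : ℕ) (A B : ℕ → ℕ → ℕ) : ℕ :=
  ((Finset.range n ×ˢ Finset.range n).image fun q => (A q.1 q.2, B q.1 q.2)).card

theorem FLat.surj {n : ℕ} {B : ℕ → ℕ → ℕ} (h : FLat n B) {i b : ℕ} (hi : i < n) (hb : b < n) :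
    ∃ j < n, B i j = b := by
  have hinj : Set.InjOn (B i) (Finset.range n) := by
    intro x hx y hy hxy
    exact h.row i hi x (by simpa using hx) y (by simpa using hy) hxy
  have := Finset.surjOn_of_injOn_of_card_le (s := Finset.range n) (t := Finset.range n) (B i)
    (fun x hx => by
      have : x < n := by simpa using hx
      simpa using h.lt i hi x this) hinj le_rfl
  obtain ⟨j, hj, e⟩ := this (show b ∈ (↑(Finset.range n) : Set ℕ) by simpa using hb)
  exact ⟨j, by simpa using hj, e⟩

theorem mem_is {n i : ℕ} (hn : 2 ≤ n) : i ∈ List.range' 1 (n - 1) ↔ 1 ≤ i ∧ i < n := by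
  rw [List.mem_range'_1]; omega

theorem Nrm.cl {n : ℕ} {c : ℕ → ℕ} {A B : ℕ → ℕ → ℕ} (h : Nrm n c A B) (hn : n ≤ 6)
    (hn2 : 2 ≤ n) (s : ℕ → ℕ) (hs : ∀ i < n, ∀ j < n, s (6 * i + j) = A i j) : ∃ p : ℕ → ℕ → ℕ,
    Cl p (List.range' 1 (n - 1)) (List.range n) ∧
    ((List.range n).Pairwise fun b b' => ∀ i ∈ List.range' 1 (n - 1), p b i ≠ p b' i) ∧
    (∀ b ∈ List.range n, ∀ i ∈ List.range' 1 (n - 1), (cells n).testBit (6 * i + p b i) = true) ∧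
    (∀ b ∈ List.range n, cnt s p (List.range' 1 (n - 1)) b ≤ n) ∧
    pc n A B = ((List.range n).map (cnt s p (List.range' 1 (n - 1)))).sum := by
  have hex : ∀ b i, ∃ j, b < n → i < n → j < n ∧ B i j = b := by
    intro b i
    by_cases hb : b < n
    · by_cases hi : i < n
      · obtain ⟨j, hj, e⟩ := h.lb.surj hi hb
        exact ⟨j, fun _ _ => ⟨hj, e⟩⟩
      · exact ⟨0, fun _ h => absurd h hi⟩
    · exact ⟨0, fun h => absurd h hb⟩
  choose p hp using hex
  have hp0 : ∀ b < n, p b 0 = b := by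
    intro b hb
    obtain ⟨h1, h2⟩ := hp b 0 hb (by omega)
    rw [h.b0 _ h1] at h2
    exact h2
  have hcnt : ∀ b < n, cnt s p (List.range' 1 (n - 1)) b =
      ((Finset.range n).image fun i => A i (p b i)).card := by
    intro b hb
    unfold cnt
    congr 1
    ext v
    simp only [Finset.mem_filter, Finset.mem_range, Finset.mem_image, mem_is hn2]
    constructor
    · rintro ⟨hv, rfl | ⟨i, hi, e⟩⟩
      · exact ⟨0, by omega, by rw [hp0 v hb, h.r0 _ hb]⟩
      · refine ⟨i, hi.2, ?_⟩
        rw [← e, hs i hi.2 _ (hp b i hb hi.2).1]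
    · rintro ⟨i, hi, rfl⟩
      obtain ⟨h1, h2⟩ := hp b i hb hi
      have := h.la.lt i hi _ h1
      refine ⟨by omega, ?_⟩
      by_cases h0 : i = 0
      · left; subst h0; rw [hp0 b hb, h.r0 _ hb]
      · right; exact ⟨i, by omega, hs i hi _ h1⟩
  refine ⟨p, ⟨?_, ?_, ?_, ?_, ?_, ?_⟩, ?_, ?_, ?_, ?_⟩
  · intro i hi; rw [mem_is hn2] at hi; omega
  · exact List.nodup_range'
  · intro b hb; rw [List.mem_range] at hb; omega
  · intro b hb i hi
    rw [List.mem_range] at hb; rw [mem_is hn2] at hi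
    have := (hp b i hb hi.2).1
    omega
  · intro b hb i hi e
    rw [List.mem_range] at hb; rw [mem_is hn2] at hi
    have := (hp b i hb hi.2)
    rw [e] at this
    have h1 : i = 0 := h.lb.col b hb i hi.2 0 (by omega) (by rw [this.2, h.b0 b hb])
    omega
  · intro b hb i hi i' hi' e
    rw [List.mem_range] at hb; rw [mem_is hn2] at hi hi'
    have h1 := (hp b i hb hi.2)
    have h2 := (hp b i' hb hi'.2)
    rw [← e] at h2
    exact h.lb.col _ h1.1 i hi.2 i' hi'.2 (by rw [h1.2, h2.2])
  · refine List.nodup_range.imp_of_mem ?_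
    intro b b' hb hb' hne i hi e
    rw [List.mem_range] at hb hb'; rw [mem_is hn2] at hi
    apply hne
    rw [← (hp b i hb hi.2).2, e, (hp b' i hb' hi.2).2]
  · intro b hb i hi
    rw [List.mem_range] at hb; rw [mem_is hn2] at hi
    exact cells_bit hn hi.2 (hp b i hb hi.2).1
  · intro b hb
    rw [List.mem_range] at hb
    rw [hcnt b hb]
    exact Finset.card_image_le.trans (by simp)
  · have e1 : ((List.range n).map (cnt s p (List.range' 1 (n - 1)))).sum =
        ∑ b ∈ Finset.range n, cnt s p (List.range' 1 (n - 1)) b := by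
      rw [Finset.sum_range, ← List.sum_ofFn]
      congr 1
      rw [List.ofFn_eq_map, ← List.map_coe_finRange_eq_range, List.map_map]
      rfl
    rw [e1]
    unfold pc
    rw [Finset.card_eq_sum_card_fiberwise (f := Prod.snd) (t := Finset.range n)]
    · apply Finset.sum_congr rfl
      intro b hb
      rw [Finset.mem_range] at hb
      rw [hcnt b hb]
      rw [← Finset.card_map (⟨fun v => (v, b), fun x y e => (Prod.mk.inj e).1⟩ : ℕ ↪ ℕ × ℕ)]
      congr 1
      ext ⟨x, y⟩
      simp only [Finset.mem_filter, Finset.mem_image, Finset.mem_product, Finset.mem_range,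
        Finset.mem_map, Prod.mk.injEq, Prod.exists]
      constructor
      · rintro ⟨⟨i, j, ⟨hi, hj⟩, e1, e2⟩, e3⟩
        obtain ⟨h1, h2⟩ := hp b i hb hi
        have : p b i = j := h.lb.row i hi _ h1 _ hj (by rw [h2, e2, e3])
        exact ⟨x, ⟨i, hi, by rw [this, e1]⟩, by rw [← e3]; rfl⟩
      · rintro ⟨v, ⟨i, hi, e⟩, e'⟩
        obtain ⟨rfl, rfl⟩ := Prod.mk.inj e'
        obtain ⟨h1, h2⟩ := hp b i hb hi
        exact ⟨⟨i, p b i, ⟨hi, h1⟩, e, h2⟩, rfl⟩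
    · intro x hx
      simp only [Finset.coe_image, Finset.coe_product, Finset.coe_range, Set.mem_image,
        Set.mem_prod, Set.mem_Iio, Prod.exists] at hx
      obtain ⟨i, j, ⟨hi, hj⟩, rfl⟩ := hx
      simpa using h.lb.lt i hi j hj

theorem good_of {n w : ℕ} {c : ℕ → ℕ} {A B : ℕ → ℕ → ℕ} (h : Nrm n c A B)
    (hw : ∀ i < n, ∀ j < n, en3 w i j = A i j) : good n (typ n c) w = true := by
  unfold good
  rw [allB_iff]
  intro i hi
  apply Nat.ble_eq_true_of_le
  have e := typ_congr (hw (i + 1) (by omega)) (h.la.lt (i + 1) (by omega))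
  change _ ≤ typ n fun j => en3 w (i + 1) j
  rw [e]
  exact h.ty i (by omega)

theorem en3_zero (w i j : ℕ) : en3 w 0 (6 * i + j) = en3 w i j := by
  unfold en3
  congr 3
  simp

theorem search_sound {n bad : ℕ} {c : ℕ → ℕ} {A B : ℕ → ℕ → ℕ} (h : Nrm n c A B) (hn : n ≤ 6)
    (hn2 : 2 ≤ n) (hs : search n bad (List.range n) (List.range' 1 (n - 1)) c = true) :
    bad.testBit (pc n A B) = false := by
  unfold search at hs
  rw [foll_eq, frb_eq, frb_eq] at hs
  obtain ⟨w, hk, hw, h6⟩ := h.dfs hn hn2 hs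
  rw [good_of h hw, cond_true, frb_eq] at hk
  obtain ⟨p, h1, h2, h3, h4, h5⟩ := h.cl hn hn2 (en3 w 0) (fun i hi j hj => by
    rw [en3_zero, hw i hi j hj])
  have := cls_sound ktab_kr (ptab_pl h6) h1 h2 h3 (fun b hb => cnt_pos _ _ _ _ (h1.b6 b hb)) h4 hk
  rwa [Nat.zero_add, ← h5] at this

theorem search6_sound {bad : ℕ} {c : ℕ → ℕ} {A B : ℕ → ℕ → ℕ} (h : Nrm 6 c A B)
    (hbad : ∀ r < 33, bad.testBit r = false)
    (hs : search6 bad [0, 1, 2, 3, 4, 5] [1, 2, 3, 4, 5] c = true) :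
    bad.testBit (pc 6 A B) = false := by
  unfold search6 at hs
  rw [foll_eq, frb_eq, frb_eq] at hs
  obtain ⟨w, hk, hw, h6⟩ := h.dfs le_rfl (by norm_num) hs
  rw [good_of h hw, cond_true, frb_eq, frb_eq, frb_eq] at hk
  obtain ⟨p, h1, h2, h3, h4, h5⟩ := h.cl le_rfl (by norm_num) (en3 w 0) (fun i hi j hj => by
    rw [en3_zero, hw i hi j hj])
  have e1 : List.range 6 = [0, 1, 2, 3, 4, 5] := rfl
  have e2 : List.range' 1 (6 - 1) = [1, 2, 3, 4, 5] := rfl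
  rw [e1, e2] at h1 h2 h3 h5
  have hs0 : ∀ b < 6, en3 w 0 b = b := by
    intro b hb
    rw [hw 0 (by norm_num) b hb, h.r0 b hb]
  have := nest_sound (bs := [0, 1, 2, 3, 4, 5]) (sk := []) ktab_kr (kttab_kt w) hs0 (ptab_pl h6)
    hbad (by rw [List.append_nil]; exact h1) (by rw [List.append_nil]; exact h2) (F := cells 6)
    (by rw [List.append_nil]; exact h3)
    (by simp) (by simp) (by simp) hk
  rw [List.append_nil, ← h5] at this
  simpa using this
end ROrth

namespace ROrth
open Finset Function

/-! ### Normalization -/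

/-- The type of a permutation. -/
def tp {n : ℕ} (σ : Equiv.Perm (Fin n)) : ℕ :=
  ∑ j, ((if σ (σ j) = j then 1 else 0) + if σ (σ (σ j)) = j then 7 else 0)

theorem tp_conj {n : ℕ} (σ g : Equiv.Perm (Fin n)) : tp (g * σ * g⁻¹) = tp σ := by
  unfold tp
  rw [← Equiv.sum_comp g]
  apply Finset.sum_congr rfl
  intro j _
  simp

/-- Natural number version of a square. -/
def nsq {n : ℕ} (A : Fin n → Fin n → Fin n) (i j : ℕ) : ℕ :=
  if h : i < n ∧ j < n then A ⟨i, h.1⟩ ⟨j, h.2⟩ else 0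

theorem nsq_eq {n : ℕ} (A : Fin n → Fin n → Fin n) {i j : ℕ} (hi : i < n) (hj : j < n) :
    nsq A i j = A ⟨i, hi⟩ ⟨j, hj⟩ := by
  unfold nsq
  rw [dif_pos ⟨hi, hj⟩]

theorem nsq_flat {n : ℕ} {A : Fin n → Fin n → Fin n} (h : LatT A) : FLat n (nsq A) := by
  refine ⟨fun i hi j hj => ?_, fun i hi j hj j' hj' e => ?_, fun j hj i hi i' hi' e => ?_⟩
  · rw [nsq_eq A hi hj]; exact Fin.is_lt _
  · rw [nsq_eq A hi hj, nsq_eq A hi hj'] at e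
    exact Fin.mk.inj (h.1 _ (Fin.ext e))
  · rw [nsq_eq A hi hj, nsq_eq A hi' hj] at e
    exact Fin.mk.inj (h.2 _ (Fin.ext e))

theorem nsq_pc {n : ℕ} (A B : Fin n → Fin n → Fin n) : pc n (nsq A) (nsq B) = (prs A B).card := by
  unfold pc
  rw [← Finset.card_map (⟨fun v : Fin n × Fin n => ((v.1 : ℕ), (v.2 : ℕ)), fun x y e => by
    obtain ⟨e1, e2⟩ := Prod.mk.inj e
    exact Prod.ext (Fin.ext e1) (Fin.ext e2)⟩ : Fin n × Fin n ↪ ℕ × ℕ)]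
  congr 1
  ext ⟨x, y⟩
  simp only [Finset.mem_image, Finset.mem_product, Finset.mem_range, Finset.mem_map, prs,
    Prod.exists, Prod.mk.injEq, Finset.mem_univ, true_and]
  constructor
  · rintro ⟨i, j, ⟨hi, hj⟩, e1, e2⟩
    rw [nsq_eq A hi hj] at e1
    rw [nsq_eq B hi hj] at e2
    exact ⟨_, _, ⟨⟨i, hi⟩, ⟨j, hj⟩, rfl, rfl⟩, Prod.ext e1 e2⟩
  · rintro ⟨_, _, ⟨i, j, rfl, rfl⟩, e⟩
    obtain ⟨e1, e2⟩ := Prod.mk.inj e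
    refine ⟨i, j, ⟨i.2, j.2⟩, ?_, ?_⟩
    · rw [nsq_eq A i.2 j.2]; exact e1
    · rw [nsq_eq B i.2 j.2]; exact e2

theorem typ_tp {n : ℕ} (σ : Equiv.Perm (Fin n)) (f : ℕ → ℕ) (h : ∀ j : Fin n, f j = σ j) :
    typ n f = tp σ := by
  rw [typ_eq, Finset.sum_range]
  unfold tp
  apply Finset.sum_congr rfl
  intro j _
  simp only [h, Fin.val_inj]

theorem prs_card_comp {n : ℕ} {A B : Fin n → Fin n → Fin n} (ρ m g h : Equiv.Perm (Fin n)) :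
    (prs (fun i j => g (A (ρ i) (m j))) (fun i j => h (B (ρ i) (m j)))).card = (prs A B).card := by
  have : prs (fun i j => g (A (ρ i) (m j))) (fun i j => h (B (ρ i) (m j)))
      = (prs A B).image (Prod.map g h) := by
    ext ⟨x, y⟩
    simp only [prs, mem_image, mem_univ, true_and, Prod.exists, Prod.map, Prod.mk.injEq]
    constructor
    · rintro ⟨a, b, h1, h2⟩
      exact ⟨_, _, ⟨ρ a, m b, rfl, rfl⟩, h1, h2⟩
    · rintro ⟨a, b, ⟨c, d, rfl, rfl⟩, h1, h2⟩
      exact ⟨ρ.symm c, m.symm d, by simpa using h1, by simpa using h2⟩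
  rw [this, card_image_of_injective _ (g.injective.prodMap h.injective)]

theorem LatT.comp {n : ℕ} {A : Fin n → Fin n → Fin n} (hA : LatT A) (ρ m g : Equiv.Perm (Fin n)) :
    LatT fun i j => g (A (ρ i) (m j)) :=
  ⟨fun _ => g.injective.comp ((hA.1 _).comp m.injective),
    fun j => g.injective.comp ((hA.2 (m j)).comp ρ.injective)⟩

/-- A permutation from an injective map. -/
noncomputable def ofInj {n : ℕ} (f : Fin n → Fin n) (h : Injective f) : Equiv.Perm (Fin n) :=
  Equiv.ofBijective f (Finite.injective_iff_bijective.1 h)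

theorem ofInj_apply {n : ℕ} (f : Fin n → Fin n) (h : Injective f) (x : Fin n) :
    ofInj f h x = f x := rfl

theorem normalize {n : ℕ} (hn : 2 ≤ n) {A B : Fin n → Fin n → Fin n} (hA : LatT A) (hB : LatT B) :
    ∃ σ : Equiv.Perm (Fin n), (∀ x, σ x ≠ x) ∧ ∀ τ : Equiv.Perm (Fin n), IsConj σ τ →
      ((τ ⟨0, by omega⟩ : Fin n) : ℕ) = 1 → ∃ A' B' : ℕ → ℕ → ℕ,
      (∀ c : ℕ → ℕ, (∀ j : Fin n, c j = τ j) → Nrm n c A' B') ∧ pc n A' B' = (prs A B).card := by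
  let R : Fin n → Equiv.Perm (Fin n) := fun i => ofInj (A i) (hA.1 i)
  have hR : ∀ i j, R i j = A i j := fun _ _ => rfl
  let T : Finset (Fin n × Fin n) := Finset.univ.filter fun x => x.1 ≠ x.2
  have hT : T.Nonempty := ⟨(⟨0, by omega⟩, ⟨1, by omega⟩), by simp [T]⟩
  obtain ⟨⟨i0, i1⟩, hmem, hmin⟩ := Finset.exists_min_image T (fun x => tp (R x.2 * (R x.1)⁻¹)) hT
  have hne : i0 ≠ i1 := by simpa [T] using hmem
  refine ⟨R i1 * (R i0)⁻¹, ?_, ?_⟩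
  · intro x hx
    apply hne
    apply hA.2 ((R i0)⁻¹ x)
    change A i0 ((R i0)⁻¹ x) = A i1 ((R i0)⁻¹ x)
    rw [← hR, ← hR]
    have : R i0 ((R i0)⁻¹ x) = x := by simp
    rw [this]
    exact hx.symm
  · intro τ hconj h01
    obtain ⟨g, hg⟩ := isConj_iff.1 hconj
    let m : Equiv.Perm (Fin n) := (R i0)⁻¹ * g⁻¹
    let z : Fin n := ⟨0, by omega⟩
    let κ : Equiv.Perm (Fin n) := ofInj (fun x => g (A x (m z)))
      (g.injective.comp (hA.2 (m z)))
    have hκ0 : κ i0 = z := by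
      change g (R i0 ((R i0)⁻¹ (g⁻¹ z))) = z
      simp
    have hκ1 : κ i1 = τ z := by
      rw [← hg]; rfl
    let ρ : Equiv.Perm (Fin n) := κ⁻¹
    have hρ0 : ρ z = i0 := by
      change κ⁻¹ z = i0
      rw [← hκ0]; simp
    have hρ1 : ρ (τ z) = i1 := by
      change κ⁻¹ (τ z) = i1
      rw [← hκ1]; simp
    let h' : Equiv.Perm (Fin n) := (ofInj (fun j => B i0 (m j)) ((hB.1 i0).comp m.injective))⁻¹
    have hh : ∀ j, h' (B i0 (m j)) = j := by
      intro j
      have : B i0 (m j) = ofInj (fun j => B i0 (m j)) ((hB.1 i0).comp m.injective) j := rfl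
      rw [this]
      simp [h']
    have hrow : ∀ i j, g (A (ρ i) (m j)) = (g * (R (ρ i) * (R i0)⁻¹) * g⁻¹) j := fun i j => rfl
    refine ⟨nsq fun i j => g (A (ρ i) (m j)), nsq fun i j => h' (B (ρ i) (m j)), fun c hc => ?_,
      ?_⟩
    · have hn0 : 0 < n := by omega
      have hn1 : 1 < n := by omega
      refine ⟨nsq_flat (hA.comp ρ m g), nsq_flat (hB.comp ρ m h'), ?_, ?_, ?_, ?_, ?_⟩
      · intro j hj
        rw [nsq_eq _ hn0 hj]
        change (g (A (ρ z) (m ⟨j, hj⟩)) : ℕ) = j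
        rw [hrow, hρ0]
        simp
      · intro i hi
        rw [nsq_eq _ hi hn0]
        change (κ (κ⁻¹ ⟨i, hi⟩) : ℕ) = i
        simp
      · intro j hj
        rw [nsq_eq _ hn1 hj, hc ⟨j, hj⟩]
        have : (⟨1, hn1⟩ : Fin n) = τ z := Fin.ext h01.symm
        rw [this, hrow, hρ1, hg]
      · intro j hj
        rw [nsq_eq _ hn0 hj]
        change (h' (B (ρ z) (m ⟨j, hj⟩)) : ℕ) = j
        rw [hρ0, hh]
      · intro i hi
        rw [typ_tp τ c hc, ← hg, tp_conj]
        rw [typ_tp (g * (R (ρ ⟨i + 1, hi⟩) * (R i0)⁻¹) * g⁻¹) _ (fun j => by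
          rw [nsq_eq _ hi j.2, hrow]), tp_conj]
        refine hmin (i0, ρ ⟨i + 1, hi⟩) ?_
        simp only [T, Finset.mem_filter, Finset.mem_univ, true_and]
        rw [← hρ0]
        intro e
        have := Fin.mk.inj (ρ.injective e)
        omega
    · rw [nsq_pc, prs_card_comp]

theorem fpf_sum {n : ℕ} {σ : Equiv.Perm (Fin n)} (h : ∀ x, σ x ≠ x) : σ.cycleType.sum = n := by
  rw [Equiv.Perm.sum_cycleType]
  have : σ.support = Finset.univ := by
    ext x; simp [h x]
  rw [this]; simp

theorem parts (s : Multiset ℕ) (h : ∀ x ∈ s, 2 ≤ x) (h6 : s.sum ≤ 6) (h2 : 2 ≤ s.sum) :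
    s = {s.sum} ∨ (∃ a b, 2 ≤ a ∧ a ≤ b ∧ a + b = s.sum ∧ s = {a, b}) ∨
      s.sum = 6 ∧ s = {2, 2, 2} := by
  induction s using Quotient.inductionOn with
  | h l =>
    match l, h, h6, h2 with
    | [], h, h6, h2 => simp at h2
    | [a], h, h6, h2 => left; simp
    | [a, b], h, h6, h2 =>
      right; left
      have ha := h a (by simp)
      have hb := h b (by simp)
      rcases le_total a b with hab | hab
      · exact ⟨a, b, ha, hab, by simp, rfl⟩
      · exact ⟨b, a, hb, hab, by simp [Nat.add_comm], by
          rw [Multiset.pair_comm]; rfl⟩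
    | [a, b, c], h, h6, h2 =>
      right; right
      have ha := h a (by simp)
      have hb := h b (by simp)
      have hc := h c (by simp)
      simp at h6
      have e1 : a = 2 := by omega
      have e2 : b = 2 := by omega
      have e3 : c = 2 := by omega
      subst e1 e2 e3
      exact ⟨rfl, rfl⟩
    | a :: b :: c :: d :: l, h, h6, h2 =>
      have ha := h a (by simp)
      have hb := h b (by simp)
      have hc := h c (by simp)
      have hd := h d (by simp)
      simp at h6
      omega

/-- Canonical permutations. -/
def can (n : ℕ) (f g : Fin n → Fin n) (h1 : ∀ x, g (f x) = x) (h2 : ∀ x, f (g x) = x) :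
    Equiv.Perm (Fin n) := ⟨f, g, h1, h2⟩

/-- The canonical permutations cover all permutations without fixed points. -/
theorem conj_of {n : ℕ} {σ τ : Equiv.Perm (Fin n)} {s : Multiset ℕ} (h : σ.cycleType = s)
    (h' : τ.cycleType = s) : IsConj σ τ := by
  rw [Equiv.Perm.isConj_iff_cycleType_eq, h, h']

theorem no_of {n bad r : ℕ} (hn : 2 ≤ n) (H : ∀ σ : Equiv.Perm (Fin n), (∀ x, σ x ≠ x) →
    ∃ τ : Equiv.Perm (Fin n), IsConj σ τ ∧ ((τ ⟨0, by omega⟩ : Fin n) : ℕ) = 1 ∧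
      ∃ c : ℕ → ℕ, (∀ j : Fin n, c j = τ j) ∧
        ∀ A B, Nrm n c A B → bad.testBit (pc n A B) = false) (h : Sp n r) :
    bad.testBit r = false := by
  rw [sp_iff_fin] at h
  obtain ⟨A, B, hA, hB, rfl⟩ := h
  obtain ⟨σ, hσ, hh⟩ := normalize hn hA hB
  obtain ⟨τ, h1, h2, c, h3, h4⟩ := H σ hσ
  obtain ⟨A', B', h5, h6⟩ := hh τ h1 h2
  rw [← h6]
  exact h4 A' B' (h5 c h3)

theorem cyc_parts {n : ℕ} (hn : 2 ≤ n) (hn6 : n ≤ 6) {σ : Equiv.Perm (Fin n)} (h : ∀ x, σ x ≠ x) :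
    σ.cycleType = {n} ∨ (∃ a b, 2 ≤ a ∧ a ≤ b ∧ a + b = n ∧ σ.cycleType = {a, b}) ∨
      n = 6 ∧ σ.cycleType = {2, 2, 2} := by
  have := parts σ.cycleType (fun x hx => Equiv.Perm.two_le_of_mem_cycleType hx)
    (by rw [fpf_sum h]; exact hn6) (by rw [fpf_sum h]; exact hn)
  rwa [fpf_sum h] at this
end ROrth

namespace ROrth
open Finset Function

/-! ### The searches -/

set_option maxRecDepth 100000

theorem s2a : search 2 16 (List.range 2) (List.range' 1 (2 - 1)) (fnl [1, 0]) = true := by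
  decide +kernel

theorem no_2 {r : ℕ} (h : Sp 2 r) : Nat.testBit 16 r = false := by
  refine no_of (by norm_num) (fun σ hσ => ?_) h
  rcases cyc_parts (by norm_num) (by norm_num) hσ with hc | ⟨a, b, ha, hb, hab, hc⟩ | ⟨h6, hc⟩
  · exact ⟨can 2 ![1, 0] ![1, 0] (by decide) (by decide), conj_of hc (by decide +kernel),
      by decide, fnl [1, 0], by decide, fun A B h => search_sound h (by norm_num) (by norm_num) s2a⟩
  · omega
  · omega

theorem s3a : search 3 224 (List.range 3) (List.range' 1 (3 - 1)) (fnl [1, 2, 0]) = true := by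
  decide +kernel

theorem no_3 {r : ℕ} (h : Sp 3 r) : Nat.testBit 224 r = false := by
  refine no_of (by norm_num) (fun σ hσ => ?_) h
  rcases cyc_parts (by norm_num) (by norm_num) hσ with hc | ⟨a, b, ha, hb, hab, hc⟩ | ⟨h6, hc⟩
  · exact ⟨can 3 ![1, 2, 0] ![2, 0, 1] (by decide) (by decide), conj_of hc (by decide +kernel),
      by decide, fnl [1, 2, 0], by decide, fun A B h => search_sound h (by norm_num) (by norm_num) s3a⟩
  · omega
  · omega

theorem s4a : search 4 27776 (List.range 4) (List.range' 1 (4 - 1)) (fnl [1, 2, 3, 0]) = true := by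
  decide +kernel

theorem s4b : search 4 27776 (List.range 4) (List.range' 1 (4 - 1)) (fnl [1, 0, 3, 2]) = true := by
  decide +kernel

theorem no_4 {r : ℕ} (h : Sp 4 r) : Nat.testBit 27776 r = false := by
  refine no_of (by norm_num) (fun σ hσ => ?_) h
  rcases cyc_parts (by norm_num) (by norm_num) hσ with hc | ⟨a, b, ha, hb, hab, hc⟩ | ⟨h6, hc⟩
  · exact ⟨can 4 ![1, 2, 3, 0] ![3, 0, 1, 2] (by decide) (by decide), conj_of hc (by decide +kernel),
      by decide, fnl [1, 2, 3, 0], by decide, fun A B h => search_sound h (by norm_num) (by norm_num) s4a⟩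
  · obtain ⟨rfl, rfl⟩ : a = 2 ∧ b = 2 := by omega
    exact ⟨can 4 ![1, 0, 3, 2] ![1, 0, 3, 2] (by decide) (by decide), conj_of hc (by decide +kernel),
      by decide, fnl [1, 0, 3, 2], by decide, fun A B h => search_sound h (by norm_num) (by norm_num) s4b⟩
  · omega

theorem s5a : search 5 13632256 (List.range 5) (List.range' 1 (5 - 1)) (fnl [1, 2, 3, 4, 0]) = true := by
  decide +kernel

theorem s5b : search 5 13632256 (List.range 5) (List.range' 1 (5 - 1)) (fnl [1, 0, 3, 4, 2]) = true := by
  decide +kernel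

theorem no_5 {r : ℕ} (h : Sp 5 r) : Nat.testBit 13632256 r = false := by
  refine no_of (by norm_num) (fun σ hσ => ?_) h
  rcases cyc_parts (by norm_num) (by norm_num) hσ with hc | ⟨a, b, ha, hb, hab, hc⟩ | ⟨h6, hc⟩
  · exact ⟨can 5 ![1, 2, 3, 4, 0] ![4, 0, 1, 2, 3] (by decide) (by decide), conj_of hc (by decide +kernel),
      by decide, fnl [1, 2, 3, 4, 0], by decide, fun A B h => search_sound h (by norm_num) (by norm_num) s5a⟩
  · obtain ⟨rfl, rfl⟩ : a = 2 ∧ b = 3 := by omega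
    exact ⟨can 5 ![1, 0, 3, 4, 2] ![1, 0, 4, 2, 3] (by decide) (by decide), conj_of hc (by decide +kernel),
      by decide, fnl [1, 0, 3, 4, 2], by decide, fun A B h => search_sound h (by norm_num) (by norm_num) s5b⟩
  · omega

theorem s6a : search6 77309411328 [0, 1, 2, 3, 4, 5] [1, 2, 3, 4, 5] (fnl [1, 2, 3, 4, 5, 0]) = true := by
  decide +kernel

theorem s6b : search6 77309411328 [0, 1, 2, 3, 4, 5] [1, 2, 3, 4, 5] (fnl [1, 0, 3, 4, 5, 2]) = true := by
  decide +kernel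

theorem s6c : search6 77309411328 [0, 1, 2, 3, 4, 5] [1, 2, 3, 4, 5] (fnl [1, 2, 0, 4, 5, 3]) = true := by
  decide +kernel

theorem s6d : search6 77309411328 [0, 1, 2, 3, 4, 5] [1, 2, 3, 4, 5] (fnl [1, 0, 3, 2, 5, 4]) = true := by
  decide +kernel

theorem no_6 {r : ℕ} (h : Sp 6 r) : Nat.testBit 77309411328 r = false := by
  refine no_of (by norm_num) (fun σ hσ => ?_) h
  rcases cyc_parts (by norm_num) (by norm_num) hσ with hc | ⟨a, b, ha, hb, hab, hc⟩ | ⟨h6, hc⟩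
  · exact ⟨can 6 ![1, 2, 3, 4, 5, 0] ![5, 0, 1, 2, 3, 4] (by decide) (by decide), conj_of hc (by decide +kernel),
      by decide, fnl [1, 2, 3, 4, 5, 0], by decide, fun A B h => search6_sound h (by decide +kernel) s6a⟩
  · obtain ⟨rfl, rfl⟩ | ⟨rfl, rfl⟩ : (a = 2 ∧ b = 4) ∨ (a = 3 ∧ b = 3) := by omega
    · exact ⟨can 6 ![1, 0, 3, 4, 5, 2] ![1, 0, 5, 2, 3, 4] (by decide) (by decide), conj_of hc (by decide +kernel),
      by decide, fnl [1, 0, 3, 4, 5, 2], by decide, fun A B h => search6_sound h (by decide +kernel) s6b⟩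
    · exact ⟨can 6 ![1, 2, 0, 4, 5, 3] ![2, 0, 1, 5, 3, 4] (by decide) (by decide), conj_of hc (by decide +kernel),
      by decide, fnl [1, 2, 0, 4, 5, 3], by decide, fun A B h => search6_sound h (by decide +kernel) s6c⟩
  · exact ⟨can 6 ![1, 0, 3, 2, 5, 4] ![1, 0, 3, 2, 5, 4] (by decide) (by decide), conj_of hc (by decide +kernel),
      by decide, fnl [1, 0, 3, 2, 5, 4], by decide, fun A B h => search6_sound h (by decide +kernel) s6d⟩

end ROrth

namespace ROrth
open Finset Function

/-! ### General restrictions -/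

theorem LatT.surj {n : ℕ} {A : Fin n → Fin n → Fin n} (h : LatT A) (i : Fin n) :
    Surjective (A i) := Finite.injective_iff_surjective.1 (h.1 i)

theorem mem_prs {n : ℕ} {A B : Fin n → Fin n → Fin n} (i j : Fin n) : (A i j, B i j) ∈ prs A B :=
  Finset.mem_image.2 ⟨(i, j), Finset.mem_univ _, rfl⟩

/-- The pairs of one row. -/
def rowp {n : ℕ} (A B : Fin n → Fin n → Fin n) (i : Fin n) : Finset (Fin n × Fin n) :=
  Finset.univ.image fun j => (A i j, B i j)

theorem rowp_card {n : ℕ} {A : Fin n → Fin n → Fin n} (B : Fin n → Fin n → Fin n) (hA : LatT A)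
    (i : Fin n) : (rowp A B i).card = n := by
  unfold rowp
  rw [Finset.card_image_of_injective, Finset.card_fin]
  intro x y e
  exact hA.1 i (Prod.mk.inj e).1

theorem rowp_sub {n : ℕ} (A B : Fin n → Fin n → Fin n) (i : Fin n) : rowp A B i ⊆ prs A B := by
  intro x hx
  obtain ⟨j, _, rfl⟩ := Finset.mem_image.1 hx
  exact mem_prs i j

theorem ge_n {n r : ℕ} (hn : 2 ≤ n) (h : Sp n r) : n ≤ r := by
  obtain ⟨A, B, hA, hB, rfl⟩ := sp_iff_fin.1 h
  exact (rowp_card B hA ⟨0, by omega⟩).symm.le.trans (Finset.card_le_card (rowp_sub A B _))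

theorem le_sq {n r : ℕ} (h : Sp n r) : r ≤ n ^ 2 := by
  obtain ⟨A, B, hA, hB, rfl⟩ := sp_iff_fin.1 h
  refine (Finset.card_le_univ _).trans ?_
  simp [sq]

theorem ne_succ {n r : ℕ} (hn : 2 ≤ n) (h : Sp n r) : r ≠ n + 1 := by
  obtain ⟨A, B, hA, hB, rfl⟩ := sp_iff_fin.1 h
  intro hc
  let z : Fin n := ⟨0, by omega⟩
  have hd : (prs A B \ rowp A B z).card = 1 := by
    rw [Finset.card_sdiff_of_subset (rowp_sub A B z), rowp_card B hA, hc]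
    omega
  obtain ⟨⟨a, b⟩, hab⟩ := Finset.card_eq_one.1 hd
  have hm : (a, b) ∈ prs A B \ rowp A B z := by rw [hab]; simp
  obtain ⟨hm1, hm2⟩ := Finset.mem_sdiff.1 hm
  obtain ⟨⟨i, j⟩, _, e⟩ := Finset.mem_image.1 hm1
  obtain ⟨e1, e2⟩ := Prod.mk.inj e
  simp only at e1 e2
  obtain ⟨j', hj'⟩ := hB.surj z b
  obtain ⟨k, hk⟩ := hA.surj i (A z j')
  have hne : A z j' ≠ a := by
    intro h
    apply hm2
    exact Finset.mem_image.2 ⟨j', Finset.mem_univ _, by rw [h, hj']⟩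
  have hin : (A i k, B i k) ∈ rowp A B z := by
    by_contra hnot
    have : (A i k, B i k) ∈ prs A B \ rowp A B z := Finset.mem_sdiff.2 ⟨mem_prs i k, hnot⟩
    rw [hab, Finset.mem_singleton] at this
    have := (Prod.mk.inj this).1
    rw [hk] at this
    exact hne this
  obtain ⟨l, _, el⟩ := Finset.mem_image.1 hin
  obtain ⟨el1, el2⟩ := Prod.mk.inj el
  have : l = j' := hA.1 z (by rw [el1, hk])
  subst this
  have : k = j := hB.1 i (by rw [← el2, hj', e2])
  subst this
  exact hne (by rw [← hk, e1])

theorem ne_pred {n r : ℕ} (hn : 2 ≤ n) (h : Sp n r) : r ≠ n ^ 2 - 1 := by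
  obtain ⟨A, B, hA, hB, rfl⟩ := sp_iff_fin.1 h
  intro hc
  have hd : (prs A B)ᶜ.card = 1 := by
    have h4 : 4 ≤ n * n := by nlinarith
    rw [Finset.card_compl, hc]
    simp only [Fintype.card_prod, Fintype.card_fin, sq]
    omega
  obtain ⟨⟨x, y⟩, hxy⟩ := Finset.card_eq_one.1 hd
  have hmiss : ∀ a b, (a, b) ∉ prs A B → a = x ∧ b = y := by
    intro a b hab
    have : (a, b) ∈ (prs A B)ᶜ := Finset.mem_compl.2 hab
    rw [hxy, Finset.mem_singleton] at this
    exact Prod.mk.inj this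
  have hx : (x, y) ∉ prs A B := by
    have : (x, y) ∈ (prs A B)ᶜ := by rw [hxy]; simp
    exact Finset.mem_compl.1 this
  choose J hJ using fun i => hB.surj i y
  have hax : ∀ i, A i (J i) ≠ x := by
    intro i e
    apply hx
    rw [← e, ← hJ i]
    exact mem_prs i (J i)
  have hns : ¬ Surjective fun i => A i (J i) := fun hs => by
    obtain ⟨i, hi⟩ := hs x
    exact hax i hi
  rw [← Finite.injective_iff_surjective] at hns
  obtain ⟨i, i', he, hii⟩ : ∃ i i', A i (J i) = A i' (J i') ∧ i ≠ i' := by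
    by_contra hcon
    push Not at hcon
    exact hns fun i i' e => hcon i i' e
  choose K hK using fun k => hA.surj k (A i (J i))
  have hKi : K i = J i := hA.1 i (hK i)
  have hKi' : K i' = J i' := hA.1 i' (by rw [hK i', he])
  have hni : ¬ Injective fun k => B k (K k) := by
    intro hinj
    apply hii
    apply hinj
    simp only
    rw [hKi, hKi', hJ, hJ]
  rw [Finite.injective_iff_surjective] at hni
  obtain ⟨z, hz⟩ : ∃ z, ∀ k, B k (K k) ≠ z := by
    by_contra hcon
    push Not at hcon
    exact hni hcon
  have hp : (A i (J i), z) ∉ prs A B := by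
    intro hm
    obtain ⟨⟨k, l⟩, _, e⟩ := Finset.mem_image.1 hm
    obtain ⟨e1, e2⟩ := Prod.mk.inj e
    simp only at e1 e2
    have : K k = l := hA.1 k (by rw [hK k, e1])
    exact hz k (by rw [this, e2])
  exact hax i (hmiss _ _ hp).1

/-! ### All orders at least seven -/

theorem wil {n h t u : ℕ} (hF : ∀ m, 7 ≤ m → m < n → Full m) (hn : n = 3 * h - 1)
    (h1 : 3 * t + u = n) (hh : 7 ≤ h) (h2 : t % 2 = 1) (h3 : t % 3 ≠ 0) (hu : u ≤ t) (hu7 : 7 ≤ u)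
    (hd : 4 * h + u + 1 ≤ u ^ 2) : Full n := by
  subst hn
  exact full_wilson hh (hF h hh (by omega)) (Nat.odd_iff.2 h2)
    ((Nat.Prime.coprime_iff_not_dvd Nat.prime_three).2 fun hdv => h3 (Nat.mod_eq_zero_of_dvd hdv))
    hu hu7 h1 (hF u hu7 (by omega)) hd

theorem full_big {n : ℕ} (hF : ∀ m, 7 ≤ m → m < n → Full m) (hn : 101 ≤ n) (h3 : n % 3 = 2) :
    Full n := by
  obtain ⟨t, h1, h2, h4, h5⟩ : ∃ t, (n + 3) / 4 ≤ t ∧ t ≤ (n + 3) / 4 + 3 ∧ t % 2 = 1 ∧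
      t % 3 ≠ 0 := by
    generalize (n + 3) / 4 = m
    rcases (by omega : m % 6 = 0 ∨ m % 6 = 1 ∨ m % 6 = 2 ∨ m % 6 = 3 ∨ m % 6 = 4 ∨ m % 6 = 5) with
      h | h | h | h | h | h
    · exact ⟨m + 1, by omega, by omega, by omega, by omega⟩
    · exact ⟨m, by omega, by omega, by omega, by omega⟩
    · exact ⟨m + 3, by omega, by omega, by omega, by omega⟩
    · exact ⟨m + 2, by omega, by omega, by omega, by omega⟩
    · exact ⟨m + 1, by omega, by omega, by omega, by omega⟩
    · exact ⟨m, by omega, by omega, by omega, by omega⟩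
  obtain ⟨u, hu⟩ : ∃ u, 3 * t + u = n := ⟨n - 3 * t, by omega⟩
  have hu14 : 14 ≤ u := by omega
  have hnu : n ≤ 4 * u + 48 := by omega
  refine wil (h := (n + 1) / 3) hF (by omega) hu (by omega) h4 h5 (by omega) (by omega) ?_
  have : 14 * u ≤ u ^ 2 := by nlinarith
  omega

theorem full_77 (h26 : Full 26) (h11 : Full 11) : Full 77 := by
  refine full_res2 (h := 26) (by norm_num) h26 fun d hd1 hd2 => ?_
  exact top_prod' (a := 7) (b := 11) (by decide) (by norm_num) h11 hd1 (by norm_num; omega)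

theorem full_all (n : ℕ) (hn : 7 ≤ n) : Full n := by
  induction n using Nat.strong_induction_on with
  | _ n ih =>
    have hF : ∀ m, 7 ≤ m → m < n → Full m := fun m h1 h2 => ih m h2 h1
    by_cases h20 : n ≤ 20
    · interval_cases n
      · exact full_7
      · exact full_8
      · exact full_9
      · exact full_10
      · exact full_11
      · exact full_12
      · exact full_13
      · exact full_14
      · exact full_15
      · exact full_16
      · exact full_17
      · exact full_18
      · exact full_19
      · exact full_20
    rcases (by omega : n % 3 = 0 ∨ n % 3 = 1 ∨ n % 3 = 2) with h | h | h
    · by_cases h21 : n = 21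
      · subst h21; exact full21 full_7 full_8
      · have := full_mul3 (b := n / 3) (by omega) (hF _ (by omega) (by omega))
          (hF _ (by omega) (by omega))
        rwa [show 3 * (n / 3) = n by omega] at this
    · have := res1 (h := n / 3) (by omega) (hF _ (by omega) (by omega))
      rwa [show 3 * (n / 3) + 1 = n by omega] at this
    · by_cases h101 : 101 ≤ n
      · exact full_big hF h101 h
      · obtain ⟨k, rfl⟩ : ∃ k, n = 3 * k + 2 := ⟨n / 3, by omega⟩
        have hk1 : 7 ≤ k := by omega
        have hk2 : k ≤ 32 := by omega
        have hG : ∀ m, 7 ≤ m → m < 3 * k + 2 → Full m := hF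
        clear hF ih hn h20 h h101
        interval_cases k
        · exact full_23 full_8 full_7
        · exact full_26 full_9 full_7
        · exact full_29 full_10 full_8
        · exact full_32 full_11 full_9
        · exact full_35 full_12 full_10
        · exact full_38 full_13 full_11
        · exact full_41 full_14 full_12
        · exact wil (h := 15) (t := 11) (u := 11) hG (by norm_num) (by norm_num) (by norm_num)
            (by norm_num) (by norm_num) (by norm_num) (by norm_num) (by norm_num)
        · exact full_47 full_16 full_14
        · exact wil (h := 17) (t := 13) (u := 11) hG (by norm_num) (by norm_num) (by norm_num)
            (by norm_num) (by norm_num) (by norm_num) (by norm_num) (by norm_num)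
        · exact full_53 full_18 full_16
        · exact full_56 full_19 full_17
        · exact full_59 full_20 full_18
        · exact wil (h := 21) (t := 17) (u := 11) hG (by norm_num) (by norm_num) (by norm_num)
            (by norm_num) (by norm_num) (by norm_num) (by norm_num) (by norm_num)
        · exact wil (h := 22) (t := 17) (u := 14) hG (by norm_num) (by norm_num) (by norm_num)
            (by norm_num) (by norm_num) (by norm_num) (by norm_num) (by norm_num)
        · exact wil (h := 23) (t := 17) (u := 17) hG (by norm_num) (by norm_num) (by norm_num)
            (by norm_num) (by norm_num) (by norm_num) (by norm_num) (by norm_num)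
        · exact wil (h := 24) (t := 19) (u := 14) hG (by norm_num) (by norm_num) (by norm_num)
            (by norm_num) (by norm_num) (by norm_num) (by norm_num) (by norm_num)
        · exact wil (h := 25) (t := 19) (u := 17) hG (by norm_num) (by norm_num) (by norm_num)
            (by norm_num) (by norm_num) (by norm_num) (by norm_num) (by norm_num)
        · exact full_77 (hG 26 (by norm_num) (by norm_num)) full_11
        · exact wil (h := 27) (t := 23) (u := 11) hG (by norm_num) (by norm_num) (by norm_num)
            (by norm_num) (by norm_num) (by norm_num) (by norm_num) (by norm_num)
        · exact wil (h := 28) (t := 23) (u := 14) hG (by norm_num) (by norm_num) (by norm_num)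
            (by norm_num) (by norm_num) (by norm_num) (by norm_num) (by norm_num)
        · exact wil (h := 29) (t := 23) (u := 17) hG (by norm_num) (by norm_num) (by norm_num)
            (by norm_num) (by norm_num) (by norm_num) (by norm_num) (by norm_num)
        · exact wil (h := 30) (t := 23) (u := 20) hG (by norm_num) (by norm_num) (by norm_num)
            (by norm_num) (by norm_num) (by norm_num) (by norm_num) (by norm_num)
        · exact wil (h := 31) (t := 23) (u := 23) hG (by norm_num) (by norm_num) (by norm_num)
            (by norm_num) (by norm_num) (by norm_num) (by norm_num) (by norm_num)
        · exact wil (h := 32) (t := 25) (u := 20) hG (by norm_num) (by norm_num) (by norm_num)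
            (by norm_num) (by norm_num) (by norm_num) (by norm_num) (by norm_num)
        · exact wil (h := 33) (t := 25) (u := 23) hG (by norm_num) (by norm_num) (by norm_num)
            (by norm_num) (by norm_num) (by norm_num) (by norm_num) (by norm_num)

theorem sp_2 : Sp 2 2 := by
  rw [sp_iff_fin]
  exact ⟨fun i j => i + j, fun i j => i + j,
    ⟨fun i => add_right_injective i, fun j => add_left_injective j⟩,
    ⟨fun i => add_right_injective i, fun j => add_left_injective j⟩, by decide⟩

theorem small_3 : ∀ r : ℕ, r < 10 → 3 ≤ r →
    r ∈ [4, 8] ∨ r ∈ [5, 6, 7] ∨ r ∈ [3, 9] := by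
  decide +kernel

theorem small_4 : ∀ r : ℕ, r < 17 → 4 ≤ r →
    r ∈ [5, 15] ∨ r ∈ [7, 10, 11, 13, 14] ∨ r ∈ [4, 6, 8, 9, 12, 16] := by
  decide +kernel

theorem small_5 : ∀ r : ℕ, r < 26 → 5 ≤ r →
    r ∈ [6, 24] ∨ r ∈ [8, 9, 20, 22, 23] ∨ r ∈ [5, 7, 10, 11, 12, 13, 14, 15, 16, 17, 18, 19, 21, 25] := by
  decide +kernel

theorem small_6 : ∀ r : ℕ, r < 37 → 6 ≤ r →
    r ∈ [7, 35] ∨ r ∈ [33, 36] ∨ r ∈ [6, 8, 9, 10, 11, 12, 13, 14, 15, 16, 17, 18, 19, 20, 21, 22, 23, 24, 25, 26, 27, 28, 29, 30, 31, 32, 34] := by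
  decide +kernel

theorem small_all {n r : ℕ} (hn : 2 ≤ n) (h7 : ¬ 7 ≤ n) (h1 : n ≤ r) (h2 : r ≤ n ^ 2)
    (h3 : r ≠ n + 1) (h4 : r ≠ n ^ 2 - 1)
    (h5 : (n, r) ∉ [(2, 4), (3, 5), (3, 6), (3, 7), (4, 7), (4, 10), (4, 11), (4, 13),
      (4, 14), (5, 8), (5, 9), (5, 20), (5, 22), (5, 23), (6, 33), (6, 36)]) : Sp n r := by
  obtain rfl | rfl | rfl | rfl | rfl : n = 2 ∨ n = 3 ∨ n = 4 ∨ n = 5 ∨ n = 6 := by omega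
  · have h6 : r ≠ 4 := by
      rintro rfl
      exact h5 (by decide)
    clear h5
    obtain rfl : r = 2 := by omega
    exact sp_2
  · rcases small_3 r (Nat.lt_succ_of_le h2) h1 with h | h | h
    · clear h5
      simp only [List.mem_cons, List.not_mem_nil, or_false] at h
      omega
    · simp only [List.mem_cons, List.not_mem_nil, or_false] at h
      rcases h with rfl | rfl | rfl <;> exact absurd (by decide) h5
    · exact sp_3 h
  · rcases small_4 r (Nat.lt_succ_of_le h2) h1 with h | h | h
    · clear h5
      simp only [List.mem_cons, List.not_mem_nil, or_false] at h
      omega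
    · simp only [List.mem_cons, List.not_mem_nil, or_false] at h
      rcases h with rfl | rfl | rfl | rfl | rfl <;> exact absurd (by decide) h5
    · exact sp_4 h
  · rcases small_5 r (Nat.lt_succ_of_le h2) h1 with h | h | h
    · clear h5
      simp only [List.mem_cons, List.not_mem_nil, or_false] at h
      omega
    · simp only [List.mem_cons, List.not_mem_nil, or_false] at h
      rcases h with rfl | rfl | rfl | rfl | rfl <;> exact absurd (by decide) h5
    · exact sp_5 h
  · rcases small_6 r (Nat.lt_succ_of_le h2) h1 with h | h | h
    · clear h5
      simp only [List.mem_cons, List.not_mem_nil, or_false] at h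
      omega
    · simp only [List.mem_cons, List.not_mem_nil, or_false] at h
      rcases h with rfl | rfl <;> exact absurd (by decide) h5
    · exact sp_6 h

end ROrth

theorem r_orthogonal_spectrum (n : ℕ) (hn : 2 ≤ n) (r : ℕ) :
    (∃ A B : Fin n → Fin n → Fin n,
        IsLatinSquare A ∧ IsLatinSquare B ∧ orthCount A B = r) ↔
      (n ≤ r ∧ r ≤ n ^ 2 ∧ r ≠ n + 1 ∧ r ≠ n ^ 2 - 1 ∧
        (n, r) ∉ ({(2, 4), (3, 5), (3, 6), (3, 7), (4, 7), (4, 10), (4, 11), (4, 13),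
          (4, 14), (5, 8), (5, 9), (5, 20), (5, 22), (5, 23), (6, 33), (6, 36)} :
          Set (ℕ × ℕ))) := by
  change ROrth.Sp n r ↔ _
  constructor
  · intro h
    refine ⟨ROrth.ge_n hn h, ROrth.le_sq h, ROrth.ne_succ hn h, ROrth.ne_pred hn h, ?_⟩
    intro hm
    simp only [Set.mem_insert_iff, Set.mem_singleton_iff, Prod.mk.injEq] at hm
    rcases hm with ⟨rfl, rfl⟩ | ⟨rfl, rfl⟩ | ⟨rfl, rfl⟩ | ⟨rfl, rfl⟩ | ⟨rfl, rfl⟩ | ⟨rfl, rfl⟩ |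
      ⟨rfl, rfl⟩ | ⟨rfl, rfl⟩ | ⟨rfl, rfl⟩ | ⟨rfl, rfl⟩ | ⟨rfl, rfl⟩ | ⟨rfl, rfl⟩ | ⟨rfl, rfl⟩ |
      ⟨rfl, rfl⟩ | ⟨rfl, rfl⟩ | ⟨rfl, rfl⟩
    · exact absurd (ROrth.no_2 h) (by decide)
    · exact absurd (ROrth.no_3 h) (by decide)
    · exact absurd (ROrth.no_3 h) (by decide)
    · exact absurd (ROrth.no_3 h) (by decide)
    · exact absurd (ROrth.no_4 h) (by decide)
    · exact absurd (ROrth.no_4 h) (by decide)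
    · exact absurd (ROrth.no_4 h) (by decide)
    · exact absurd (ROrth.no_4 h) (by decide)
    · exact absurd (ROrth.no_4 h) (by decide)
    · exact absurd (ROrth.no_5 h) (by decide)
    · exact absurd (ROrth.no_5 h) (by decide)
    · exact absurd (ROrth.no_5 h) (by decide)
    · exact absurd (ROrth.no_5 h) (by decide)
    · exact absurd (ROrth.no_5 h) (by decide)
    · exact absurd (ROrth.no_6 h) (by decide)
    · exact absurd (ROrth.no_6 h) (by decide)
  · rintro ⟨h1, h2, h3, h4, h5⟩
    by_cases h7 : 7 ≤ n
    · exact ROrth.full_all n h7 r h1 h2 h3 h4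
    exact ROrth.small_all hn h7 h1 h2 h3 h4 (fun h => h5 (by simpa using h))
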